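/- Theorem D. Let α > 0. Let γ : (0,π] → (0,1] be a differentiable increasing function with γ(t) → 0 as t → 0⁺ such that t ↦ γ(t)/t is increasing, γ′(t) = O(γ(t)/t) as t → 0⁺, and γ(t) = O(t/log^β(1/t)) for some β > 1/2. Let Ω ⊆ 𝔻 be a simply connected domain with 0 ∈ Ω and ∂Ω ∩ ∂𝔻 = {1}, whose boundary has, in a neighborhood of 1, the polar equation 1−r = γ(|θ|), and let φ be a conformal map of 𝔻 onto Ω with φ(0) = 0. Set Γ(t) = (2/π)∫_t^1 γ(s)/s² ds and suppose ∫_0 γ(t)/t² dt = ∞. Then: (1) if γ(t)log(1/t)/t → ∞ as t → 0⁺, then s_n(C_φ, ℋ_α) = O(1/n^A) for every A > 0; (2) if γ(t)log(1/t)/t = O(1) as t → 0⁺, then s_n(C_φ, ℋ_α) ≍ exp(−(α/2)Γ(x_n)), where x_n ∈ (0,π) is defined (for large n) by ∫_{x_n}^π dt/γ(t) = n. -/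

import Mathlib

open MeasureTheory Metric Filter Set
open scoped ENNReal Topology

noncomputable section

/-- `approxNum T n = inf{‖T - R‖ : rank R ≤ n}`, the `(n+1)`-th approximation number
(= `(n+1)`-th singular value `s_{n+1}(T)` of a compact operator `T`). -/
noncomputable def approxNum {H : Type} [NormedAddCommGroup H] [InnerProductSpace ℂ H]
    (T : H →L[ℂ] H) (n : ℕ) : ℝ :=
  sInf {c : ℝ | ∃ R : H →L[ℂ] H,
      FiniteDimensional ℂ (LinearMap.range R.toLinearMap) ∧
      Module.finrank ℂ (LinearMap.range R.toLinearMap) ≤ n ∧ c = ‖T - R‖}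

/-- `H1`, realized via `e1` as a space of functions, is the space `ℋ_ω` of holomorphic
functions on `𝔻` with `‖f‖² = |f(0)|² + ∫_𝔻 |f′|² ω² dA < ∞`. -/
structure IsHSpace (ω : ℂ → ℝ) {H1 : Type}
    [NormedAddCommGroup H1] [InnerProductSpace ℂ H1] [CompleteSpace H1]
    (e : H1 →ₗ[ℂ] (ℂ → ℂ)) : Prop where
  holo : ∀ f : H1, DifferentiableOn ℂ (e f) (ball (0 : ℂ) 1)
  inj : ∀ f : H1, (∀ z ∈ ball (0 : ℂ) 1, e f z = 0) → f = 0
  norm_sq : ∀ f : H1, ‖f‖ ^ 2 =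
    ‖e f 0‖ ^ 2 + ∫ z in ball (0 : ℂ) 1, ‖deriv (e f) z‖ ^ 2 * ω z ^ 2
  surj : ∀ g : ℂ → ℂ, DifferentiableOn ℂ g (ball (0 : ℂ) 1) →
    (∫⁻ z in ball (0 : ℂ) 1, ENNReal.ofReal (‖deriv g z‖ ^ 2 * ω z ^ 2)) < ⊤ →
    ∃ f : H1, ∀ z ∈ ball (0 : ℂ) 1, e f z = g z

/-- `Γ(t) = (2/π) ∫_t^1 γ(s)/s² ds`. -/
noncomputable def Gam (γf : ℝ → ℝ) (t : ℝ) : ℝ :=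
  (2 / Real.pi) * ∫ s in t..(1 : ℝ), γf s / s ^ 2

section Approx

variable {H : Type} [NormedAddCommGroup H] [InnerProductSpace ℂ H]

lemma approxNum_set_bddBelow (T : H →L[ℂ] H) (n : ℕ) :
    BddBelow {c : ℝ | ∃ R : H →L[ℂ] H,
      FiniteDimensional ℂ (LinearMap.range R.toLinearMap) ∧
      Module.finrank ℂ (LinearMap.range R.toLinearMap) ≤ n ∧ c = ‖T - R‖} :=
  ⟨0, by rintro c ⟨R, -, -, rfl⟩; exact norm_nonneg _⟩

lemma approxNum_set_nonempty (T : H →L[ℂ] H) (n : ℕ) :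
    {c : ℝ | ∃ R : H →L[ℂ] H,
      FiniteDimensional ℂ (LinearMap.range R.toLinearMap) ∧
      Module.finrank ℂ (LinearMap.range R.toLinearMap) ≤ n ∧ c = ‖T - R‖}.Nonempty := by
  refine ⟨‖T - 0‖, 0, ?_, ?_, rfl⟩
  · rw [ContinuousLinearMap.toLinearMap_zero, LinearMap.range_zero]; infer_instance
  · rw [ContinuousLinearMap.toLinearMap_zero, LinearMap.range_zero]; simp

lemma approxNum_nonneg (T : H →L[ℂ] H) (n : ℕ) : 0 ≤ approxNum T n :=
  Real.sInf_nonneg (by rintro c ⟨R, -, -, rfl⟩; exact norm_nonneg _)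

lemma approxNum_le_norm (T : H →L[ℂ] H) (n : ℕ) : approxNum T n ≤ ‖T‖ := by
  refine csInf_le (approxNum_set_bddBelow T n) ⟨0, ?_, ?_, by simp⟩
  · rw [ContinuousLinearMap.toLinearMap_zero, LinearMap.range_zero]; infer_instance
  · rw [ContinuousLinearMap.toLinearMap_zero, LinearMap.range_zero]; simp

/-- If `T` is bounded by `c` on the common kernel of at most `n` functionals then its `n`-th
approximation number is at most `c`. -/
lemma approxNum_le_of_functionals [CompleteSpace H] (T : H →L[ℂ] H) {n : ℕ} {ι : Type*} [Fintype ι]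
    (hn : Fintype.card ι ≤ n) (l : ι → H →L[ℂ] ℂ) {c : ℝ} (hc : 0 ≤ c)
    (h : ∀ f, (∀ i, l i f = 0) → ‖T f‖ ≤ c * ‖f‖) : approxNum T n ≤ c := by
  set L : H →L[ℂ] (ι → ℂ) := ContinuousLinearMap.pi l with hL
  set K : Submodule ℂ H := LinearMap.ker L.toLinearMap with hK
  have hKc : IsClosed (K : Set H) := L.isClosed_ker
  have : CompleteSpace K := hKc.completeSpace_coe
  have hinj : Function.Injective (L.toLinearMap.comp Kᗮ.subtype) := by
    rw [← LinearMap.ker_eq_bot, LinearMap.ker_eq_bot']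
    intro x hx
    have h1 : (x : H) ∈ K := by simpa [hK] using hx
    have h2 : (x : H) ∈ K ⊓ Kᗮ := ⟨h1, x.2⟩
    rw [Submodule.inf_orthogonal_eq_bot] at h2
    exact Subtype.ext ((Submodule.mem_bot ℂ).1 h2)
  have hfd : FiniteDimensional ℂ Kᗮ := FiniteDimensional.of_injective _ hinj
  have hdim : Module.finrank ℂ Kᗮ ≤ n := by
    have := LinearMap.finrank_le_finrank_of_injective hinj
    rw [Module.finrank_fintype_fun_eq_card] at this
    exact this.trans hn
  set P : H →L[ℂ] H := Kᗮ.starProjection with hP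
  have hrange : LinearMap.range (T ∘L P).toLinearMap ≤ Submodule.map T.toLinearMap Kᗮ := by
    rintro _ ⟨x, rfl⟩
    exact ⟨P x, by simp [hP], rfl⟩
  have : FiniteDimensional ℂ (Submodule.map T.toLinearMap Kᗮ) := inferInstance
  refine (csInf_le (approxNum_set_bddBelow T n) ⟨T ∘L P, ?_, ?_, rfl⟩).trans ?_
  · exact Submodule.finiteDimensional_of_le hrange
  · exact (Submodule.finrank_mono hrange).trans ((Submodule.finrank_map_le _ _).trans hdim)
  · refine ContinuousLinearMap.opNorm_le_bound _ hc fun f => ?_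
    have h1 : f - P f = K.starProjection f := by
      have := K.starProjection_add_starProjection_orthogonal f
      rw [hP]; nth_rewrite 1 [← this]; abel
    have h2 : (T - T ∘L P) f = T (K.starProjection f) := by
      simp only [sub_apply, ContinuousLinearMap.comp_apply]
      rw [← map_sub, h1]
    rw [h2]
    have h3 : K.starProjection f ∈ K := K.starProjection_apply_mem f
    refine (h _ fun i => ?_).trans (mul_le_mul_of_nonneg_left ?_ hc)
    · have : L (K.starProjection f) = 0 := h3
      exact congrFun this i
    · exact K.norm_starProjection_apply_le f

/-- A lower bound for approximation numbers through almost orthogonal functionals. -/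
lemma le_approxNum_of_functionals [CompleteSpace H] (T : H →L[ℂ] H) {n : ℕ} {ι : Type*} [Fintype ι]
    [Nonempty ι] (l : ι → H →L[ℂ] ℂ) {A B c : ℝ} (hA : 0 < A) (hc : 0 < c)
    (hl : ∀ j, c ≤ ‖l j‖ ^ 2) (hB : ∀ f, ∑ j, ‖l j f‖ ^ 2 ≤ B * ‖f‖ ^ 2)
    (hT : ∀ j f, ‖l j f‖ ≤ A * ‖T f‖) (hn : 2 * n * B ≤ Fintype.card ι * c) :
    Real.sqrt (c / 2) / A ≤ approxNum T n := by
  refine le_csInf (approxNum_set_nonempty T n) ?_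
  rintro _ ⟨R, hfin, hrank, rfl⟩
  set ε := ‖T - R‖ with hε
  have hε0 : 0 ≤ ε := norm_nonneg _
  let k : ι → H := fun j => (InnerProductSpace.toDual ℂ H).symm (l j)
  have hk : ∀ j f, inner ℂ (k j) f = l j f := fun j f =>
    InnerProductSpace.toDual_symm_apply
  have hkn : ∀ j, ‖k j‖ = ‖l j‖ := fun j => LinearIsometryEquiv.norm_map _ _
  set K : Submodule ℂ H := LinearMap.ker R.toLinearMap with hK
  have hKc : IsClosed (K : Set H) := R.isClosed_ker
  have : CompleteSpace K := hKc.completeSpace_coe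
  have hinj : Function.Injective (R.toLinearMap.rangeRestrict.comp Kᗮ.subtype) := by
    rw [← LinearMap.ker_eq_bot, LinearMap.ker_eq_bot']
    intro x hx
    have h1 : (x : H) ∈ K := by
      have := congrArg Subtype.val hx
      simpa [hK] using this
    have h2 : (x : H) ∈ K ⊓ Kᗮ := ⟨h1, x.2⟩
    rw [Submodule.inf_orthogonal_eq_bot] at h2
    exact Subtype.ext ((Submodule.mem_bot ℂ).1 h2)
  have hfd : FiniteDimensional ℂ Kᗮ := FiniteDimensional.of_injective _ hinj
  have hdim : Module.finrank ℂ Kᗮ ≤ n :=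
    (LinearMap.finrank_le_finrank_of_injective hinj).trans hrank
  have hPk : ∀ j, ‖K.starProjection (k j)‖ ≤ A * ε := by
    intro j
    set p := K.starProjection (k j) with hp
    have hpK : p ∈ K := K.starProjection_apply_mem _
    have h1 : inner ℂ (k j) p = ((‖p‖ : ℂ)) ^ 2 := by
      have h2 : k j = p + Kᗮ.starProjection (k j) :=
        (K.starProjection_add_starProjection_orthogonal (k j)).symm
      have h3 : inner ℂ (Kᗮ.starProjection (k j)) p = 0 :=
        Submodule.inner_left_of_mem_orthogonal hpK (Kᗮ.starProjection_apply_mem _)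
      rw [h2, inner_add_left, h3, add_zero, inner_self_eq_norm_sq_to_K]; rfl
    have h4 : ‖p‖ ^ 2 ≤ A * (ε * ‖p‖) := by
      have h5 := hT j p
      rw [← hk, h1] at h5
      have h6 : T p = (T - R) p := by
        have : R p = 0 := hpK
        simp [this]
      rw [h6] at h5
      have h7 : ‖((‖p‖ : ℂ)) ^ 2‖ = ‖p‖ ^ 2 := by simp
      rw [h7] at h5
      exact h5.trans (mul_le_mul_of_nonneg_left ((T - R).le_opNorm p) hA.le)
    rcases (norm_nonneg p).eq_or_lt with h0 | h0
    · rw [← h0]; positivity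
    · nlinarith
  have hQ : ∑ j, ‖Kᗮ.starProjection (k j)‖ ^ 2 ≤ n * B := by
    let b := stdOrthonormalBasis ℂ Kᗮ
    have hB0 : 0 ≤ B ∨ Module.finrank ℂ Kᗮ = 0 := by
      by_contra! h
      have : Nontrivial Kᗮ := Module.finrank_pos_iff.1 (Nat.pos_of_ne_zero h.2)
      obtain ⟨x, hx⟩ := exists_ne (0 : Kᗮ)
      have h1 := hB x
      have h2 : (0 : ℝ) ≤ ∑ j, ‖l j x‖ ^ 2 := Finset.sum_nonneg fun _ _ => by positivity
      have h3 : 0 < ‖(x : H)‖ ^ 2 := by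
        have : (x : H) ≠ 0 := by simpa using hx
        positivity
      nlinarith [h.1]
    have h1 : ∀ j, ‖Kᗮ.starProjection (k j)‖ ^ 2 = ∑ i, ‖l j (b i : H)‖ ^ 2 := by
      intro j
      have h0 := b.sum_sq_norm_inner_right (Kᗮ.orthogonalProjectionOnto (k j))
      rw [Submodule.starProjection_apply]
      refine h0.symm.trans (Finset.sum_congr rfl fun i _ => ?_)
      rw [← hk, norm_inner_symm, Submodule.coe_inner, ← Submodule.starProjection_apply]
      congr 2
      have h2 : k j = K.starProjection (k j) + Kᗮ.starProjection (k j) :=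
        (K.starProjection_add_starProjection_orthogonal (k j)).symm
      have h3 : inner ℂ (K.starProjection (k j)) (b i : H) = 0 :=
        Submodule.inner_right_of_mem_orthogonal (K.starProjection_apply_mem _) (b i).2
      nth_rewrite 2 [h2]
      rw [inner_add_left, h3, zero_add]
    calc ∑ j, ‖Kᗮ.starProjection (k j)‖ ^ 2 = ∑ i, ∑ j, ‖l j (b i : H)‖ ^ 2 := by
          rw [Finset.sum_comm]; exact Finset.sum_congr rfl fun j _ => h1 j
      _ ≤ ∑ i : Fin (Module.finrank ℂ Kᗮ), B := by
          refine Finset.sum_le_sum fun i _ => (hB _).trans ?_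
          have : ‖(b i : H)‖ = 1 := b.orthonormal.1 i
          rw [this]; simp
      _ = (Module.finrank ℂ Kᗮ) * B := by simp
      _ ≤ n * B := by
          rcases hB0 with h | h
          · exact mul_le_mul_of_nonneg_right (by exact_mod_cast hdim) h
          · rw [h]
            by_cases hn0 : n = 0
            · simp [hn0]
            have h2 := (Finset.sum_nonneg (s := Finset.univ)
              fun j _ => sq_nonneg ‖l j (k j)‖)
            have j0 : ι := Classical.arbitrary ι
            have h3 := hB (k j0)
            have h4 : (0 : ℝ) ≤ ∑ j, ‖l j (k j0)‖ ^ 2 :=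
              Finset.sum_nonneg fun _ _ => by positivity
            have h5 : 0 < ‖k j0‖ ^ 2 := by rw [hkn]; exact hc.trans_le (hl j0)
            have h6 : 0 ≤ B := by
              by_contra! h7
              nlinarith
            simp only [CharP.cast_eq_zero, zero_mul]
            positivity
  have hsum : Fintype.card ι * c ≤ Fintype.card ι * (A * ε) ^ 2 + n * B := by
    calc Fintype.card ι * c = ∑ _j : ι, c := by simp
      _ ≤ ∑ j, (‖K.starProjection (k j)‖ ^ 2 + ‖Kᗮ.starProjection (k j)‖ ^ 2) := by
          refine Finset.sum_le_sum fun j _ => (hl j).trans ?_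
          rw [← hkn, Submodule.norm_sq_eq_add_norm_sq_starProjection (k j) K]
      _ ≤ ∑ _j : ι, (A * ε) ^ 2 + n * B := by
          rw [Finset.sum_add_distrib]
          refine add_le_add (Finset.sum_le_sum fun j _ => ?_) hQ
          exact pow_le_pow_left₀ (norm_nonneg _) (hPk j) 2
      _ = _ := by simp
  have hcard : (0 : ℝ) < Fintype.card ι := by exact_mod_cast Fintype.card_pos
  have hfin : c / 2 ≤ (A * ε) ^ 2 := by
    by_contra! h
    nlinarith
  rw [div_le_iff₀ hA]
  calc Real.sqrt (c / 2) ≤ Real.sqrt ((A * ε) ^ 2) := Real.sqrt_le_sqrt hfin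
    _ = ε * A := by rw [Real.sqrt_sq (by positivity)]; ring

end Approx

section ComplexLemmas

/-- Sub-mean value property of `‖h‖ₑ ^ 2` on a disc. -/
lemma enorm_sq_mul_volume_ball_le {h : ℂ → ℂ} {c : ℂ} {R : ℝ} (hh : DifferentiableOn ℂ h (ball c R)) :
    ‖h c‖ₑ ^ 2 * volume (ball c R) ≤ ∫⁻ z in ball c R, ‖h z‖ₑ ^ 2 := by
  set F : ℂ → ℝ≥0∞ := (ball (0 : ℂ) R).indicator fun w => ‖h (c + w)‖ₑ ^ 2 with hF
  have hmaps : ∀ w ∈ ball (0 : ℂ) R, c + w ∈ ball c R := by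
    intro w hw; simpa [mem_ball, dist_eq_norm] using hw
  have hcont : ContinuousOn (fun w => h (c + w)) (ball (0 : ℂ) R) :=
    hh.continuousOn.comp (by fun_prop) hmaps
  have hFm : Measurable F := by
    refine measurable_of_restrict_of_restrict_compl (s := ball (0 : ℂ) R) measurableSet_ball ?_ ?_
    · have h1 : Measurable ((ball (0 : ℂ) R).domRestrict fun w => h (c + w)) :=
        (continuousOn_iff_continuous_domRestrict.1 hcont).measurable
      have h2 : (ball (0 : ℂ) R).domRestrict F
          = fun w => ‖(ball (0 : ℂ) R).domRestrict (fun w => h (c + w)) w‖ₑ ^ 2 := by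
        ext w; simp only [domRestrict_apply, hF, indicator_of_mem w.2]
      rw [h2]; fun_prop
    · have h2 : ((ball (0 : ℂ) R)ᶜ).domRestrict F = fun _ => 0 := by
        ext w; simp only [domRestrict_apply, hF]; exact indicator_of_notMem w.2 _
      rw [h2]; exact measurable_const
  have hI : ∫⁻ z in ball c R, ‖h z‖ₑ ^ 2 = ∫⁻ w, F w := by
    rw [hF, lintegral_indicator measurableSet_ball]
    have := (measurePreserving_add_left (volume : Measure ℂ) c).setLIntegral_comp_preimage_emb
      (MeasurableEquiv.addLeft c).measurableEmbedding (fun z => ‖h z‖ₑ ^ 2) (ball c R)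
    rw [← this]
    congr 2
    ext w; simp [mem_ball, dist_eq_norm]
  rw [hI]
  have hrot : ∀ θ : ℝ, ∫⁻ w, F (Complex.exp (θ * Complex.I) * w) = ∫⁻ w, F w := by
    intro θ
    let e := rotation (Circle.exp θ)
    have := e.measurePreserving.lintegral_comp_emb e.toHomeomorph.measurableEmbedding F
    rw [← this]
    rfl
  have hmv : ∀ w ∈ ball (0 : ℂ) R, ENNReal.ofReal (2 * Real.pi) * ‖h c‖ₑ ^ 2
      ≤ ∫⁻ θ in Ioc 0 (2 * Real.pi), F (Complex.exp (θ * Complex.I) * w) := by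
    intro w hw
    have hmem : ∀ u ∈ closedBall (0 : ℂ) 1, c + u * w ∈ ball c R := by
      intro u hu
      apply hmaps
      rw [mem_ball_zero_iff] at hw ⊢
      rw [mem_closedBall_zero_iff] at hu
      rw [norm_mul]
      nlinarith [norm_nonneg w]
    have hd : DiffContOnCl ℂ (fun u => h (c + u * w) ^ 2) (ball (0 : ℂ) |(1 : ℝ)|) := by
      apply DifferentiableOn.diffContOnCl
      rw [abs_one, closure_ball _ one_ne_zero]
      refine DifferentiableOn.pow ?_ 2
      exact hh.comp (by fun_prop) hmem
    have h1 := hd.circleAverage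
    simp only [zero_mul, add_zero, Real.circleAverage_def, circleMap, zero_add, Complex.ofReal_one,
      one_mul] at h1
    rw [intervalIntegral.integral_of_le (by positivity)] at h1
    have h3 : ‖h c‖ₑ ^ 2 ≤ ENNReal.ofReal ((2 * Real.pi)⁻¹) *
        ∫⁻ θ in Ioc 0 (2 * Real.pi), ‖h (c + Complex.exp (θ * Complex.I) * w) ^ 2‖ₑ := by
      rw [← enorm_pow, ← h1, enorm_smul, Real.enorm_of_nonneg (by positivity)]
      gcongr
      exact enorm_integral_le_lintegral_enorm _
    have h4 : ENNReal.ofReal (2 * Real.pi) * ENNReal.ofReal ((2 * Real.pi)⁻¹) = 1 := by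
      rw [← ENNReal.ofReal_mul (by positivity), mul_inv_cancel₀ (by positivity), ENNReal.ofReal_one]
    calc _ ≤ ENNReal.ofReal (2 * Real.pi) * (ENNReal.ofReal ((2 * Real.pi)⁻¹) *
        ∫⁻ θ in Ioc 0 (2 * Real.pi), ‖h (c + Complex.exp (θ * Complex.I) * w) ^ 2‖ₑ) := by gcongr
      _ = ∫⁻ θ in Ioc 0 (2 * Real.pi), ‖h (c + Complex.exp (θ * Complex.I) * w) ^ 2‖ₑ := by
        rw [← mul_assoc, h4, one_mul]
      _ = _ := by
        refine lintegral_congr fun θ => ?_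
        have : Complex.exp (θ * Complex.I) * w ∈ ball (0 : ℂ) R := by
          rw [mem_ball_zero_iff, norm_mul, Complex.norm_exp_ofReal_mul_I, one_mul]
          exact mem_ball_zero_iff.1 hw
        rw [hF, indicator_of_mem this, enorm_pow]
  have h2pi : ENNReal.ofReal (2 * Real.pi) ≠ 0 := by
    simp [Real.pi_pos]
  rw [← ENNReal.mul_le_mul_iff_right h2pi ENNReal.ofReal_ne_top]
  calc ENNReal.ofReal (2 * Real.pi) * (‖h c‖ₑ ^ 2 * volume (ball c R))
      = ∫⁻ w in ball (0 : ℂ) R, ENNReal.ofReal (2 * Real.pi) * ‖h c‖ₑ ^ 2 := by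
        rw [lintegral_const, Measure.restrict_apply_univ, Complex.volume_ball, Complex.volume_ball]
        ring
    _ ≤ ∫⁻ w in ball (0 : ℂ) R,
        ∫⁻ θ in Ioc 0 (2 * Real.pi), F (Complex.exp (θ * Complex.I) * w) :=
      setLIntegral_mono' measurableSet_ball hmv
    _ ≤ ∫⁻ w, ∫⁻ θ in Ioc 0 (2 * Real.pi), F (Complex.exp (θ * Complex.I) * w) :=
      setLIntegral_le_lintegral _ _
    _ = ∫⁻ θ in Ioc 0 (2 * Real.pi), ∫⁻ w, F (Complex.exp ((θ : ℝ) * Complex.I) * w) := by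
      rw [lintegral_lintegral_swap]
      refine (hFm.comp ?_).aemeasurable
      fun_prop
    _ = ENNReal.ofReal (2 * Real.pi) * ∫⁻ w, F w := by
      simp_rw [hrot]
      rw [lintegral_const, Measure.restrict_apply_univ, Real.volume_Ioc, sub_zero, mul_comm]

/-- A holomorphic function vanishing to order `m` at the centre of a disc is small on a
smaller concentric disc. -/
lemma lintegral_enorm_sq_ball_le_of_isBigO {h : ℂ → ℂ} {c : ℂ} {r ρ : ℝ} (hr : 0 < r) (hρ : 0 < ρ)
    (hh : DifferentiableOn ℂ h (ball c (r + 2 * ρ))) {m : ℕ} (hm : m ≠ 0)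
    (hO : h =O[𝓝 c] fun w => ‖w - c‖ ^ m) :
    ∫⁻ z in ball c r, ‖h z‖ₑ ^ 2 ≤
      ENNReal.ofReal ((r / ρ) ^ 2 * (r / (r + ρ)) ^ (2 * m)) *
        ∫⁻ z in ball c (r + 2 * ρ), ‖h z‖ₑ ^ 2 := by
  set I := ∫⁻ z in ball c (r + 2 * ρ), ‖h z‖ₑ ^ 2 with hI
  have hconst : 0 < (r / ρ) ^ 2 * (r / (r + ρ)) ^ (2 * m) := by positivity
  rcases eq_or_ne I ⊤ with htop | htop
  · rw [htop, ENNReal.mul_top]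
    · exact le_top
    · simpa using hconst
  have hsup : ∀ z ∈ ball c (r + ρ), ‖h z‖ ^ 2 ≤ I.toReal / (Real.pi * ρ ^ 2) := by
    intro z hz
    have hsub : ball z ρ ⊆ ball c (r + 2 * ρ) := by
      refine ball_subset_ball' ?_
      rw [mem_ball] at hz; linarith
    have h1 := enorm_sq_mul_volume_ball_le (hh.mono hsub)
    have h2 : ‖h z‖ₑ ^ 2 * volume (ball z ρ) ≤ I := h1.trans (lintegral_mono_set hsub)
    have h3 := (ENNReal.toReal_le_toReal (ne_top_of_le_ne_top htop h2) htop).2 h2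
    rw [ENNReal.toReal_mul, ENNReal.toReal_pow, toReal_enorm, Complex.volume_ball,
      ENNReal.toReal_mul, ENNReal.toReal_pow, ENNReal.toReal_ofReal hρ.le] at h3
    rw [le_div_iff₀ (by positivity)]
    refine le_trans (le_of_eq ?_) h3
    rw [ENNReal.coe_toReal, NNReal.coe_real_pi]; ring
  set M := Real.sqrt (I.toReal / (Real.pi * ρ ^ 2)) with hM
  have hsupM : ∀ z ∈ ball c (r + ρ), ‖h z‖ ≤ M := fun z hz =>
    Real.le_sqrt_of_sq_le (hsup z hz)
  have hc0 : h c = 0 := by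
    have := hO.eq_zero_of_norm_pow hm
    exact this
  obtain ⟨n, rfl⟩ := Nat.exists_eq_succ_of_ne_zero hm
  have ho : (fun w => h w - h c) =o[𝓝 c] fun w => ‖w - c‖ ^ n := by
    simp only [hc0, sub_zero]
    refine hO.trans_isLittleO ?_
    have h0 : Tendsto (fun w : ℂ => ‖w - c‖) (𝓝 c) (𝓝 0) := by
      have : Continuous fun w : ℂ => ‖w - c‖ := by fun_prop
      simpa using this.tendsto c
    have := (Asymptotics.isLittleO_pow_pow (𝕜 := ℝ) (Nat.lt_succ_self n)).comp_tendsto h0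
    exact this
  have hschw : ∀ z ∈ ball c r, ‖h z‖ ≤ M * (r / (r + ρ)) ^ (n + 1) := by
    intro z hz
    have hz' : z ∈ ball c (r + ρ) := ball_subset_ball (by linarith) hz
    have h1 := Complex.dist_le_mul_div_pow_of_mapsTo_ball_of_isLittleO (R₁ := r + ρ) (R₂ := M)
      (hh.mono (ball_subset_ball (by linarith)))
      (fun w hw => by rw [hc0, mem_closedBall_zero_iff]; exact hsupM w hw) ho hz'
    rw [hc0, dist_zero_right] at h1
    refine h1.trans ?_
    have : dist z c ≤ r := (mem_ball.1 hz).le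
    have hM0 : 0 ≤ M := Real.sqrt_nonneg _
    gcongr
  have hpt : ∀ z ∈ ball c r, ‖h z‖ₑ ^ 2 ≤
      ENNReal.ofReal (I.toReal / (Real.pi * ρ ^ 2) * (r / (r + ρ)) ^ (2 * (n + 1))) := by
    intro z hz
    rw [← ofReal_norm, ← ENNReal.ofReal_pow (norm_nonneg _)]
    apply ENNReal.ofReal_le_ofReal
    have := pow_le_pow_left₀ (norm_nonneg _) (hschw z hz) 2
    rw [mul_pow, hM, Real.sq_sqrt (by positivity), ← pow_mul, mul_comm (n + 1) 2] at this
    exact this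
  calc ∫⁻ z in ball c r, ‖h z‖ₑ ^ 2 ≤ ∫⁻ _z in ball c r,
      ENNReal.ofReal (I.toReal / (Real.pi * ρ ^ 2) * (r / (r + ρ)) ^ (2 * (n + 1))) :=
        setLIntegral_mono' measurableSet_ball hpt
    _ = ENNReal.ofReal (I.toReal / (Real.pi * ρ ^ 2) * (r / (r + ρ)) ^ (2 * (n + 1)))
        * ENNReal.ofReal (Real.pi * r ^ 2) := by
        rw [lintegral_const, Measure.restrict_apply_univ, Complex.volume_ball]
        congr 1
        rw [ENNReal.ofReal_mul (by positivity), mul_comm, ENNReal.ofReal_pow hr.le]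
        congr 1
        rw [← NNReal.coe_real_pi, ENNReal.ofReal_coe_nnreal]
    _ = ENNReal.ofReal ((r / ρ) ^ 2 * (r / (r + ρ)) ^ (2 * (n + 1))) * ENNReal.ofReal I.toReal := by
        rw [← ENNReal.ofReal_mul (by positivity), ← ENNReal.ofReal_mul (by positivity)]
        congr 1
        field_simp
    _ = _ := by rw [ENNReal.ofReal_toReal htop]

lemma isBigO_of_iteratedDeriv_eq_zero {g : ℂ → ℂ} {w : ℂ} (hg : AnalyticAt ℂ g w) {m : ℕ}
    (h : ∀ i < m, iteratedDeriv i g w = 0) : g =O[𝓝 w] fun z => ‖z - w‖ ^ m := by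
  have h1 := (natCast_le_analyticOrderAt_iff_iteratedDeriv_eq_zero hg).2 h
  obtain ⟨u, hu, hgu⟩ := (natCast_le_analyticOrderAt hg).1 h1
  have h2 : (fun z => (z - w) ^ m • u z) =O[𝓝 w] fun z => ‖z - w‖ ^ m := by
    have h3 : u =O[𝓝 w] fun _ => (1 : ℝ) := hu.continuousAt.isBigO_one ℝ
    have h4 : (fun z => (z - w) ^ m) =O[𝓝 w] fun z => ‖z - w‖ ^ m := by
      refine Asymptotics.IsBigO.of_bound 1 (Eventually.of_forall fun z => ?_)
      simp
    simpa using h4.smul h3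
  exact h2.congr' (hgu.mono fun z hz => hz.symm) EventuallyEq.rfl

/-- Maximum principle with asymptotic boundary control. -/
lemma norm_le_one_of_frontier {D : Set ℂ} (hD : IsOpen D) (hb : Bornology.IsBounded D) {G : ℂ → ℂ}
    (hG : DifferentiableOn ℂ G D)
    (hfr : ∀ z ∈ frontier D, ∀ ε > 0, ∀ᶠ w in 𝓝[D] z, ‖G w‖ ≤ 1 + ε) :
    ∀ z ∈ D, ‖G z‖ ≤ 1 := by
  by_contra! hcon
  obtain ⟨z0, hz0, hz1⟩ := hcon
  set ε := (‖G z0‖ - 1) / 2 with hε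
  have hε0 : 0 < ε := by rw [hε]; linarith
  set K := {z ∈ D | ‖G z0‖ ≤ ‖G z‖} with hK
  have hKc : IsCompact K := by
    refine isCompact_of_isClosed_isBounded ?_ (hb.subset (sep_subset _ _))
    rw [← closure_subset_iff_isClosed]
    intro z hz
    have hzD : z ∈ closure D := closure_mono (sep_subset _ _) hz
    have hzin : z ∈ D := by
      by_contra hzn
      have hzf : z ∈ frontier D := by rw [hD.frontier_eq]; exact ⟨hzD, hzn⟩
      have h1 := hfr z hzf ε hε0
      rw [eventually_nhdsWithin_iff] at h1
      obtain ⟨w, hw1, hw2⟩ := (mem_closure_iff_frequently.1 hz).and_eventually h1 |>.exists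
      have := hw2 hw1.1
      linarith [hw1.2]
    refine ⟨hzin, ?_⟩
    have hcG : ContinuousAt G z := (hG.differentiableAt (hD.mem_nhds hzin)).continuousAt
    exact ge_of_tendsto_of_frequently hcG.norm
      ((mem_closure_iff_frequently.1 hz).mono fun w hw => hw.2)
  obtain ⟨z1, hz1K, hmax⟩ := hKc.exists_isMaxOn ⟨z0, hz0, le_rfl⟩
    ((hG.continuousOn.mono (sep_subset _ _)).norm)
  set S := {z ∈ D | ‖G z‖ = ‖G z1‖} with hS
  have hmaxD : ∀ z ∈ D, ‖G z‖ ≤ ‖G z1‖ := by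
    intro z hz
    by_cases h : ‖G z0‖ ≤ ‖G z‖
    · exact hmax ⟨hz, h⟩
    · exact (not_le.1 h).le.trans hz1K.2
  have hSK : S ⊆ K := fun z hz => ⟨hz.1, by rw [hz.2]; exact hz1K.2⟩
  have hSo : IsOpen S := by
    rw [isOpen_iff_mem_nhds]
    intro z hz
    have h1 : ∀ᶠ w in 𝓝 z, DifferentiableAt ℂ G w :=
      (hD.eventually_mem hz.1).mono fun w hw => hG.differentiableAt (hD.mem_nhds hw)
    have h2 : IsLocalMax (norm ∘ G) z :=
      (hD.eventually_mem hz.1).mono fun w hw => by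
        simp only [Function.comp_apply]; rw [hz.2]; exact hmaxD w hw
    filter_upwards [Complex.norm_eventually_eq_of_isLocalMax h1 h2, hD.eventually_mem hz.1]
      with w hw1 hw2
    exact ⟨hw2, hw1.trans hz.2⟩
  have hSc : IsClosed S := by
    have : S = K ∩ (fun z => ‖G z‖) ⁻¹' {‖G z1‖} := by
      ext z
      constructor
      · intro hz; exact ⟨hSK hz, hz.2⟩
      · intro hz; exact ⟨hz.1.1, hz.2⟩
    rw [this]
    exact ((hG.continuousOn.mono (sep_subset _ _)).norm).preimage_isClosed_of_isClosed
      hKc.isClosed isClosed_singleton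
  rcases isClopen_iff.1 ⟨hSc, hSo⟩ with h | h
  · have : z1 ∈ S := ⟨hz1K.1, rfl⟩
    rw [h] at this; exact this
  · have : Bornology.IsBounded (univ : Set ℂ) := by
      rw [← h]; exact hb.subset (sep_subset _ _)
    exact NormedSpace.unbounded_univ ℝ ℂ this

/-- The inverse of a conformal map of the unit disc. -/
lemma exists_conformal_inverse {φ : ℂ → ℂ} {Ω : Set ℂ} (hφd : DifferentiableOn ℂ φ (ball (0 : ℂ) 1))
    (hφi : InjOn φ (ball (0 : ℂ) 1)) (hφim : φ '' ball (0 : ℂ) 1 = Ω) :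
    ∃ ψ : ℂ → ℂ, DifferentiableOn ℂ ψ Ω ∧ (∀ w ∈ Ω, ψ w ∈ ball (0 : ℂ) 1 ∧ φ (ψ w) = w) ∧
      (∀ z ∈ ball (0 : ℂ) 1, ψ (φ z) = z) ∧
      ∀ w ∉ Ω, ∀ r < 1, ∀ᶠ v in 𝓝[Ω] w, r < ‖ψ v‖ := by
  subst hφim
  set U := ball (0 : ℂ) 1 with hU
  have hUo : IsOpen U := isOpen_ball
  set ψ := Function.invFunOn φ U with hψ
  have hψU : ∀ w ∈ φ '' U, ψ w ∈ U ∧ φ (ψ w) = w := fun w hw =>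
    ⟨Function.invFunOn_mem hw, Function.invFunOn_eq hw⟩
  have hψφ : ∀ z ∈ U, ψ (φ z) = z := fun z hz => hφi.leftInvOn_invFunOn hz
  have han : AnalyticOnNhd ℂ φ U := hφd.analyticOnNhd hUo
  have hopen : ∀ s ⊆ U, IsOpen s → IsOpen (φ '' s) := by
    rcases han.is_constant_or_isOpen (convex_ball (0 : ℂ) 1).isPreconnected with ⟨w, hw⟩ | h
    · exfalso
      have h1 : (0 : ℂ) ∈ U := by simp [hU]
      have h2 : (1 / 2 : ℂ) ∈ U := by simp [hU]; norm_num
      have := hφi h1 h2 ((hw _ h1).trans (hw _ h2).symm)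
      norm_num at this
    · exact h
  have hΩo : IsOpen (φ '' U) := hopen U subset_rfl hUo
  have hψc : ContinuousOn ψ (φ '' U) := by
    rw [continuousOn_open_iff hΩo]
    intro t ht
    have : φ '' U ∩ ψ ⁻¹' t = φ '' (U ∩ t) := by
      ext w
      constructor
      · rintro ⟨hw, hwt⟩
        exact ⟨ψ w, ⟨(hψU w hw).1, hwt⟩, (hψU w hw).2⟩
      · rintro ⟨z, ⟨hz, hzt⟩, rfl⟩
        refine ⟨⟨z, hz, rfl⟩, ?_⟩
        rw [mem_preimage, hψφ z hz]; exact hzt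
    rw [this]
    exact hopen _ inter_subset_left (hUo.inter ht)
  have hreg : ∀ w ∈ φ '' U, deriv φ (ψ w) ≠ 0 → DifferentiableAt ℂ ψ w := by
    intro w hw hne
    have h1 : HasDerivAt φ (deriv φ (ψ w)) (ψ w) :=
      (hφd.differentiableAt (hUo.mem_nhds (hψU w hw).1)).hasDerivAt
    refine (HasDerivAt.of_local_left_inverse (hψc.continuousAt (hΩo.mem_nhds hw)) h1 hne
      ?_).differentiableAt
    filter_upwards [hΩo.mem_nhds hw] with v hv using (hψU v hv).2
  refine ⟨ψ, ?_, hψU, hψφ, ?_⟩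
  · intro w hw
    refine DifferentiableAt.differentiableWithinAt ?_
    by_cases hne : deriv φ (ψ w) = 0
    · have hz := (hψU w hw).1
      have hiso : ∀ᶠ z in 𝓝[≠] (ψ w), deriv φ z ≠ 0 := by
        rcases (han.deriv _ hz).eventually_eq_zero_or_eventually_ne_zero with h | h
        · exfalso
          have h1 : EqOn (deriv φ) 0 U :=
            han.deriv.eqOn_zero_of_preconnected_of_eventuallyEq_zero
              (convex_ball (0 : ℂ) 1).isPreconnected hz h
          have h2 := (convex_ball (0 : ℂ) 1).is_const_of_fderivWithin_eq_zero (𝕜 := ℂ) hφd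
            (fun x hx => by
              rw [fderivWithin_of_isOpen hUo hx]
              ext; simpa using h1 hx)
            (x := 0) (y := 1 / 2) (by simp) (by simp; norm_num)
          have := hφi (by simp [hU]) (by simp [hU]; norm_num) h2
          norm_num at this
        · exact h
      have hctw : ContinuousAt ψ w := hψc.continuousAt (hΩo.mem_nhds hw)
      have hdiff : ∀ᶠ v in 𝓝 w, v ≠ w → DifferentiableAt ℂ ψ v := by
        rw [eventually_nhdsWithin_iff] at hiso
        filter_upwards [hctw.eventually hiso, hΩo.mem_nhds hw] with v hv hvΩ hvw
        refine hreg v hvΩ (hv ?_)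
        intro h
        apply hvw
        have h5 := congrArg φ (show ψ v = ψ w from h)
        rwa [(hψU v hvΩ).2, (hψU w hw).2] at h5
      obtain ⟨s, hs, hso, hws⟩ := _root_.eventually_nhds_iff.1 hdiff
      have h1 : DifferentiableOn ℂ ψ (s \ {w}) := fun v hv =>
        (hs v hv.1 hv.2).differentiableWithinAt
      exact ((Complex.differentiableOn_compl_singleton_and_continuousAt_iff
        (hso.mem_nhds hws)).1 ⟨h1, hctw⟩).differentiableAt (hso.mem_nhds hws)
    · exact hreg w hw hne
  · intro w hw r hr
    have hcomp : IsCompact (φ '' closedBall (0 : ℂ) r) :=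
      (isCompact_closedBall _ _).image_of_continuousOn
        (hφd.continuousOn.mono (closedBall_subset_ball hr))
    have hn : w ∉ φ '' closedBall (0 : ℂ) r := fun h =>
      hw (image_mono (closedBall_subset_ball hr) h)
    rw [eventually_nhdsWithin_iff]
    filter_upwards [hcomp.isClosed.isOpen_compl.mem_nhds hn] with v hv hvΩ
    by_contra! hle
    exact hv ⟨ψ v, by simpa using hle, (hψU v hvΩ).2⟩

end ComplexLemmas

section BarrierMeasure

/-- The measures used to build the barriers: `ν` is the Stieltjes measure of `κ` near `0` and
`μ = ν + κ(a)² da / a`. -/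
lemma exists_barrier_measures {κ : ℝ → ℝ} {b : ℝ} (hb : 0 < b) (hmono : MonotoneOn κ (Icc 0 b))
    (hcont : ContinuousOn κ (Icc 0 b)) (hκ0 : κ 0 = 0)
    (hsq : IntegrableOn (fun t => κ t ^ 2 / t) (Ioc 0 b)) {δ : ℝ} (hδ : 0 < δ) :
    ∃ a0 ∈ Ioc 0 b, κ a0 ≤ δ ∧ ∃ ν μ : Measure ℝ, IsFiniteMeasure ν ∧ IsFiniteMeasure μ ∧ ν ≤ μ ∧
      (∀ᵐ a ∂μ, a ∈ Ioc 0 a0) ∧ μ.real univ ≤ 2 * δ ∧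
      (∀ r ∈ Icc 0 a0, ν.real (Ioc 0 r) = κ r) ∧
      ∀ r ∈ Ioc 0 (a0 / 2), κ r - κ (r / 2) + κ r ^ 2 / 2 ≤ μ.real (Ioc (r / 2) (2 * r)) := by
  have h0b : (0 : ℝ) ∈ Icc 0 b := ⟨le_rfl, hb.le⟩
  -- smallness of `κ` near `0`
  have hev1 : ∀ᶠ a in 𝓝[>] (0 : ℝ), κ a ≤ δ := by
    have h1 : Tendsto κ (𝓝[Icc 0 b] 0) (𝓝 0) := by
      have := hcont 0 h0b; rwa [ContinuousWithinAt, hκ0] at this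
    have h2 : 𝓝[>] (0 : ℝ) ≤ 𝓝[Icc 0 b] 0 := by
      rw [← nhdsWithin_Ioc_eq_nhdsGT hb]; exact nhdsWithin_mono _ Ioc_subset_Icc_self
    exact (h1.mono_left h2).eventually (Iic_mem_nhds hδ)
  have hev2 : ∀ᶠ a in 𝓝[>] (0 : ℝ), ∫ t in Ioc 0 a, κ t ^ 2 / t ≤ δ := by
    have hii : IntervalIntegrable (fun t => κ t ^ 2 / t) volume 0 b :=
      (intervalIntegrable_iff_integrableOn_Ioc_of_le hb.le).2 hsq
    have h1 := intervalIntegral.continuousOn_primitive_interval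
      (f := fun t => κ t ^ 2 / t) (μ := volume) (a := 0) (b := b)
      (by rw [uIcc_of_le hb.le, integrableOn_Icc_iff_integrableOn_Ioc]; exact hsq)
    rw [uIcc_of_le hb.le] at h1
    have h3 : Tendsto (fun x => ∫ t in (0 : ℝ)..x, κ t ^ 2 / t) (𝓝[Icc 0 b] 0) (𝓝 0) := by
      have := h1 0 h0b; simpa [ContinuousWithinAt] using this
    have h2 : 𝓝[>] (0 : ℝ) ≤ 𝓝[Icc 0 b] 0 := by
      rw [← nhdsWithin_Ioc_eq_nhdsGT hb]; exact nhdsWithin_mono _ Ioc_subset_Icc_self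
    filter_upwards [(h3.mono_left h2).eventually (Iic_mem_nhds hδ), self_mem_nhdsWithin] with a ha ha0
    rw [← intervalIntegral.integral_of_le (le_of_lt ha0)]
    exact ha
  obtain ⟨a0, ⟨h1, h2⟩, ha0⟩ := ((hev1.and hev2).and (Ioc_mem_nhdsGT hb)).exists
  refine ⟨a0, ha0, h1, ?_⟩
  have ha0p : 0 < a0 := ha0.1
  have hκnn : ∀ t ∈ Icc 0 b, 0 ≤ κ t := fun t ht => by
    rw [← hκ0]; exact hmono h0b ht ht.1
  let cl : ℝ → ℝ := fun t => min (max t 0) a0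
  have hcl : ∀ t, cl t ∈ Icc 0 b := fun t =>
    ⟨le_min (le_max_right _ _) ha0p.le, (min_le_right _ _).trans ha0.2⟩
  have hclm : Monotone cl := fun x y hxy => min_le_min_right _ (max_le_max_right _ hxy)
  have hclc : Continuous cl := by fun_prop
  let f : StieltjesFunction ℝ :=
    { toFun := fun t => κ (cl t)
      mono' := fun x y hxy => hmono (hcl x) (hcl y) (hclm hxy)
      right_continuous' := fun x =>
        (hcont.comp_continuous hclc hcl).continuousAt.continuousWithinAt }
  have hclid : ∀ t ∈ Icc 0 a0, cl t = t := fun t ht => by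
    simp only [cl]; rw [max_eq_left ht.1, min_eq_left ht.2]
  have hf : ∀ t ∈ Icc 0 a0, f t = κ t := fun t ht => by
    change κ (cl t) = κ t; rw [hclid t ht]
  have h00 : (0 : ℝ) ∈ Icc 0 a0 := ⟨le_rfl, ha0p.le⟩
  have haa : a0 ∈ Icc 0 a0 := ⟨ha0p.le, le_rfl⟩
  have hνm : ∀ x y, 0 ≤ x → x ≤ y → y ≤ a0 →
      f.measure.restrict (Ioc 0 a0) (Ioc x y) = ENNReal.ofReal (κ y - κ x) := by
    intro x y hx hxy hy
    rw [Measure.restrict_apply measurableSet_Ioc, inter_eq_left.2 (Ioc_subset_Ioc hx hy),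
      f.measure_Ioc, hf y ⟨hx.trans hxy, hy⟩, hf x ⟨hx, hxy.trans hy⟩]
  have hνu : f.measure.restrict (Ioc 0 a0) univ = ENNReal.ofReal (κ a0) := by
    rw [Measure.restrict_apply_univ, f.measure_Ioc, hf _ h00, hf _ haa, hκ0, sub_zero]
  set ν := f.measure.restrict (Ioc 0 a0) with hν
  set ν_two : Measure ℝ := (volume.restrict (Ioc 0 a0)).withDensity
    (fun t => ENNReal.ofReal (κ t ^ 2 / t)) with hν_two
  have hIoc : Ioc 0 a0 ⊆ Ioc 0 b := Ioc_subset_Ioc_right ha0.2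
  have hsq' : IntegrableOn (fun t => κ t ^ 2 / t) (Ioc 0 a0) := hsq.mono_set hIoc
  have h_univ : ν_two univ = ENNReal.ofReal (∫ t in Ioc 0 a0, κ t ^ 2 / t) := by
    rw [hν_two, withDensity_apply _ MeasurableSet.univ, Measure.restrict_univ,
      ofReal_integral_eq_lintegral_ofReal hsq']
    exact (ae_restrict_mem measurableSet_Ioc).mono fun t ht => by
      have := ht.1; simp only [Pi.zero_apply]; positivity
  have hfν : IsFiniteMeasure ν := ⟨by rw [hνu]; exact ENNReal.ofReal_lt_top⟩
  have hfν_two : IsFiniteMeasure ν_two := ⟨by rw [h_univ]; exact ENNReal.ofReal_lt_top⟩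
  refine ⟨ν, ν + ν_two, hfν, inferInstance, Measure.le_add_right le_rfl, ?_, ?_, ?_, ?_⟩
  · rw [ae_add_measure_iff]
    refine ⟨ae_restrict_mem measurableSet_Ioc, ?_⟩
    exact (withDensity_absolutelyContinuous _ _).ae_le (ae_restrict_mem measurableSet_Ioc)
  · rw [measureReal_add_apply, Measure.real, Measure.real, hνu, h_univ,
      ENNReal.toReal_ofReal (hκnn a0 ⟨ha0p.le, ha0.2⟩), ENNReal.toReal_ofReal]
    · linarith
    · exact setIntegral_nonneg measurableSet_Ioc fun t ht => by have := ht.1; positivity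
  · intro r hr
    rw [Measure.real, hνm 0 r le_rfl hr.1 hr.2, hκ0, sub_zero,
      ENNReal.toReal_ofReal (hκnn r ⟨hr.1, hr.2.trans ha0.2⟩)]
  · intro r hr
    have hr0 := hr.1
    have hr2 : 2 * r ≤ a0 := by linarith [hr.2]
    rw [measureReal_add_apply]
    have e1 : κ r - κ (r / 2) ≤ ν.real (Ioc (r / 2) (2 * r)) := by
      have : ν.real (Ioc (r / 2) r) = κ r - κ (r / 2) := by
        rw [Measure.real, hνm (r / 2) r (by linarith) (by linarith) (by linarith),
          ENNReal.toReal_ofReal]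
        have := hmono (a := r / 2) (b := r) ⟨by linarith, by linarith [ha0.2]⟩
          ⟨by linarith, by linarith [ha0.2]⟩ (by linarith)
        linarith
      rw [← this]
      exact measureReal_mono (Ioc_subset_Ioc_right (by linarith))
    have e2 : κ r ^ 2 / 2 ≤ ν_two.real (Ioc (r / 2) (2 * r)) := by
      have h3 : ENNReal.ofReal (κ r ^ 2 / 2) ≤ ν_two (Ioc r (2 * r)) := by
        rw [hν_two, withDensity_apply _ measurableSet_Ioc, Measure.restrict_restrict measurableSet_Ioc,
          inter_eq_left.2 (Ioc_subset_Ioc hr0.le hr2)]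
        calc ENNReal.ofReal (κ r ^ 2 / 2) = ∫⁻ _t in Ioc r (2 * r),
            ENNReal.ofReal (κ r ^ 2 / (2 * r)) := by
              rw [lintegral_const, Measure.restrict_apply_univ, Real.volume_Ioc,
                ← ENNReal.ofReal_mul (by positivity)]
              congr 1; field_simp; ring
          _ ≤ _ := by
              refine setLIntegral_mono' measurableSet_Ioc fun t ht => ?_
              apply ENNReal.ofReal_le_ofReal
              have ht0 : 0 < t := hr0.trans ht.1
              have hk1 : κ r ≤ κ t := hmono ⟨hr0.le, by linarith [ha0.2]⟩
                ⟨ht0.le, by linarith [ha0.2, ht.2]⟩ ht.1.le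
              have hk0 : 0 ≤ κ r := hκnn r ⟨hr0.le, by linarith [ha0.2]⟩
              have := ht.2
              gcongr
      have h4 : ν_two (Ioc r (2 * r)) ≤ ν_two (Ioc (r / 2) (2 * r)) :=
        measure_mono (Ioc_subset_Ioc_left (by linarith))
      rw [Measure.real, ← ENNReal.ofReal_le_iff_le_toReal (measure_ne_top _ _)]
      exact h3.trans h4
    linarith

end BarrierMeasure

section Barrier

/-- The barrier function attached to `ν`, `μ`. -/
def barrier (ν μ : Measure ℝ) (M : ℝ) (z : ℂ) : ℂ :=
  z * Complex.exp ((2 / Real.pi : ℝ) * (∫ a : ℝ, Complex.log (z + a) ∂ν) +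
    M * ∫ a : ℝ, z / (z + a) ∂μ)

/-- The argument of the barrier function. -/
def barrierArg (ν μ : Measure ℝ) (M : ℝ) (z : ℂ) : ℝ :=
  z.arg + 2 / Real.pi * (∫ a : ℝ, (z + a).arg ∂ν) + M * ∫ a : ℝ, (z / (z + a)).im ∂μ

lemma integrable_of_continuousOn_Icc {E : Type*} [NormedAddCommGroup E] {ν : Measure ℝ}
    [IsFiniteMeasure ν] {a0 : ℝ} (h : ∀ᵐ a ∂ν, a ∈ Ioc 0 a0) {f : ℝ → E}
    (hf : ContinuousOn f (Icc 0 a0)) : Integrable f ν := by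
  have h1 : IntegrableOn f (Icc 0 a0) ν := hf.integrableOn_compact isCompact_Icc
  rwa [IntegrableOn, Measure.restrict_eq_self_of_ae_mem
    (h.mono fun a ha => Ioc_subset_Icc_self ha)] at h1

lemma add_ofReal_mem_slitPlane {z : ℂ} (hz : 0 < z.re) {a : ℝ} (ha : 0 ≤ a) :
    z + a ∈ Complex.slitPlane := by
  left; simp; linarith

lemma add_ofReal_ne_zero {z : ℂ} (hz : 0 < z.re) {a : ℝ} (ha : 0 ≤ a) : z + a ≠ 0 :=
  Complex.slitPlane_ne_zero (add_ofReal_mem_slitPlane hz ha)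

lemma continuousOn_log_add {z : ℂ} (hz : 0 < z.re) (a0 : ℝ) :
    ContinuousOn (fun a : ℝ => Complex.log (z + a)) (Icc 0 a0) := by
  refine ContinuousOn.clog (by fun_prop) fun a ha => add_ofReal_mem_slitPlane hz ha.1

lemma continuousOn_div_add {z : ℂ} (hz : 0 < z.re) (a0 : ℝ) :
    ContinuousOn (fun a : ℝ => z / (z + a)) (Icc 0 a0) := by
  refine ContinuousOn.div (by fun_prop) (by fun_prop) fun a ha => add_ofReal_ne_zero hz ha.1

lemma le_norm_of_mem_ball {z w : ℂ} (hw : w ∈ ball z (z.re / 2)) {a : ℝ} (ha : 0 ≤ a) :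
    z.re / 2 ≤ ‖w + a‖ := by
  have h1 : |(w - z).re| ≤ ‖w - z‖ := Complex.abs_re_le_norm _
  rw [mem_ball, dist_eq_norm] at hw
  have h2 := (abs_lt.1 (h1.trans_lt hw)).1
  have h3 : (w + a).re ≤ ‖w + a‖ := Complex.re_le_norm _
  simp at h2 h3
  linarith

lemma re_pos_of_mem_ball {z w : ℂ} (hz : 0 < z.re) (hw : w ∈ ball z (z.re / 2)) : 0 < w.re := by
  have h1 : |(w - z).re| ≤ ‖w - z‖ := Complex.abs_re_le_norm _
  rw [mem_ball, dist_eq_norm] at hw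
  have h2 := (abs_lt.1 (h1.trans_lt hw)).1
  simp at h2
  linarith

lemma differentiableAt_integral_log {ν : Measure ℝ} [IsFiniteMeasure ν] {a0 : ℝ}
    (h : ∀ᵐ a ∂ν, a ∈ Ioc 0 a0) {z : ℂ} (hz : 0 < z.re) :
    DifferentiableAt ℂ (fun z : ℂ => ∫ a : ℝ, Complex.log (z + a) ∂ν) z := by
  refine (hasDerivAt_integral_of_dominated_loc_of_deriv_le (𝕜 := ℂ) (μ := ν)
    (F := fun (z : ℂ) (a : ℝ) => Complex.log (z + a)) (F' := fun (z : ℂ) (a : ℝ) => (z + a)⁻¹)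
    (s := ball z (z.re / 2)) (bound := fun _ => (z.re / 2)⁻¹) (ball_mem_nhds z (by linarith))
    (Eventually.of_forall fun w => (Complex.measurable_log.comp
      (by fun_prop : Measurable fun a : ℝ => w + a)).aestronglyMeasurable)
    (integrable_of_continuousOn_Icc h (continuousOn_log_add hz a0)) ?_ ?_ (integrable_const _)
    ?_).2.differentiableAt
  · exact (by fun_prop : Measurable fun a : ℝ => (z + a)⁻¹).aestronglyMeasurable
  · filter_upwards [h] with a ha w hw
    rw [norm_inv]
    exact inv_anti₀ (by linarith) (le_norm_of_mem_ball hw ha.1.le)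
  · filter_upwards [h] with a ha w hw
    have h1 : HasDerivAt (fun w : ℂ => w + a) 1 w := (hasDerivAt_id w).add_const _
    simpa using h1.clog (add_ofReal_mem_slitPlane (re_pos_of_mem_ball hz hw) ha.1.le)

lemma differentiableAt_integral_div {μ : Measure ℝ} [IsFiniteMeasure μ] {a0 : ℝ}
    (h : ∀ᵐ a ∂μ, a ∈ Ioc 0 a0) {z : ℂ} (hz : 0 < z.re) :
    DifferentiableAt ℂ (fun z : ℂ => ∫ a : ℝ, z / (z + a) ∂μ) z := by
  refine (hasDerivAt_integral_of_dominated_loc_of_deriv_le (𝕜 := ℂ) (μ := μ)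
    (F := fun (z : ℂ) (a : ℝ) => z / (z + a)) (F' := fun (z : ℂ) (a : ℝ) => a / (z + a) ^ 2)
    (s := ball z (z.re / 2)) (bound := fun _ => a0 / (z.re / 2) ^ 2)
    (ball_mem_nhds z (by linarith))
    (Eventually.of_forall fun w =>
      (by fun_prop : Measurable fun a : ℝ => w / (w + a)).aestronglyMeasurable)
    (integrable_of_continuousOn_Icc h (continuousOn_div_add hz a0)) ?_ ?_ (integrable_const _)
    ?_).2.differentiableAt
  · exact (by fun_prop : Measurable fun a : ℝ => (a : ℂ) / (z + a) ^ 2).aestronglyMeasurable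
  · filter_upwards [h] with a ha w hw
    rw [norm_div, norm_pow, Complex.norm_real, Real.norm_of_nonneg ha.1.le]
    have h1 := le_norm_of_mem_ball hw ha.1.le
    have h2 := ha.1
    have h3 := ha.2
    have h4 : 0 < z.re / 2 := by linarith
    have h5 : 0 ≤ a0 := by linarith
    gcongr
  · filter_upwards [h] with a ha w hw
    have h0 := add_ofReal_ne_zero (re_pos_of_mem_ball hz hw) ha.1.le
    have h1 : HasDerivAt (fun w : ℂ => w + a) 1 w := (hasDerivAt_id w).add_const _
    have h2 := (hasDerivAt_id w).div h1 h0
    refine h2.congr_deriv ?_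
    simp only [id]
    ring

lemma differentiableAt_barrier {ν μ : Measure ℝ} [IsFiniteMeasure ν] [IsFiniteMeasure μ] {a0 : ℝ}
    (hν : ∀ᵐ a ∂ν, a ∈ Ioc 0 a0) (hμ : ∀ᵐ a ∂μ, a ∈ Ioc 0 a0) (M : ℝ) {z : ℂ} (hz : 0 < z.re) :
    DifferentiableAt ℂ (barrier ν μ M) z :=
  differentiableAt_id.mul (((differentiableAt_integral_log hν hz).const_mul _).add
    ((differentiableAt_integral_div hμ hz).const_mul _)).cexp

lemma barrier_re {ν μ : Measure ℝ} [IsFiniteMeasure ν] [IsFiniteMeasure μ] {a0 : ℝ}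
    (hν : ∀ᵐ a ∂ν, a ∈ Ioc 0 a0) (hμ : ∀ᵐ a ∂μ, a ∈ Ioc 0 a0) (M : ℝ) {z : ℂ} (hz : 0 < z.re) :
    (barrier ν μ M z).re = ‖barrier ν μ M z‖ * Real.cos (barrierArg ν μ M z) := by
  have hz0 : z ≠ 0 := by rintro rfl; simp at hz
  have h1 : barrier ν μ M z = Complex.exp (Complex.log z +
      ((2 / Real.pi : ℝ) * (∫ a : ℝ, Complex.log (z + a) ∂ν) + M * ∫ a : ℝ, z / (z + a) ∂μ)) := by
    rw [Complex.exp_add, Complex.exp_log hz0]; rfl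
  have h2 : ∫ a : ℝ, (z + a).arg ∂ν = (∫ a : ℝ, Complex.log (z + a) ∂ν).im := by
    have := (Complex.imCLM.integral_comp_comm
      (integrable_of_continuousOn_Icc hν (continuousOn_log_add hz a0)))
    simpa [Complex.log_im] using this
  have h3 : ∫ a : ℝ, (z / (z + a)).im ∂μ = (∫ a : ℝ, z / (z + a) ∂μ).im := by
    have := (Complex.imCLM.integral_comp_comm
      (integrable_of_continuousOn_Icc hμ (continuousOn_div_add hz a0)))
    simpa using this
  rw [h1, Complex.exp_re, Complex.norm_exp]
  congr 2
  rw [Complex.add_im, Complex.add_im, Complex.im_ofReal_mul, Complex.im_ofReal_mul, Complex.log_im,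
    barrierArg, h2, h3, add_assoc]

lemma norm_barrier {ν μ : Measure ℝ} [IsFiniteMeasure ν] [IsFiniteMeasure μ] {a0 : ℝ}
    (hν : ∀ᵐ a ∂ν, a ∈ Ioc 0 a0) (hμ : ∀ᵐ a ∂μ, a ∈ Ioc 0 a0) (M : ℝ) {z : ℂ} (hz : 0 < z.re) :
    ‖barrier ν μ M z‖ = ‖z‖ * Real.exp (2 / Real.pi * (∫ a : ℝ, Real.log ‖z + a‖ ∂ν) +
      M * ∫ a : ℝ, (z / (z + a)).re ∂μ) := by
  have h2 : ∫ a : ℝ, Real.log ‖z + a‖ ∂ν = (∫ a : ℝ, Complex.log (z + a) ∂ν).re := by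
    have := (Complex.reCLM.integral_comp_comm
      (integrable_of_continuousOn_Icc hν (continuousOn_log_add hz a0)))
    simpa [Complex.log_re] using this
  have h3 : ∫ a : ℝ, (z / (z + a)).re ∂μ = (∫ a : ℝ, z / (z + a) ∂μ).re := by
    have := (Complex.reCLM.integral_comp_comm
      (integrable_of_continuousOn_Icc hμ (continuousOn_div_add hz a0)))
    simpa using this
  rw [barrier, norm_mul, Complex.norm_exp, h2, h3]
  simp

lemma barrierArg_conj {ν μ : Measure ℝ} {a0 : ℝ} (hν : ∀ᵐ a ∂ν, a ∈ Ioc 0 a0)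
    (M : ℝ) {z : ℂ} (hz : 0 < z.re) :
    barrierArg ν μ M (starRingEnd ℂ z) = -barrierArg ν μ M z := by
  have harg : ∀ a : ℝ, 0 ≤ a → (starRingEnd ℂ z + a).arg = -(z + a).arg := by
    intro a ha
    have : starRingEnd ℂ z + a = starRingEnd ℂ (z + a) := by simp
    rw [this, Complex.arg_conj, if_neg]
    exact (Complex.mem_slitPlane_iff_arg.1 (add_ofReal_mem_slitPlane hz ha)).1
  have h1 : ∫ a : ℝ, (starRingEnd ℂ z + a).arg ∂ν = -∫ a : ℝ, (z + a).arg ∂ν := by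
    rw [← integral_neg]
    exact integral_congr_ae (hν.mono fun a ha => harg a ha.1.le)
  have h2 : ∫ a : ℝ, (starRingEnd ℂ z / (starRingEnd ℂ z + a)).im ∂μ
      = -∫ a : ℝ, (z / (z + a)).im ∂μ := by
    rw [← integral_neg]
    congr 1; ext a
    have : starRingEnd ℂ z / (starRingEnd ℂ z + a) = starRingEnd ℂ (z / (z + a)) := by simp
    rw [this, Complex.conj_im]
  have h3 := harg 0 le_rfl
  simp only [Complex.ofReal_zero, add_zero] at h3
  rw [barrierArg, barrierArg, h1, h2, h3]; ring

lemma div_add_im (z : ℂ) (a : ℝ) : (z / (z + a)).im = a * z.im / ‖z + a‖ ^ 2 := by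
  rw [Complex.div_im, ← Complex.normSq_eq_norm_sq]
  simp; ring

lemma norm_add_ofReal_sq (z : ℂ) (a : ℝ) : ‖z + a‖ ^ 2 = ‖z‖ ^ 2 + 2 * a * z.re + a ^ 2 := by
  rw [← Complex.normSq_eq_norm_sq, ← Complex.normSq_eq_norm_sq, Complex.normSq_apply,
    Complex.normSq_apply]
  simp; ring

lemma arg_mem_of_re_pos {z : ℂ} (hz : 0 < z.re) (hz' : 0 ≤ z.im) :
    0 ≤ z.arg ∧ z.arg < Real.pi / 2 :=
  ⟨Complex.arg_nonneg_iff.2 hz', Complex.arg_lt_pi_div_two_iff.2 (Or.inl hz)⟩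

/-- Pointwise comparison of `arg (z + a)` with `arg z` restricted to `a ≤ ‖z‖`. -/
lemma abs_arg_add_sub_le {z : ℂ} (hz : 0 < z.re) (hz' : 0 ≤ z.im) {a : ℝ} (ha : 0 < a) :
    |(z + a).arg - (Ioc 0 ‖z‖).indicator (fun _ => z.arg) a| ≤ Real.pi * (z / (z + a)).im := by
  have hza : 0 < (z + a).re := by simp; linarith
  have hza' : 0 ≤ (z + a).im := by simpa using hz'
  have hn : 0 < ‖z + a‖ := norm_pos_iff.2 (add_ofReal_ne_zero hz ha.le)
  have hn0 : 0 < ‖z‖ := norm_pos_iff.2 (by rintro rfl; simp at hz)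
  have h1 := arg_mem_of_re_pos hza hza'
  have h2 := arg_mem_of_re_pos hz hz'
  have hsz := Complex.sin_arg z
  have hsza := Complex.sin_arg (z + a)
  have hcz := Complex.cos_arg (x := z) (norm_pos_iff.1 hn0)
  have hcza := Complex.cos_arg (x := z + a) (norm_pos_iff.1 hn)
  have him : (z + a).im = z.im := by simp
  have hre : (z + a).re = z.re + a := by simp
  have hsq := norm_add_ofReal_sq z a
  have hrn : z.re ≤ ‖z‖ := Complex.re_le_norm z
  rw [div_add_im]
  by_cases h : a ≤ ‖z‖
  · rw [indicator_of_mem (show a ∈ Ioc 0 ‖z‖ from ⟨ha, h⟩)]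
    have hsin : Real.sin (z.arg - (z + a).arg) = a * z.im / (‖z‖ * ‖z + a‖) := by
      rw [Real.sin_sub, hsz, hsza, hcz, hcza, him, hre]
      field_simp; ring
    have hpos : 0 ≤ z.arg - (z + a).arg := by
      by_contra! hneg
      have h3 : Real.sin (z.arg - (z + a).arg) < 0 :=
        Real.sin_neg_of_neg_of_neg_pi_lt hneg (by linarith [Real.pi_pos])
      rw [hsin] at h3
      have : 0 ≤ a * z.im / (‖z‖ * ‖z + a‖) := by positivity
      linarith
    have h4 := Real.mul_le_sin hpos (by linarith)
    rw [hsin] at h4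
    rw [abs_sub_comm, abs_of_nonneg hpos]
    have h5 : ‖z + a‖ ≤ 2 * ‖z‖ := by
      refine (norm_add_le _ _).trans ?_
      rw [Complex.norm_real, Real.norm_of_nonneg ha.le]; linarith
    have h6 : z.arg - (z + a).arg ≤ Real.pi / 2 * (a * z.im / (‖z‖ * ‖z + a‖)) := by
      have := mul_le_mul_of_nonneg_left h4 (by positivity : (0 : ℝ) ≤ Real.pi / 2)
      refine le_trans (le_of_eq ?_) this
      field_simp
    refine h6.trans ?_
    rw [div_mul_eq_mul_div, mul_div_assoc', mul_div_assoc', div_div,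
      div_le_div_iff₀ (by positivity) (by positivity)]
    have h7 : 0 ≤ Real.pi * (a * z.im) := by positivity
    nlinarith [mul_le_mul_of_nonneg_left h5 (mul_nonneg h7 hn.le)]
  · push Not at h
    rw [indicator_of_notMem (show a ∉ Ioc 0 ‖z‖ from fun h' => absurd h'.2 (not_le.2 h)), sub_zero,
      abs_of_nonneg h1.1]
    have h3 : (z + a).arg ≤ z.im / (z.re + a) := by
      have h4 := Real.le_tan h1.1 h1.2
      rwa [Complex.tan_arg, him, hre] at h4
    refine h3.trans ?_
    rw [mul_div_assoc', div_le_div_iff₀ (by linarith) (by positivity)]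
    have h5 : ‖z + a‖ ^ 2 ≤ Real.pi * (a * (z.re + a)) := by
      have h6 : ‖z‖ ^ 2 ≤ a ^ 2 := by gcongr
      have h7 := Real.pi_gt_three
      have h8 : 0 ≤ a * (z.re + a) := by positivity
      nlinarith
    nlinarith

lemma div_add_im_nonneg {z : ℂ} (hz' : 0 ≤ z.im) {a : ℝ} (ha : 0 < a) : 0 ≤ (z / (z + a)).im := by
  rw [div_add_im]; positivity

lemma div_add_im_le_half {z : ℂ} (hz : 0 < z.re) {a : ℝ} (ha : 0 < a) :
    (z / (z + a)).im ≤ 1 / 2 := by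
  have hn : 0 < ‖z + a‖ := norm_pos_iff.2 (add_ofReal_ne_zero hz ha.le)
  rw [div_add_im, div_le_iff₀ (by positivity), norm_add_ofReal_sq]
  have : z.im ≤ ‖z‖ := Complex.im_le_norm z
  nlinarith [sq_nonneg (‖z‖ - a), mul_pos ha hz]

lemma le_div_add_im {z : ℂ} (hz : 0 < z.re) (hz' : 0 ≤ z.im) {a : ℝ}
    (ha : a ∈ Ioc (‖z‖ / 2) (2 * ‖z‖)) : 2 / 9 * (z.im / ‖z‖) ≤ (z / (z + a)).im := by
  have hn0 : 0 < ‖z‖ := norm_pos_iff.2 (by rintro rfl; simp at hz)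
  have ha0 : 0 < a := by linarith [ha.1]
  have hn : 0 < ‖z + a‖ := norm_pos_iff.2 (add_ofReal_ne_zero hz ha0.le)
  rw [div_add_im, mul_div_assoc', div_le_div_iff₀ (by positivity) (by positivity)]
  have h1 : ‖z + a‖ ≤ ‖z‖ + a := by
    refine (norm_add_le _ _).trans ?_
    rw [Complex.norm_real, Real.norm_of_nonneg ha0.le]
  have h2 : ‖z + a‖ ^ 2 ≤ (‖z‖ + a) ^ 2 := by gcongr
  have h3 : 2 / 9 * (‖z‖ + a) ^ 2 ≤ a * ‖z‖ := by nlinarith [ha.1, ha.2]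
  have h4 : 2 / 9 * ‖z + a‖ ^ 2 ≤ a * ‖z‖ := by linarith
  nlinarith

end Barrier

section BarrierEstimates

/-- The data of a pair of measures used to build the barriers for the gauge `κ`. -/
structure IsBarrierPair (κ : ℝ → ℝ) (a0 : ℝ) (ν μ : Measure ℝ) : Prop where
  pos : 0 < a0
  le_one : a0 ≤ 1
  mono : MonotoneOn κ (Icc 0 a0)
  nonneg : ∀ r ∈ Icc 0 a0, 0 ≤ κ r
  small : κ a0 ≤ 1 / 10000
  le : ν ≤ μ
  ae : ∀ᵐ a ∂μ, a ∈ Ioc 0 a0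
  tot : μ.real univ ≤ 2 / 10000
  fst_Ioc : ∀ r ∈ Icc 0 a0, ν.real (Ioc 0 r) = κ r
  snd_Ioc : ∀ r ∈ Ioc 0 (a0 / 2), κ r - κ (r / 2) + κ r ^ 2 / 2 ≤ μ.real (Ioc (r / 2) (2 * r))

variable {κ : ℝ → ℝ} {a0 : ℝ} {ν μ : Measure ℝ} [IsFiniteMeasure ν] [IsFiniteMeasure μ]

lemma IsBarrierPair.ae_fst (h : IsBarrierPair κ a0 ν μ) : ∀ᵐ a ∂ν, a ∈ Ioc 0 a0 :=
  (Measure.absolutelyContinuous_of_le h.le).ae_le h.ae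

lemma IsBarrierPair.le_small (h : IsBarrierPair κ a0 ν μ) {r : ℝ} (hr : r ∈ Icc 0 a0) :
    κ r ≤ 1 / 10000 :=
  (h.mono hr ⟨h.pos.le, le_rfl⟩ hr.2).trans h.small

lemma continuousOn_div_add_im {z : ℂ} (hz : 0 < z.re) (a0 : ℝ) :
    ContinuousOn (fun a : ℝ => (z / (z + a)).im) (Icc 0 a0) :=
  Complex.continuous_im.comp_continuousOn (continuousOn_div_add hz a0)

lemma continuousOn_arg_add {z : ℂ} (hz : 0 < z.re) (a0 : ℝ) :
    ContinuousOn (fun a : ℝ => (z + a).arg) (Icc 0 a0) := by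
  have := Complex.continuous_im.comp_continuousOn (continuousOn_log_add hz a0)
  refine this.congr fun a _ => by simp [Complex.log_im]

lemma IsBarrierPair.integral_im_nonneg (h : IsBarrierPair κ a0 ν μ) {z : ℂ} (hz' : 0 ≤ z.im) :
    0 ≤ ∫ a : ℝ, (z / (z + a)).im ∂μ :=
  integral_nonneg_of_ae (h.ae.mono fun _ ha => div_add_im_nonneg hz' ha.1)

lemma IsBarrierPair.integral_im_le (h : IsBarrierPair κ a0 ν μ) {z : ℂ} (hz : 0 < z.re) :
    ∫ a : ℝ, (z / (z + a)).im ∂μ ≤ 1 / 10000 := by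
  calc ∫ a : ℝ, (z / (z + a)).im ∂μ ≤ ∫ _ : ℝ, (1 / 2 : ℝ) ∂μ :=
        integral_mono_ae (integrable_of_continuousOn_Icc h.ae (continuousOn_div_add_im hz a0))
          (integrable_const _) (h.ae.mono fun _ ha => div_add_im_le_half hz ha.1)
    _ ≤ 1 / 10000 := by
        rw [integral_const, smul_eq_mul]; linarith [h.tot]

lemma IsBarrierPair.le_integral_im (h : IsBarrierPair κ a0 ν μ) {z : ℂ} (hz : 0 < z.re)
    (hz' : 0 ≤ z.im) (hza : ‖z‖ ≤ a0 / 2) :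
    2 / 9 * (z.im / ‖z‖) * (κ ‖z‖ - κ (‖z‖ / 2) + κ ‖z‖ ^ 2 / 2) ≤
      ∫ a : ℝ, (z / (z + a)).im ∂μ := by
  have hn0 : 0 < ‖z‖ := norm_pos_iff.2 (by rintro rfl; simp at hz)
  have hint := integrable_of_continuousOn_Icc h.ae (continuousOn_div_add_im hz a0)
  calc 2 / 9 * (z.im / ‖z‖) * (κ ‖z‖ - κ (‖z‖ / 2) + κ ‖z‖ ^ 2 / 2)
      ≤ 2 / 9 * (z.im / ‖z‖) * μ.real (Ioc (‖z‖ / 2) (2 * ‖z‖)) := by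
        gcongr; exact h.snd_Ioc _ ⟨hn0, hza⟩
    _ = ∫ a in Ioc (‖z‖ / 2) (2 * ‖z‖), 2 / 9 * (z.im / ‖z‖) ∂μ := by
        rw [setIntegral_const, smul_eq_mul, mul_comm]
    _ ≤ ∫ a in Ioc (‖z‖ / 2) (2 * ‖z‖), (z / (z + a)).im ∂μ := by
        refine setIntegral_mono_on (integrable_const _) hint.integrableOn measurableSet_Ioc
          fun a ha => le_div_add_im hz hz' ha
    _ ≤ ∫ a : ℝ, (z / (z + a)).im ∂μ :=
        setIntegral_le_integral hint (h.ae.mono fun _ ha => div_add_im_nonneg hz' ha.1)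

lemma IsBarrierPair.abs_integral_arg_sub_le (h : IsBarrierPair κ a0 ν μ) {z : ℂ} (hz : 0 < z.re)
    (hz' : 0 ≤ z.im) (hza : ‖z‖ ≤ a0 / 2) :
    |∫ a : ℝ, (z + a).arg ∂ν - z.arg * κ ‖z‖| ≤ Real.pi * ∫ a : ℝ, (z / (z + a)).im ∂μ := by
  have hn0 : 0 < ‖z‖ := norm_pos_iff.2 (by rintro rfl; simp at hz)
  have hint := integrable_of_continuousOn_Icc h.ae (continuousOn_div_add_im hz a0)
  have h1 : z.arg * κ ‖z‖ = ∫ a, (Ioc 0 ‖z‖).indicator (fun _ => z.arg) a ∂ν := by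
    rw [integral_indicator_const _ measurableSet_Ioc, smul_eq_mul,
      h.fst_Ioc _ ⟨hn0.le, by linarith [h.pos]⟩, mul_comm]
  rw [h1, ← integral_sub (integrable_of_continuousOn_Icc h.ae_fst (continuousOn_arg_add hz a0))
    ((integrable_const _).indicator measurableSet_Ioc)]
  refine (abs_integral_le_integral_abs).trans ?_
  calc ∫ a : ℝ, |(z + a).arg - (Ioc 0 ‖z‖).indicator (fun _ => z.arg) a| ∂ν
      ≤ ∫ a : ℝ, Real.pi * (z / (z + a)).im ∂ν := by
        refine integral_mono_of_nonneg (Eventually.of_forall fun _ => abs_nonneg _)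
          ((hint.mono_measure h.le).const_mul _)
          (h.ae_fst.mono fun a ha => abs_arg_add_sub_le hz hz' ha.1)
    _ = Real.pi * ∫ a : ℝ, (z / (z + a)).im ∂ν := integral_const_mul _ _
    _ ≤ Real.pi * ∫ a : ℝ, (z / (z + a)).im ∂μ := by
        have := integral_mono_measure h.le
          (h.ae.mono fun _ ha => div_add_im_nonneg hz' ha.1) hint
        have hpi := Real.pi_pos
        gcongr

lemma IsBarrierPair.abs_barrierArg_sub_le (h : IsBarrierPair κ a0 ν μ) (M : ℝ) {z : ℂ}
    (hz : 0 < z.re) (hz' : 0 ≤ z.im) (hza : ‖z‖ ≤ a0 / 2) :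
    |barrierArg ν μ M z - (z.arg + 2 / Real.pi * z.arg * κ ‖z‖ +
      M * ∫ a : ℝ, (z / (z + a)).im ∂μ)| ≤ 2 * ∫ a : ℝ, (z / (z + a)).im ∂μ := by
  have h1 := h.abs_integral_arg_sub_le hz hz' hza
  have hpi := Real.pi_pos
  have h2 : barrierArg ν μ M z - (z.arg + 2 / Real.pi * z.arg * κ ‖z‖ +
      M * ∫ a : ℝ, (z / (z + a)).im ∂μ) =
      2 / Real.pi * (∫ a : ℝ, (z + a).arg ∂ν - z.arg * κ ‖z‖) := by
    rw [barrierArg]; ring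
  rw [h2, abs_mul, abs_of_pos (by positivity)]
  calc 2 / Real.pi * |∫ a : ℝ, (z + a).arg ∂ν - z.arg * κ ‖z‖|
      ≤ 2 / Real.pi * (Real.pi * ∫ a : ℝ, (z / (z + a)).im ∂μ) := by gcongr
    _ = 2 * ∫ a : ℝ, (z / (z + a)).im ∂μ := by field_simp

/-- Trigonometric facts in polar coordinates. -/
lemma polar_facts {z : ℂ} (hz : 0 < z.re) (hz' : 0 ≤ z.im) :
    0 < ‖z‖ ∧ z.re = ‖z‖ * Real.cos z.arg ∧ z.im = ‖z‖ * Real.sin z.arg ∧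
      0 ≤ z.arg ∧ z.arg < Real.pi / 2 ∧ 0 < Real.cos z.arg ∧ 0 ≤ Real.sin z.arg ∧
      Real.cos z.arg < Real.pi / 2 - z.arg := by
  have hz0 : z ≠ 0 := by rintro rfl; simp at hz
  have hn0 : 0 < ‖z‖ := norm_pos_iff.2 hz0
  have h1 := arg_mem_of_re_pos hz hz'
  refine ⟨hn0, ?_, ?_, h1.1, h1.2, ?_, ?_, ?_⟩
  · rw [Complex.cos_arg hz0]; field_simp
  · rw [Complex.sin_arg]; field_simp
  · rw [Complex.cos_arg hz0]; positivity
  · rw [Complex.sin_arg]; positivity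
  · rw [← Real.sin_pi_div_two_sub]
    exact Real.sin_lt (by linarith)

lemma IsBarrierPair.barrierArg_neg (h : IsBarrierPair κ a0 ν μ) {z : ℂ}
    (hz : 0 < z.re) (hz' : 0 ≤ z.im) (hza : ‖z‖ ≤ a0 / 2) (hγ : z.im * κ z.im ≤ z.re) :
    |barrierArg ν μ (-100) z| < Real.pi / 2 := by
  obtain ⟨hn0, hre, him, hϑ, hϑ', hcos, hsin, hcos'⟩ := polar_facts hz hz'
  have h1 := abs_le.1 (h.abs_barrierArg_sub_le (-100) hz hz' hza)
  have hJ0 := h.integral_im_nonneg hz'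
  have hJ1 := h.integral_im_le hz
  have hJ2 := h.le_integral_im hz hz' hza
  have hsin_eq : z.im / ‖z‖ = Real.sin z.arg := (Complex.sin_arg z).symm
  rw [hsin_eq] at hJ2
  have hρ : ‖z‖ ∈ Icc 0 a0 := ⟨hn0.le, by linarith [h.pos]⟩
  have hρ2 : ‖z‖ / 2 ∈ Icc 0 a0 := ⟨by positivity, by linarith [h.pos]⟩
  have hκ0 := h.nonneg _ hρ
  have hκ1 := h.le_small hρ
  have hκ2 := h.nonneg _ hρ2
  have hκ3 := h.mono hρ2 hρ (by linarith)
  set J := ∫ a : ℝ, (z / (z + a)).im ∂μ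
  set k := κ ‖z‖
  set k2 := κ (‖z‖ / 2)
  have hpi := Real.pi_gt_three
  have hpi0 := Real.pi_pos
  have hq0 : 0 ≤ 2 / Real.pi * z.arg * k := by positivity
  have hq : 2 / Real.pi * z.arg * k ≤ k := by
    have : 2 / Real.pi * z.arg ≤ 1 := by
      rw [div_mul_eq_mul_div, div_le_one hpi0]; linarith
    nlinarith
  rw [abs_lt]
  refine ⟨by linarith, ?_⟩
  rcases lt_or_ge (Real.sin z.arg) (1 / 2) with hs | hs
  · have : z.arg < 1 := by
      have := Real.mul_le_sin hϑ hϑ'.le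
      rw [div_mul_eq_mul_div, div_le_iff₀ hpi0] at this
      have hpi4 := Real.pi_le_four
      nlinarith
    linarith
  · rcases le_or_gt k (Real.cos z.arg) with hc | hc
    · linarith
    · have hs1 : 1 - k ^ 2 ≤ Real.sin z.arg := by
        have h3 := Real.sin_sq_add_cos_sq z.arg
        have h4 := Real.sin_le_one z.arg
        nlinarith
      have h5 : Real.sin z.arg * k2 ≤ Real.cos z.arg := by
        have h6 : ‖z‖ / 2 ≤ z.im := by rw [him]; nlinarith
        have h7 : z.im ∈ Icc 0 a0 := ⟨hz', (Complex.im_le_norm z).trans hρ.2⟩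
        have h8 : k2 ≤ κ z.im := h.mono hρ2 h7 h6
        have h9 : z.im * k2 ≤ z.re := (mul_le_mul_of_nonneg_left h8 hz').trans hγ
        rw [him, hre, mul_assoc] at h9
        exact le_of_mul_le_mul_left h9 hn0
      have h10 : k ≤ Real.cos z.arg + 98 * J := by
        have h11 : (1 - k ^ 2) * (k + 10 * k ^ 2) ≤ Real.sin z.arg * (k + 10 * k ^ 2) := by gcongr
        have h12 : Real.sin z.arg * (k + 10 * k ^ 2) ≤ Real.cos z.arg + 98 * J := by
          have h13 : 0 ≤ Real.sin z.arg * (k - k2) := mul_nonneg hsin (by linarith)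
          have h14 : 0 ≤ Real.sin z.arg * k ^ 2 := by positivity
          nlinarith
        have h15 : k ≤ (1 - k ^ 2) * (k + 10 * k ^ 2) := by
          have : (1 - k ^ 2) * (k + 10 * k ^ 2) - k = k ^ 2 * (10 - k - 10 * k ^ 2) := by ring
          nlinarith [mul_nonneg (sq_nonneg k) (by nlinarith : 0 ≤ 10 - k - 10 * k ^ 2)]
        linarith
      linarith

set_option maxHeartbeats 1000000 in
lemma IsBarrierPair.barrierArg_pos (h : IsBarrierPair κ a0 ν μ) {z : ℂ}
    (hz : 0 < z.re) (hz' : 0 ≤ z.im) (hza : ‖z‖ ≤ a0 / 2)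
    (hγ : z.re ≤ z.im * κ z.im + (z.im * κ z.im) ^ 2) :
    Real.pi / 2 ≤ barrierArg ν μ 100 z ∧ barrierArg ν μ 100 z ≤ Real.pi + Real.pi / 2 := by
  obtain ⟨hn0, hre, him, hϑ, hϑ', hcos, hsin, hcos'⟩ := polar_facts hz hz'
  have h1 := abs_le.1 (h.abs_barrierArg_sub_le 100 hz hz' hza)
  have hJ0 := h.integral_im_nonneg hz'
  have hJ1 := h.integral_im_le hz
  have hJ2 := h.le_integral_im hz hz' hza
  have hsin_eq : z.im / ‖z‖ = Real.sin z.arg := (Complex.sin_arg z).symm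
  rw [hsin_eq] at hJ2
  have hρ : ‖z‖ ∈ Icc 0 a0 := ⟨hn0.le, by linarith [h.pos]⟩
  have hρ2 : ‖z‖ / 2 ∈ Icc 0 a0 := ⟨by positivity, by linarith [h.pos]⟩
  have h7 : z.im ∈ Icc 0 a0 := ⟨hz', (Complex.im_le_norm z).trans hρ.2⟩
  have hκ0 := h.nonneg _ hρ
  have hκ1 := h.le_small hρ
  have hκ2 := h.nonneg _ hρ2
  have hκ3 := h.mono hρ2 hρ (by linarith)
  have hκ4 := h.mono h7 hρ (Complex.im_le_norm z)
  have hκ5 := h.nonneg _ h7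
  set J := ∫ a : ℝ, (z / (z + a)).im ∂μ
  set k := κ ‖z‖
  set k2 := κ (‖z‖ / 2)
  have hpi := Real.pi_gt_three
  have hpi4 := Real.pi_le_four
  have hpi0 := Real.pi_pos
  have hq0 : 0 ≤ 2 / Real.pi * z.arg * k := by positivity
  have hq : 2 / Real.pi * z.arg * k ≤ k := by
    have : 2 / Real.pi * z.arg ≤ 1 := by
      rw [div_mul_eq_mul_div, div_le_one hpi0]; linarith
    nlinarith
  refine ⟨?_, by linarith⟩
  have hc : Real.cos z.arg ≤ k + k ^ 2 := by
    have h2 : z.im * κ z.im ≤ ‖z‖ * k := by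
      have := Complex.im_le_norm z
      gcongr
    have h3 : (z.im * κ z.im) ^ 2 ≤ (‖z‖ * k) ^ 2 := by gcongr
    have h4 : ‖z‖ * Real.cos z.arg ≤ ‖z‖ * (k + ‖z‖ * k ^ 2) := by
      rw [← hre]; nlinarith
    have h5 := le_of_mul_le_mul_left h4 hn0
    have h6 : ‖z‖ ≤ 1 := by linarith [h.le_one, hρ.2]
    nlinarith [sq_nonneg k]
  set σ := Real.pi / 2 - z.arg with hσ
  have hσ0 : 0 < σ := by linarith
  have hsσ : Real.sin σ = Real.cos z.arg := Real.sin_pi_div_two_sub _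
  have hσ1 : σ ≤ 2 * (k + k ^ 2) := by
    have := Real.mul_le_sin hσ0.le (by linarith : σ ≤ Real.pi / 2)
    rw [hsσ, div_mul_eq_mul_div, div_le_iff₀ hpi0] at this
    nlinarith
  have hσ2 : σ ≤ 3 * k := by nlinarith
  have hσ3 : σ ≤ k + 2 * k ^ 2 := by
    have h3 := Real.sin_gt_sub_cube hσ0
    rw [hsσ] at h3
    have h4 : σ ^ 3 ≤ (3 * k) ^ 3 := by gcongr
    have h5 : k * k ^ 2 ≤ 1 / 10000 * k ^ 2 := mul_le_mul_of_nonneg_right hκ1 (sq_nonneg k)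
    have h6 : (3 * k) ^ 3 = 27 * (k * k ^ 2) := by ring
    linarith [sq_nonneg k]
  have hs : 1 / 2 ≤ Real.sin z.arg := by
    have h3 := Real.sin_sq_add_cos_sq z.arg
    have h4 : Real.cos z.arg ≤ 1 / 100 := by nlinarith
    have h5 : Real.cos z.arg ^ 2 ≤ (1 / 100) ^ 2 := by gcongr
    by_contra! h6
    have h7 : Real.sin z.arg ^ 2 ≤ (1 / 2) ^ 2 := by gcongr
    linarith
  have hq2 : k - 2 * k ^ 2 ≤ 2 / Real.pi * z.arg * k := by
    have h3 : z.arg = Real.pi / 2 - σ := by rw [hσ]; ring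
    have h4 : 2 / Real.pi * z.arg * k = k - 2 / Real.pi * σ * k := by
      rw [h3]; field_simp
    have h5 : 2 / Real.pi * σ ≤ 2 * k := by
      rw [div_mul_eq_mul_div, div_le_iff₀ hpi0]; nlinarith
    rw [h4]; linarith [mul_le_mul_of_nonneg_right h5 hκ0]
  have hJ3 : 5 * k ^ 2 ≤ 98 * J := by
    have h3 : (1 / 2) * (k ^ 2 / 2) ≤ Real.sin z.arg * (k - k2 + k ^ 2 / 2) := by
      have : k ^ 2 / 2 ≤ k - k2 + k ^ 2 / 2 := by linarith
      gcongr
    linarith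
  linarith

lemma IsBarrierPair.barrierArg_sector (h : IsBarrierPair κ a0 ν μ) {z : ℂ}
    (hz : 0 < z.re) (hz' : 0 ≤ z.im) (hza : ‖z‖ ≤ a0 / 2) (hγ : ‖z‖ / 8 ≤ z.re) :
    0 ≤ barrierArg ν μ 100 z ∧ barrierArg ν μ 100 z ≤ Real.pi / 2 - 1 / 16 := by
  obtain ⟨hn0, hre, him, hϑ, hϑ', hcos, hsin, hcos'⟩ := polar_facts hz hz'
  have h1 := abs_le.1 (h.abs_barrierArg_sub_le 100 hz hz' hza)
  have hJ0 := h.integral_im_nonneg hz'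
  have hJ1 := h.integral_im_le hz
  have hρ : ‖z‖ ∈ Icc 0 a0 := ⟨hn0.le, by linarith [h.pos]⟩
  have hκ0 := h.nonneg _ hρ
  have hκ1 := h.le_small hρ
  have hpi0 := Real.pi_pos
  have hq0 : 0 ≤ 2 / Real.pi * z.arg * κ ‖z‖ := by positivity
  have hq : 2 / Real.pi * z.arg * κ ‖z‖ ≤ κ ‖z‖ := by
    have : 2 / Real.pi * z.arg ≤ 1 := by
      rw [div_mul_eq_mul_div, div_le_one hpi0]; linarith
    nlinarith
  have hc : 1 / 8 ≤ Real.cos z.arg := by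
    rw [hre] at hγ
    exact le_of_mul_le_mul_left (by linarith : ‖z‖ * (1 / 8) ≤ ‖z‖ * Real.cos z.arg) hn0
  exact ⟨by linarith, by linarith⟩

lemma IsBarrierPair.integral_log_max (h : IsBarrierPair κ a0 ν μ) {ρ : ℝ} (hρ : ρ ∈ Ioc 0 a0) :
    ∫ a, Real.log (max ρ a) ∂ν = κ a0 * Real.log a0 - ∫ s in ρ..a0, κ s / s := by
  have htot : ν.real univ = κ a0 := by
    rw [← h.fst_Ioc a0 ⟨h.pos.le, le_rfl⟩, measureReal_def, measureReal_def]
    congr 1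
    exact measure_congr (by
      filter_upwards [h.ae_fst] with a ha
      exact propext ⟨fun _ => ha, fun _ => trivial⟩)
  have hint : Integrable (fun p : ℝ × ℝ => (Set.Ici p.1).indicator (fun s => s⁻¹) p.2)
      (ν.prod (volume.restrict (Ioc ρ a0))) := by
    have hm : Measurable fun p : ℝ × ℝ => (Set.Ici p.1).indicator (fun s => s⁻¹) p.2 := by
      have : (fun p : ℝ × ℝ => (Set.Ici p.1).indicator (fun s => s⁻¹) p.2) =
          {p : ℝ × ℝ | p.1 ≤ p.2}.indicator (fun p => p.2⁻¹) := by
        ext p; simp [indicator]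
      rw [this]
      exact (by fun_prop : Measurable fun p : ℝ × ℝ => p.2⁻¹).indicator
        (measurableSet_le measurable_fst measurable_snd)
    refine (integrable_const (ρ⁻¹ : ℝ)).mono' hm.aestronglyMeasurable ?_
    have h2 : ∀ᵐ s ∂(volume.restrict (Ioc ρ a0)), s ∈ Ioc ρ a0 :=
      ae_restrict_mem measurableSet_Ioc
    have h3 := Measure.quasiMeasurePreserving_snd (μ := ν) (ν := volume.restrict (Ioc ρ a0))
    filter_upwards [h3.ae h2] with p hp
    have hp0 : 0 < p.2 := hρ.1.trans hp.1
    rw [indicator]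
    split_ifs
    · rw [Real.norm_of_nonneg (by positivity)]
      exact inv_anti₀ hρ.1 hp.1.le
    · simpa using hρ.1.le
  have hsw := integral_integral_swap
    (f := fun (a s : ℝ) => (Set.Ici a).indicator (fun s => s⁻¹) s) hint
  have hL : ∀ᵐ a ∂ν, ∫ s in Ioc ρ a0, (Set.Ici a).indicator (fun s => s⁻¹) s =
      Real.log a0 - Real.log (max ρ a) := by
    filter_upwards [h.ae_fst] with a ha
    rw [setIntegral_indicator measurableSet_Ici]
    have h4 : (Ioc ρ a0 ∩ Set.Ici a : Set ℝ) =ᵐ[volume] Ioc (max ρ a) a0 := by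
      have : (Ioc ρ a0 ∩ Set.Ici a : Set ℝ) =ᵐ[volume] (Ioc ρ a0 ∩ Set.Ioi a : Set ℝ) :=
        (ae_eq_refl _).inter Ioi_ae_eq_Ici.symm
      refine this.trans (Eventually.of_forall fun s => propext ?_)
      change (ρ < s ∧ s ≤ a0) ∧ a < s ↔ max ρ a < s ∧ s ≤ a0
      rw [max_lt_iff]; tauto
    have h5 : 0 < max ρ a := lt_max_of_lt_left hρ.1
    rw [setIntegral_congr_set h4, ← intervalIntegral.integral_of_le (max_le hρ.2 ha.2),
      integral_inv_of_pos h5 h.pos, Real.log_div h.pos.ne' h5.ne']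
  have hR : ∀ s ∈ Ioc ρ a0, ∫ a, (Set.Ici a).indicator (fun s => s⁻¹) s ∂ν = κ s / s := by
    intro s hs
    have hs0 : 0 < s := hρ.1.trans hs.1
    have h6 : (fun a => (Set.Ici a).indicator (fun s => s⁻¹) s) =ᵐ[ν]
        (Ioc 0 s).indicator (fun _ => s⁻¹) := by
      filter_upwards [h.ae_fst] with a ha
      simp [indicator, ha.1]
    rw [integral_congr_ae h6, integral_indicator_const _ measurableSet_Ioc, smul_eq_mul,
      h.fst_Ioc s ⟨hs0.le, hs.2⟩, div_eq_mul_inv]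
  rw [integral_congr_ae hL] at hsw
  have hlogint : Integrable (fun a => Real.log (max ρ a)) ν := by
    refine integrable_of_continuousOn_Icc h.ae_fst (a0 := a0) ?_
    refine ContinuousOn.log (by fun_prop) fun a _ => (lt_max_of_lt_left hρ.1).ne'
  rw [integral_sub (integrable_const _) hlogint, integral_const, smul_eq_mul, htot,
    setIntegral_congr_fun measurableSet_Ioc hR, ← intervalIntegral.integral_of_le hρ.2] at hsw
  linarith

lemma max_le_norm_add {z : ℂ} (hz : 0 < z.re) {a : ℝ} (ha : 0 ≤ a) :
    max ‖z‖ a ≤ ‖z + a‖ ∧ ‖z + a‖ ≤ 2 * max ‖z‖ a := by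
  have h1 := norm_add_ofReal_sq z a
  have h2 : 0 ≤ a * z.re := by positivity
  refine ⟨max_le (le_of_sq_le_sq ?_ (norm_nonneg _)) (le_of_sq_le_sq ?_ (norm_nonneg _)), ?_⟩
  · nlinarith
  · nlinarith [norm_nonneg z]
  · refine (norm_add_le _ _).trans ?_
    rw [Complex.norm_real, Real.norm_of_nonneg ha]
    linarith [le_max_left ‖z‖ a, le_max_right ‖z‖ a]

lemma div_add_re_mem {z : ℂ} (hz : 0 < z.re) {a : ℝ} (ha : 0 ≤ a) :
    0 ≤ (z / (z + a)).re ∧ (z / (z + a)).re ≤ 1 := by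
  have hn : 0 < ‖z + a‖ := norm_pos_iff.2 (add_ofReal_ne_zero hz ha)
  constructor
  · rw [Complex.div_re]
    have : (z + a).re = z.re + a := by simp
    have h2 : (z + a).im = z.im := by simp
    rw [this, h2, ← add_div]
    apply div_nonneg _ (Complex.normSq_nonneg _)
    have : 0 ≤ z.re * (z.re + a) := by positivity
    nlinarith [mul_self_nonneg z.im]
  · refine (Complex.re_le_norm _).trans ?_
    rw [norm_div, div_le_one hn]
    exact (le_max_left _ _).trans (max_le_norm_add hz ha).1

lemma IsBarrierPair.norm_barrier_mem (h : IsBarrierPair κ a0 ν μ) (M : ℝ) : ∃ C > 0, ∀ z : ℂ,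
    0 < z.re → ‖z‖ ≤ a0 → 
      ‖barrier ν μ M z‖ ≤ C * (‖z‖ * Real.exp (-(2 / Real.pi * ∫ s in ‖z‖..a0, κ s / s))) ∧
      ‖z‖ * Real.exp (-(2 / Real.pi * ∫ s in ‖z‖..a0, κ s / s)) ≤ C * ‖barrier ν μ M z‖ := by
  set B := 2 / Real.pi * (|κ a0 * Real.log a0| + ν.real univ * Real.log 2) + |M| * μ.real univ
    with hB
  have hpi := Real.pi_pos
  refine ⟨Real.exp B, Real.exp_pos _, fun z hz hza => ?_⟩
  have hn0 : 0 < ‖z‖ := norm_pos_iff.2 (by rintro rfl; simp at hz)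
  rw [norm_barrier h.ae_fst h.ae M hz]
  set I := ∫ s in ‖z‖..a0, κ s / s
  set X := ∫ a : ℝ, Real.log ‖z + a‖ ∂ν
  set Y := ∫ a : ℝ, (z / (z + a)).re ∂μ
  have hlogint : Integrable (fun a => Real.log (max ‖z‖ a)) ν := by
    refine integrable_of_continuousOn_Icc h.ae_fst (a0 := a0) ?_
    refine ContinuousOn.log (by fun_prop) fun a _ => (lt_max_of_lt_left hn0).ne'
  have hlogint2 : Integrable (fun a : ℝ => Real.log ‖z + a‖) ν := by
    refine integrable_of_continuousOn_Icc h.ae_fst (a0 := a0) ?_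
    refine ContinuousOn.log (by fun_prop) fun a ha =>
      norm_ne_zero_iff.2 (add_ofReal_ne_zero hz ha.1)
  have hmax := h.integral_log_max ⟨hn0, hza⟩
  have hX1 : κ a0 * Real.log a0 - I ≤ X := by
    rw [← hmax]
    refine integral_mono_ae hlogint hlogint2 (h.ae_fst.mono fun a ha => ?_)
    exact Real.log_le_log (lt_max_of_lt_left hn0) (max_le_norm_add hz ha.1.le).1
  have hX2 : X ≤ κ a0 * Real.log a0 - I + ν.real univ * Real.log 2 := by
    rw [← hmax, ← smul_eq_mul, ← integral_const, ← integral_add hlogint (integrable_const _)]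
    refine integral_mono_ae hlogint2 (hlogint.add (integrable_const _))
      (h.ae_fst.mono fun a ha => ?_)
    have hm : 0 < max ‖z‖ a := lt_max_of_lt_left hn0
    have := max_le_norm_add hz ha.1.le
    simp only [Pi.add_apply]
    rw [← Real.log_mul hm.ne' (by norm_num), mul_comm]
    exact Real.log_le_log (hm.trans_le this.1) this.2
  have hY : 0 ≤ Y ∧ Y ≤ μ.real univ := by
    constructor
    · exact integral_nonneg_of_ae (h.ae.mono fun a ha => (div_add_re_mem hz ha.1.le).1)
    · calc Y ≤ ∫ _ : ℝ, (1 : ℝ) ∂μ := by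
            refine integral_mono_ae ?_ (integrable_const _)
              (h.ae.mono fun a ha => (div_add_re_mem hz ha.1.le).2)
            exact integrable_of_continuousOn_Icc h.ae
              (Complex.continuous_re.comp_continuousOn (continuousOn_div_add hz a0))
        _ = μ.real univ := by simp
  have hMY : |M * Y| ≤ |M| * μ.real univ := by
    rw [abs_mul, abs_of_nonneg hY.1]; gcongr; exact hY.2
  have hν0 : 0 ≤ ν.real univ * Real.log 2 := by positivity
  have habs := abs_le.1 (le_refl |κ a0 * Real.log a0|)
  have hkey : |2 / Real.pi * X + M * Y + 2 / Real.pi * I| ≤ B := by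
    have h1 : |X + I| ≤ |κ a0 * Real.log a0| + ν.real univ * Real.log 2 := by
      rw [abs_le]; constructor <;> linarith
    have h2 : 2 / Real.pi * X + M * Y + 2 / Real.pi * I = 2 / Real.pi * (X + I) + M * Y := by ring
    rw [h2]
    refine (abs_add_le _ _).trans ?_
    rw [abs_mul (2 / Real.pi), abs_of_pos (by positivity : 0 < 2 / Real.pi)]
    have := mul_le_mul_of_nonneg_left h1 (by positivity : 0 ≤ 2 / Real.pi)
    linarith
  have hkey' := abs_le.1 hkey
  constructor
  · rw [mul_left_comm, ← Real.exp_add]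
    exact mul_le_mul_of_nonneg_left (Real.exp_le_exp.2 (by linarith)) hn0.le
  · rw [mul_left_comm, ← Real.exp_add]
    exact mul_le_mul_of_nonneg_left (Real.exp_le_exp.2 (by linarith)) hn0.le

end BarrierEstimates

section Gauge

/-- The properties of the gauge function used in the proof. -/
structure IsGauge (γf : ℝ → ℝ) : Prop where
  zero : γf 0 = 0
  pos : ∀ t ∈ Ioc 0 Real.pi, 0 < γf t
  le_one : ∀ t ∈ Ioc 0 Real.pi, γf t ≤ 1
  cont : ContinuousOn γf (Icc 0 Real.pi)
  mono_quot : MonotoneOn (fun t => γf t / t) (Icc 0 Real.pi)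
  cont_quot : ContinuousOn (fun t => γf t / t) (Icc 0 Real.pi)
  sq : IntegrableOn (fun t => (γf t / t) ^ 2 / t) (Ioc 0 Real.pi)

lemma integrableOn_inv_mul_log_rpow {β : ℝ} (hβ : 1 / 2 < β) :
    IntegrableOn (fun t => 1 / (t * Real.log (1 / t) ^ (2 * β))) (Ioc 0 (1 / 2)) := by
  have h1 : IntegrableOn (fun t => (2 * β - 1) * (1 / (t * Real.log (1 / t) ^ (2 * β))))
      (Ioc 0 (1 / 2)) := by
    have hlog : ∀ x ∈ Ioo (0 : ℝ) 1, 0 < Real.log (1 / x) := fun x hx =>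
      Real.log_pos (by rw [lt_div_iff₀ hx.1]; linarith [hx.2])
    refine intervalIntegral.integrableOn_deriv_of_nonneg
      (g := fun t => Real.log (1 / t) ^ (1 - 2 * β)) ?_ ?_ ?_
    · intro x hx
      rcases eq_or_lt_of_le hx.1 with rfl | hx0
      · have h2 : Tendsto (fun t : ℝ => Real.log (1 / t)) (𝓝[>] 0) atTop := by
          simp only [one_div]
          exact Real.tendsto_log_atTop.comp tendsto_inv_nhdsGT_zero
        have h3 := (tendsto_rpow_neg_atTop (by linarith : 0 < 2 * β - 1)).comp h2
        have h4 : ContinuousWithinAt (fun t => Real.log (1 / t) ^ (1 - 2 * β)) (Ioi 0) (0 : ℝ) := by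
          rw [ContinuousWithinAt]
          simp only [div_zero, Real.log_zero]
          rw [Real.zero_rpow (by linarith)]
          refine h3.congr fun t => ?_
          simp
        exact (continuousWithinAt_Ioi_iff_Ici.1 h4).mono fun t ht => ht.1
      · have h5 := hlog x ⟨hx0, by linarith [hx.2]⟩
        refine ContinuousAt.continuousWithinAt (ContinuousAt.rpow_const (ContinuousAt.log
          (continuousAt_const.div continuousAt_id hx0.ne') (by positivity)) (Or.inl h5.ne'))
    · intro x hx
      have h5 := hlog x ⟨hx.1, by linarith [hx.2]⟩
      have h6 : HasDerivAt (fun t : ℝ => Real.log (1 / t)) (-x⁻¹) x := by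
        have := (Real.hasDerivAt_log hx.1.ne').neg
        refine this.congr_of_eventuallyEq (Eventually.of_forall fun t => ?_)
        simp
      have h7 := h6.rpow_const (p := 1 - 2 * β) (Or.inl h5.ne')
      convert h7 using 1
      rw [show 1 - 2 * β - 1 = -(2 * β) by ring, Real.rpow_neg h5.le]
      have := hx.1.ne'
      field_simp
      ring
    · intro x hx
      have h5 := hlog x ⟨hx.1, by linarith [hx.2]⟩
      have := hx.1
      have : 0 ≤ 2 * β - 1 := by linarith
      positivity
  have h2 := h1.const_mul (2 * β - 1)⁻¹
  refine h2.congr (Eventually.of_forall fun t => ?_)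
  have : 2 * β - 1 ≠ 0 := by linarith
  field_simp

lemma isGauge_of_hypotheses {γf : ℝ → ℝ}
    (hγ_mem : ∀ t ∈ Ioc (0 : ℝ) Real.pi, γf t ∈ Ioc (0 : ℝ) 1)
    (hγ_diff : ∀ t ∈ Ioc (0 : ℝ) Real.pi, DifferentiableAt ℝ γf t)
    (hγ_zero : Tendsto γf (𝓝[>] (0 : ℝ)) (𝓝 0))
    (hγ_quot : MonotoneOn (fun t => γf t / t) (Ioc 0 Real.pi))
    (hγ_log : ∃ β > (1 / 2 : ℝ), ∃ C : ℝ, ∀ᶠ t in 𝓝[>] (0 : ℝ),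
      γf t ≤ C * (t / Real.log (1 / t) ^ β)) (h0 : γf 0 = 0) : IsGauge γf := by
  have hpi := Real.pi_pos
  have hcq : ContinuousOn (fun t => γf t / t) (Ioc 0 Real.pi) := fun t ht =>
    ((hγ_diff t ht).continuousAt.div continuousAt_id ht.1.ne').continuousWithinAt
  obtain ⟨β, hβ, C, hC⟩ := hγ_log
  obtain ⟨ε0, hε0, hε⟩ := (mem_nhdsGT_iff_exists_Ioo_subset).1 hC
  have hε0' : (0 : ℝ) < ε0 := hε0
  refine ⟨h0, fun t ht => (hγ_mem t ht).1, fun t ht => (hγ_mem t ht).2, ?_, ?_, ?_, ?_⟩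
  · intro t ht
    rcases eq_or_lt_of_le ht.1 with rfl | ht0
    · have : ContinuousWithinAt γf (Ioi 0) 0 := by rwa [ContinuousWithinAt, h0]
      exact (continuousWithinAt_Ioi_iff_Ici.1 this).mono fun t ht => ht.1
    · exact (hγ_diff t ⟨ht0, ht.2⟩).continuousAt.continuousWithinAt
  · intro x hx y hy hxy
    rcases eq_or_lt_of_le hx.1 with rfl | hx0
    · rcases eq_or_lt_of_le hy.1 with rfl | hy0
      · exact le_rfl
      · simp only [div_zero]
        exact div_nonneg (hγ_mem y ⟨hy0, hy.2⟩).1.le hy0.le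
    · exact hγ_quot ⟨hx0, hx.2⟩ ⟨hx0.trans_le hxy, hy.2⟩ hxy
  · intro t ht
    rcases eq_or_lt_of_le ht.1 with rfl | ht0
    · have h4 : ContinuousWithinAt (fun t => γf t / t) (Ioi 0) (0 : ℝ) := by
        rw [ContinuousWithinAt]
        simp only [div_zero]
        have h2 : Tendsto (fun t : ℝ => Real.log (1 / t)) (𝓝[>] 0) atTop := by
          simp only [one_div]
          exact Real.tendsto_log_atTop.comp tendsto_inv_nhdsGT_zero
        have h3 := ((tendsto_rpow_neg_atTop (by linarith : 0 < β)).comp h2).const_mul C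
        rw [mul_zero] at h3
        refine tendsto_of_tendsto_of_tendsto_of_le_of_le' tendsto_const_nhds h3 ?_ ?_
        · filter_upwards [Ioo_mem_nhdsGT hpi] with t ht
          exact div_nonneg (hγ_mem t ⟨ht.1, ht.2.le⟩).1.le ht.1.le
        · filter_upwards [hC, Ioo_mem_nhdsGT (by norm_num : (0 : ℝ) < 1)] with t ht ht1
          have h5 : 0 < Real.log (1 / t) :=
            Real.log_pos (by rw [lt_div_iff₀ ht1.1]; linarith [ht1.2])
          rw [div_le_iff₀ ht1.1]
          simp only [Function.comp]
          rw [Real.rpow_neg h5.le]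
          refine ht.trans (le_of_eq ?_)
          rw [div_eq_mul_inv]; ring
      exact (continuousWithinAt_Ioi_iff_Ici.1 h4).mono fun t ht => ht.1
    · exact ((hγ_diff t ⟨ht0, ht.2⟩).continuousAt.div continuousAt_id
        ht0.ne').continuousWithinAt
  · set ε := min (ε0 / 2) (1 / 2) with hεd
    have hεp : 0 < ε := lt_min (by linarith) (by norm_num)
    have hεpi : ε ≤ Real.pi := (min_le_right _ _).trans (by linarith [Real.pi_gt_three])
    have hc2 : ContinuousOn (fun t => (γf t / t) ^ 2 / t) (Ioc 0 Real.pi) :=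
      (hcq.pow 2).div continuousOn_id fun t ht => ht.1.ne'
    rw [← Ioc_union_Ioc_eq_Ioc hεp.le hεpi]
    refine IntegrableOn.union ?_ ?_
    · have h6 := ((integrableOn_inv_mul_log_rpow hβ).mono_set
        (Ioc_subset_Ioc_right (min_le_right (ε0 / 2) (1 / 2)))).const_mul (C ^ 2)
      refine h6.mono' ((hc2.mono (Ioc_subset_Ioc_right hεpi)).aestronglyMeasurable
        measurableSet_Ioc) ?_
      filter_upwards [ae_restrict_mem measurableSet_Ioc] with t ht
      have h7 : t ∈ Ioo 0 ε0 := ⟨ht.1, by linarith [ht.2, min_le_left (ε0 / 2) (1 / 2)]⟩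
      have h8 : γf t ≤ C * (t / Real.log (1 / t) ^ β) := hε h7
      have ht1 : t ≤ 1 / 2 := ht.2.trans (min_le_right _ _)
      have ht0 := ht.1
      have h9 := (hγ_mem t ⟨ht0, ht.2.trans hεpi⟩).1
      have h5 : 0 < Real.log (1 / t) := Real.log_pos (by rw [lt_div_iff₀ ht0]; linarith)
      rw [Real.norm_of_nonneg (by positivity)]
      have h10 : γf t / t ≤ C / Real.log (1 / t) ^ β := by
        rw [div_le_iff₀ ht0]; refine h8.trans (le_of_eq ?_); ring
      have h11 : (γf t / t) ^ 2 ≤ (C / Real.log (1 / t) ^ β) ^ 2 := by gcongr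
      calc (γf t / t) ^ 2 / t ≤ (C / Real.log (1 / t) ^ β) ^ 2 / t := by gcongr
        _ = C ^ 2 * (1 / (t * Real.log (1 / t) ^ (2 * β))) := by
          rw [mul_comm 2 β, Real.rpow_mul h5.le]
          norm_cast
          field_simp
    · refine ((hc2.mono fun t ht => ?_).integrableOn_compact isCompact_Icc).mono_set
        (Ioc_subset_Icc_self)
      exact ⟨hεp.trans_le ht.1, ht.2⟩

variable {γf : ℝ → ℝ}

lemma IsGauge.quot_pos (h : IsGauge γf) {t : ℝ} (ht : t ∈ Ioc 0 Real.pi) : 0 < γf t / t :=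
  div_pos (h.pos t ht) ht.1

lemma IsGauge.quot_nonneg (h : IsGauge γf) {t : ℝ} (ht : t ∈ Icc 0 Real.pi) : 0 ≤ γf t / t := by
  rcases eq_or_lt_of_le ht.1 with rfl | ht0
  · simp
  · exact (h.quot_pos ⟨ht0, ht.2⟩).le

lemma IsGauge.nonneg (h : IsGauge γf) {t : ℝ} (ht : t ∈ Icc 0 Real.pi) : 0 ≤ γf t := by
  rcases eq_or_lt_of_le ht.1 with rfl | ht0
  · simp [h.zero]
  · exact (h.pos _ ⟨ht0, ht.2⟩).le

lemma IsGauge.mul_quot (h : IsGauge γf) (t : ℝ) : t * (γf t / t) = γf t := by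
  rcases eq_or_ne t 0 with rfl | ht0
  · simp [h.zero]
  · field_simp

lemma IsGauge.mono (h : IsGauge γf) : MonotoneOn γf (Icc 0 Real.pi) := by
  intro x hx y hy hxy
  rw [← h.mul_quot x, ← h.mul_quot y]
  exact mul_le_mul hxy (h.mono_quot hx hy hxy) (h.quot_nonneg hx) hy.1

lemma IsGauge.tendsto_quot (h : IsGauge γf) :
    Tendsto (fun t => γf t / t) (𝓝[>] 0) (𝓝 0) := by
  have h1 := h.cont_quot 0 ⟨le_rfl, Real.pi_pos.le⟩
  have h2 : 𝓝[>] (0 : ℝ) ≤ 𝓝[Icc 0 Real.pi] 0 := by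
    rw [← nhdsWithin_Ioc_eq_nhdsGT Real.pi_pos]; exact nhdsWithin_mono _ Ioc_subset_Icc_self
  have := h1.tendsto.mono_left h2
  simpa using this

lemma IsGauge.continuousOn_div_sq (h : IsGauge γf) :
    ContinuousOn (fun t => γf t / t ^ 2) (Ioc 0 Real.pi) :=
  (h.cont.mono Ioc_subset_Icc_self).div (by fun_prop) fun t ht => by
    have := ht.1; positivity

lemma IsGauge.continuousOn_inv (h : IsGauge γf) :
    ContinuousOn (fun t => 1 / γf t) (Ioc 0 Real.pi) :=
  continuousOn_const.div (h.cont.mono Ioc_subset_Icc_self) fun t ht => (h.pos t ht).ne'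

lemma intervalIntegrable_of_continuousOn_Ioc {f : ℝ → ℝ} {b x y : ℝ}
    (hf : ContinuousOn f (Ioc 0 b)) (hx : x ∈ Ioc 0 b) (hy : y ∈ Ioc 0 b) :
    IntervalIntegrable f volume x y :=
  (hf.mono (Set.ordConnected_Ioc.uIcc_subset hx hy)).intervalIntegrable

/-- The counting integral `∫_x^π dt / γ(t)`. -/
def gaugeCount (γf : ℝ → ℝ) (x : ℝ) : ℝ := ∫ t in x..Real.pi, 1 / γf t

lemma one_mem_Ioc_pi : (1 : ℝ) ∈ Ioc 0 Real.pi := ⟨one_pos, by linarith [Real.pi_gt_three]⟩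

lemma IsGauge.Gam_sub (h : IsGauge γf) {x y : ℝ} (hx : x ∈ Ioc 0 Real.pi)
    (hy : y ∈ Ioc 0 Real.pi) : Gam γf x - Gam γf y = 2 / Real.pi * ∫ s in x..y, γf s / s ^ 2 := by
  have h1 := fun {a b : ℝ} (ha : a ∈ Ioc 0 Real.pi) (hb : b ∈ Ioc 0 Real.pi) =>
    intervalIntegrable_of_continuousOn_Ioc h.continuousOn_div_sq ha hb
  have h2 := intervalIntegral.integral_add_adjacent_intervals (h1 hx hy) (h1 hy one_mem_Ioc_pi)
  rw [Gam, Gam, ← h2]; ring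

lemma IsGauge.gaugeCount_sub (h : IsGauge γf) {x y : ℝ} (hx : x ∈ Ioc 0 Real.pi)
    (hy : y ∈ Ioc 0 Real.pi) : gaugeCount γf x - gaugeCount γf y = ∫ s in x..y, 1 / γf s := by
  have h1 := fun {a b : ℝ} (ha : a ∈ Ioc 0 Real.pi) (hb : b ∈ Ioc 0 Real.pi) =>
    intervalIntegrable_of_continuousOn_Ioc h.continuousOn_inv ha hb
  have hpi : Real.pi ∈ Ioc 0 Real.pi := ⟨Real.pi_pos, le_rfl⟩
  have h2 := intervalIntegral.integral_add_adjacent_intervals (h1 hx hy) (h1 hy hpi)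
  rw [gaugeCount, gaugeCount, ← h2]; ring

lemma integral_le_mul_log {f : ℝ → ℝ} {x y c : ℝ} (hx : 0 < x) (hxy : x ≤ y)
    (hf : IntervalIntegrable f volume x y) (h : ∀ t ∈ Icc x y, f t ≤ c * t⁻¹) :
    ∫ t in x..y, f t ≤ c * Real.log (y / x) := by
  rw [← integral_inv_of_pos hx (hx.trans_le hxy), ← intervalIntegral.integral_const_mul]
  refine intervalIntegral.integral_mono_on hxy hf ?_ h
  exact (ContinuousOn.intervalIntegrable (ContinuousOn.mul continuousOn_const
    (continuousOn_inv₀.mono fun t ht => by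
      rw [uIcc_of_le hxy] at ht; exact (hx.trans_le ht.1).ne')))

lemma mul_log_le_integral {f : ℝ → ℝ} {x y c : ℝ} (hx : 0 < x) (hxy : x ≤ y)
    (hf : IntervalIntegrable f volume x y) (h : ∀ t ∈ Icc x y, c * t⁻¹ ≤ f t) :
    c * Real.log (y / x) ≤ ∫ t in x..y, f t := by
  have := integral_le_mul_log (f := fun t => -f t) (c := -c) hx hxy hf.neg
    fun t ht => by have := h t ht; linarith
  rw [intervalIntegral.integral_neg] at this
  linarith

lemma IsGauge.Gam_sub_le (h : IsGauge γf) {x y : ℝ} (hx : 0 < x) (hxy : x ≤ y)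
    (hy : y ≤ Real.pi) : Gam γf x - Gam γf y ≤ 2 / Real.pi * (γf y / y * Real.log (y / x)) := by
  have hx' : x ∈ Ioc 0 Real.pi := ⟨hx, hxy.trans hy⟩
  have hy' : y ∈ Ioc 0 Real.pi := ⟨hx.trans_le hxy, hy⟩
  rw [h.Gam_sub hx' hy']
  have hpi := Real.pi_pos
  gcongr
  refine integral_le_mul_log hx hxy
    (intervalIntegrable_of_continuousOn_Ioc h.continuousOn_div_sq hx' hy') fun t ht => ?_
  have ht0 : 0 < t := hx.trans_le ht.1
  have := h.mono_quot (a := t) (b := y) ⟨ht0.le, ht.2.trans hy⟩ ⟨hy'.1.le, hy⟩ ht.2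
  calc γf t / t ^ 2 = γf t / t * t⁻¹ := by field_simp
    _ ≤ γf y / y * t⁻¹ := by gcongr

lemma IsGauge.le_Gam_sub (h : IsGauge γf) {x y : ℝ} (hx : 0 < x) (hxy : x ≤ y)
    (hy : y ≤ Real.pi) : 2 / Real.pi * (γf x / x * Real.log (y / x)) ≤ Gam γf x - Gam γf y := by
  have hx' : x ∈ Ioc 0 Real.pi := ⟨hx, hxy.trans hy⟩
  have hy' : y ∈ Ioc 0 Real.pi := ⟨hx.trans_le hxy, hy⟩
  rw [h.Gam_sub hx' hy']
  have hpi := Real.pi_pos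
  gcongr
  refine mul_log_le_integral hx hxy
    (intervalIntegrable_of_continuousOn_Ioc h.continuousOn_div_sq hx' hy') fun t ht => ?_
  have ht0 : 0 < t := hx.trans_le ht.1
  have := h.mono_quot (a := x) (b := t) ⟨hx.le, hxy.trans hy⟩ ⟨ht0.le, ht.2.trans hy⟩ ht.1
  calc γf x / x * t⁻¹ ≤ γf t / t * t⁻¹ := by gcongr
    _ = γf t / t ^ 2 := by field_simp

lemma IsGauge.Gam_anti (h : IsGauge γf) {x y : ℝ} (hx : 0 < x) (hxy : x ≤ y)
    (hy : y ≤ Real.pi) : Gam γf y ≤ Gam γf x := by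
  have h1 := h.le_Gam_sub hx hxy hy
  have h2 := h.quot_nonneg (t := x) ⟨hx.le, hxy.trans hy⟩
  have h3 : 0 ≤ Real.log (y / x) := Real.log_nonneg (by rwa [le_div_iff₀ hx, one_mul])
  have hpi := Real.pi_pos
  have : 0 ≤ 2 / Real.pi * (γf x / x * Real.log (y / x)) := by positivity
  linarith

lemma Gam_one : Gam γf 1 = 0 := by simp [Gam]

lemma IsGauge.Gam_nonneg (h : IsGauge γf) {x : ℝ} (hx : 0 < x) (hx1 : x ≤ 1) :
    0 ≤ Gam γf x := by
  have := h.Gam_anti hx hx1 one_mem_Ioc_pi.2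
  rwa [Gam_one] at this

lemma IsGauge.gaugeCount_sub_le (h : IsGauge γf) {x y : ℝ} (hx : 0 < x) (hxy : x ≤ y)
    (hy : y ≤ Real.pi) :
    gaugeCount γf x - gaugeCount γf y ≤ (γf x / x)⁻¹ * Real.log (y / x) := by
  have hx' : x ∈ Ioc 0 Real.pi := ⟨hx, hxy.trans hy⟩
  have hy' : y ∈ Ioc 0 Real.pi := ⟨hx.trans_le hxy, hy⟩
  rw [h.gaugeCount_sub hx' hy']
  refine integral_le_mul_log hx hxy
    (intervalIntegrable_of_continuousOn_Ioc h.continuousOn_inv hx' hy') fun t ht => ?_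
  have ht0 : 0 < t := hx.trans_le ht.1
  have h1 := h.mono_quot (a := x) (b := t) ⟨hx.le, hxy.trans hy⟩ ⟨ht0.le, ht.2.trans hy⟩ ht.1
  have h2 := h.quot_pos hx'
  calc 1 / γf t = (γf t / t)⁻¹ * t⁻¹ := by field_simp
    _ ≤ (γf x / x)⁻¹ * t⁻¹ := by gcongr

lemma IsGauge.le_gaugeCount_sub (h : IsGauge γf) {x y : ℝ} (hx : 0 < x) (hxy : x ≤ y)
    (hy : y ≤ Real.pi) :
    (γf y / y)⁻¹ * Real.log (y / x) ≤ gaugeCount γf x - gaugeCount γf y := by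
  have hx' : x ∈ Ioc 0 Real.pi := ⟨hx, hxy.trans hy⟩
  have hy' : y ∈ Ioc 0 Real.pi := ⟨hx.trans_le hxy, hy⟩
  rw [h.gaugeCount_sub hx' hy']
  refine mul_log_le_integral hx hxy
    (intervalIntegrable_of_continuousOn_Ioc h.continuousOn_inv hx' hy') fun t ht => ?_
  have ht0 : 0 < t := hx.trans_le ht.1
  have h1 := h.mono_quot (a := t) (b := y) ⟨ht0.le, ht.2.trans hy⟩ ⟨hy'.1.le, hy⟩ ht.2
  have h2 := h.quot_pos (t := t) ⟨ht0, ht.2.trans hy⟩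
  calc (γf y / y)⁻¹ * t⁻¹ ≤ (γf t / t)⁻¹ * t⁻¹ := by gcongr
    _ = 1 / γf t := by field_simp

lemma IsGauge.gaugeCount_anti (h : IsGauge γf) {x y : ℝ} (hx : 0 < x) (hxy : x ≤ y)
    (hy : y ≤ Real.pi) : gaugeCount γf y ≤ gaugeCount γf x := by
  have h1 := h.le_gaugeCount_sub hx hxy hy
  have h2 := h.quot_nonneg (t := y) ⟨(hx.trans_le hxy).le, hy⟩
  have h3 : 0 ≤ Real.log (y / x) := Real.log_nonneg (by rwa [le_div_iff₀ hx, one_mul])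
  have : 0 ≤ (γf y / y)⁻¹ * Real.log (y / x) := by positivity
  linarith

lemma gaugeCount_pi : gaugeCount γf Real.pi = 0 := by simp [gaugeCount]

lemma IsGauge.gaugeCount_nonneg (h : IsGauge γf) {x : ℝ} (hx : 0 < x) (hx1 : x ≤ Real.pi) :
    0 ≤ gaugeCount γf x := by
  have := h.gaugeCount_anti hx hx1 le_rfl
  rwa [gaugeCount_pi] at this

/-- A bounded ratio of counting integrals yields a bounded difference of `Gam`. -/
lemma IsGauge.Gam_le_add_of_gaugeCount_le (h : IsGauge γf) {C : ℝ} (hC : 0 ≤ C)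
    (hlog : ∀ t ∈ Ioc 0 Real.pi, γf t / t * Real.log (Real.pi / t) ≤ C) {x y B : ℝ}
    (hx : x ∈ Ioc 0 Real.pi) (hy : y ∈ Ioc 0 Real.pi) (hB : 1 ≤ B)
    (hN : gaugeCount γf y ≤ B * gaugeCount γf x) :
    Gam γf y ≤ Gam γf x + B * C := by
  have hpi := Real.pi_pos
  rcases le_or_gt x y with hxy | hxy
  · have := h.Gam_anti hx.1 hxy hy.2
    have : 0 ≤ B * C := by positivity
    linarith
  · have h1 : Gam γf y - Gam γf x ≤ 2 / Real.pi * ((γf x / x) ^ 2 *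
        (gaugeCount γf y - gaugeCount γf x)) := by
      rw [h.Gam_sub hy hx, h.gaugeCount_sub hy hx]
      refine mul_le_mul_of_nonneg_left ?_ (by positivity)
      rw [← intervalIntegral.integral_const_mul]
      refine intervalIntegral.integral_mono_on hxy.le
        (intervalIntegrable_of_continuousOn_Ioc h.continuousOn_div_sq hy hx)
        ((intervalIntegrable_of_continuousOn_Ioc h.continuousOn_inv hy hx).const_mul _)
        fun t ht => ?_
      have ht0 : 0 < t := hy.1.trans_le ht.1
      have ht' : t ∈ Ioc 0 Real.pi := ⟨ht0, ht.2.trans hx.2⟩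
      have h2 := h.mono_quot (a := t) (b := x) ⟨ht0.le, ht'.2⟩ ⟨hx.1.le, hx.2⟩ ht.2
      have h3 := h.pos t ht'
      calc γf t / t ^ 2 = (γf t / t) ^ 2 * (1 / γf t) := by field_simp
        _ ≤ (γf x / x) ^ 2 * (1 / γf t) := by gcongr
    have hN0 := h.gaugeCount_nonneg hx.1 hx.2
    have h4 : gaugeCount γf x ≤ (γf x / x)⁻¹ * Real.log (Real.pi / x) := by
      have := h.gaugeCount_sub_le hx.1 hx.2 le_rfl
      rwa [gaugeCount_pi, sub_zero] at this
    have h5 : γf x / x * gaugeCount γf x ≤ C * (γf x / x)⁻¹ := by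
      have h6 := hlog x hx
      have hκ := h.quot_pos hx
      calc γf x / x * gaugeCount γf x ≤ γf x / x * ((γf x / x)⁻¹ * Real.log (Real.pi / x)) := by
            gcongr
        _ = (γf x / x * Real.log (Real.pi / x)) * (γf x / x)⁻¹ := by ring
        _ ≤ _ := by gcongr
    have hκ := h.quot_pos hx
    have h7 : (γf x / x) ^ 2 * gaugeCount γf x ≤ C := by
      calc (γf x / x) ^ 2 * gaugeCount γf x = γf x / x * (γf x / x * gaugeCount γf x) := by ring
        _ ≤ γf x / x * (C * (γf x / x)⁻¹) := by gcongr
        _ = C := by rw [mul_left_comm, mul_inv_cancel₀ hκ.ne', mul_one]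
    have h8 : (γf x / x) ^ 2 * (gaugeCount γf y - gaugeCount γf x) ≤ B * C := by
      calc (γf x / x) ^ 2 * (gaugeCount γf y - gaugeCount γf x)
          ≤ (γf x / x) ^ 2 * (B * gaugeCount γf x) := by gcongr; linarith
        _ = B * ((γf x / x) ^ 2 * gaugeCount γf x) := by ring
        _ ≤ B * C := by gcongr
    have h9 : 2 / Real.pi ≤ 1 := by
      rw [div_le_one hpi]; linarith [Real.pi_gt_three]
    have h10 : 0 ≤ (γf x / x) ^ 2 * (gaugeCount γf y - gaugeCount γf x) := by
      have := h.gaugeCount_anti hy.1 hxy.le hx.2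
      exact mul_nonneg (sq_nonneg _) (by linarith)
    nlinarith

end Gauge

section GaugeBarriers

variable {γf : ℝ → ℝ}

lemma IsGauge.exists_barriers (h : IsGauge γf) :
    ∃ ρ0 ∈ Ioc (0 : ℝ) (1 / 2), ∃ F₁ F₂ : ℂ → ℂ, ∃ C > 0,
      (∀ z : ℂ, 0 < z.re → DifferentiableAt ℂ F₁ z ∧ DifferentiableAt ℂ F₂ z) ∧
      (∀ z : ℂ, 0 < z.re → ‖z‖ ≤ ρ0 →
        ‖F₁ z‖ ≤ C * (‖z‖ * Real.exp (-Gam γf ‖z‖)) ∧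
        ‖F₂ z‖ ≤ C * (‖z‖ * Real.exp (-Gam γf ‖z‖)) ∧
        ‖z‖ * Real.exp (-Gam γf ‖z‖) ≤ C * ‖F₂ z‖) ∧
      (∀ z : ℂ, 0 < z.re → ‖z‖ ≤ ρ0 → γf |z.im| ≤ z.re → 0 < (F₁ z).re) ∧
      (∀ z : ℂ, 0 < z.re → ‖z‖ ≤ ρ0 → z.re ≤ γf |z.im| + γf |z.im| ^ 2 → (F₂ z).re ≤ 0) ∧
      (∀ z : ℂ, 0 < z.re → ‖z‖ ≤ ρ0 → ‖z‖ / 8 ≤ z.re → ‖F₂ z‖ ≤ C * (F₂ z).re) := by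
  have hone : Icc (0 : ℝ) 1 ⊆ Icc 0 Real.pi := Icc_subset_Icc_right one_mem_Ioc_pi.2
  obtain ⟨a0, ha0, hsm, ν, μ, hν, hμ, hle, hae, htot, hfst, hsnd⟩ :=
    exists_barrier_measures (κ := fun t => γf t / t) one_pos (h.mono_quot.mono hone)
      (h.cont_quot.mono hone) (by simp) (h.sq.mono_set (Ioc_subset_Ioc_right one_mem_Ioc_pi.2))
      (δ := 1 / 10000) (by norm_num)
  have hsub : Icc 0 a0 ⊆ Icc 0 Real.pi := Icc_subset_Icc_right (ha0.2.trans one_mem_Ioc_pi.2)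
  have hp : IsBarrierPair (fun t => γf t / t) a0 ν μ :=
    { pos := ha0.1, le_one := ha0.2, mono := h.mono_quot.mono hsub
      nonneg := fun r hr => h.quot_nonneg (hsub hr)
      small := hsm, le := hle, ae := hae, tot := by linarith
      fst_Ioc := hfst, snd_Ioc := hsnd }
  have ha0pi : a0 ∈ Ioc 0 Real.pi := ⟨ha0.1, ha0.2.trans one_mem_Ioc_pi.2⟩
  have hpi := Real.pi_pos
  -- the norm estimate in terms of `Gam`
  have hnorm : ∀ M : ℝ, ∃ C > 0, ∀ z : ℂ, 0 < z.re → ‖z‖ ≤ a0 →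
      ‖barrier ν μ M z‖ ≤ C * (‖z‖ * Real.exp (-Gam γf ‖z‖)) ∧
      ‖z‖ * Real.exp (-Gam γf ‖z‖) ≤ C * ‖barrier ν μ M z‖ := by
    intro M
    obtain ⟨C, hC, hCz⟩ := hp.norm_barrier_mem M
    refine ⟨C * Real.exp |Gam γf a0|, by positivity, fun z hz hza => ?_⟩
    have hn0 : 0 < ‖z‖ := norm_pos_iff.2 (by rintro rfl; simp at hz)
    obtain ⟨h1, h2⟩ := hCz z hz hza
    have h3 : 2 / Real.pi * ∫ s in ‖z‖..a0, γf s / s / s = Gam γf ‖z‖ - Gam γf a0 := by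
      rw [h.Gam_sub ⟨hn0, hza.trans ha0pi.2⟩ ha0pi]
      congr 2; ext s; rw [div_div, pow_two]
    rw [h3, neg_sub] at h1 h2
    have h4 : Real.exp (Gam γf a0 - Gam γf ‖z‖) ≤
        Real.exp |Gam γf a0| * Real.exp (-Gam γf ‖z‖) := by
      rw [← Real.exp_add]; gcongr; linarith [le_abs_self (Gam γf a0)]
    have h5 : Real.exp (-Gam γf ‖z‖) ≤
        Real.exp |Gam γf a0| * Real.exp (Gam γf a0 - Gam γf ‖z‖) := by
      rw [← Real.exp_add]; gcongr; linarith [neg_abs_le (Gam γf a0)]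
    constructor
    · calc _ ≤ _ := h1
        _ ≤ C * (‖z‖ * (Real.exp |Gam γf a0| * Real.exp (-Gam γf ‖z‖))) := by gcongr
        _ = _ := by ring
    · calc ‖z‖ * Real.exp (-Gam γf ‖z‖)
          ≤ ‖z‖ * (Real.exp |Gam γf a0| * Real.exp (Gam γf a0 - Gam γf ‖z‖)) := by gcongr
        _ = Real.exp |Gam γf a0| * (‖z‖ * Real.exp (Gam γf a0 - Gam γf ‖z‖)) := by ring
        _ ≤ Real.exp |Gam γf a0| * (C * ‖barrier ν μ M z‖) := by gcongr
        _ = _ := by ring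
  obtain ⟨C1, hC1, hC1z⟩ := hnorm (-100)
  obtain ⟨C2, hC2, hC2z⟩ := hnorm 100
  -- reduction to the upper half plane
  have hcos : ∀ (M : ℝ) (z : ℂ), 0 < z.re →
      ∃ w : ℂ, w.re = z.re ∧ w.im = |z.im| ∧ ‖w‖ = ‖z‖ ∧
        Real.cos (barrierArg ν μ M z) = Real.cos (barrierArg ν μ M w) := by
    intro M z hz
    rcases le_or_gt 0 z.im with him | him
    · exact ⟨z, rfl, (abs_of_nonneg him).symm, rfl, rfl⟩
    · refine ⟨starRingEnd ℂ z, by simp, by simp [abs_of_neg him], by simp, ?_⟩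
      rw [barrierArg_conj hp.ae_fst M hz, Real.cos_neg]
  have hmulq : ∀ t : ℝ, t * (γf t / t) = γf t := h.mul_quot
  have hs16 : 0 < Real.sin (1 / 16) :=
    Real.sin_pos_of_pos_of_lt_pi (by norm_num) (by linarith [Real.pi_gt_three])
  set C := C1 + C2 + (Real.sin (1 / 16))⁻¹ with hC
  have hinv : 0 < (Real.sin (1 / 16))⁻¹ := inv_pos.2 hs16
  refine ⟨a0 / 2, ⟨by linarith [ha0.1], by linarith [ha0.2]⟩, barrier ν μ (-100), barrier ν μ 100,
    C, by positivity, fun z hz => ⟨differentiableAt_barrier hp.ae_fst hp.ae _ hz,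
      differentiableAt_barrier hp.ae_fst hp.ae _ hz⟩, fun z hz hza => ?_, ?_, ?_, ?_⟩
  · have hza' : ‖z‖ ≤ a0 := by linarith [ha0.1]
    refine ⟨(hC1z z hz hza').1.trans ?_, (hC2z z hz hza').1.trans ?_,
      (hC2z z hz hza').2.trans ?_⟩ <;> gcongr <;> linarith
  · intro z hz hza hγ
    obtain ⟨w, hw1, hw2, hw3, hw4⟩ := hcos (-100) z hz
    rw [barrier_re hp.ae_fst hp.ae _ hz, hw4]
    have hw := hp.barrierArg_neg (z := w) (by rw [hw1]; exact hz) (by rw [hw2]; positivity)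
      (by rw [hw3]; exact hza) (by rw [hmulq, hw1, hw2]; exact hγ)
    rw [abs_lt] at hw
    have h1 := Real.cos_pos_of_mem_Ioo ⟨hw.1, hw.2⟩
    have h2 : 0 < ‖barrier ν μ (-100) z‖ := by
      have hn0 : 0 < ‖z‖ := norm_pos_iff.2 (by rintro rfl; simp at hz)
      rw [norm_barrier hp.ae_fst hp.ae _ hz]; positivity
    positivity
  · intro z hz hza hγ
    obtain ⟨w, hw1, hw2, hw3, hw4⟩ := hcos 100 z hz
    rw [barrier_re hp.ae_fst hp.ae _ hz, hw4]
    have hw := hp.barrierArg_pos (z := w) (by rw [hw1]; exact hz) (by rw [hw2]; positivity)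
      (by rw [hw3]; exact hza) (by rw [hmulq, hw1, hw2]; exact hγ)
    exact mul_nonpos_of_nonneg_of_nonpos (norm_nonneg _)
      (Real.cos_nonpos_of_pi_div_two_le_of_le hw.1 hw.2)
  · intro z hz hza hγ
    obtain ⟨w, hw1, hw2, hw3, hw4⟩ := hcos 100 z hz
    rw [barrier_re hp.ae_fst hp.ae _ hz, hw4]
    have hw := hp.barrierArg_sector (z := w) (by rw [hw1]; exact hz) (by rw [hw2]; positivity)
      (by rw [hw3]; exact hza) (by rw [hw1, hw3]; exact hγ)
    have h1 : Real.sin (1 / 16) ≤ Real.cos (barrierArg ν μ 100 w) := by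
      rw [← Real.cos_pi_div_two_sub]
      exact Real.cos_le_cos_of_nonneg_of_le_pi hw.1 (by linarith) hw.2
    have h2 : 1 ≤ C * Real.cos (barrierArg ν μ 100 w) := by
      calc 1 = (Real.sin (1 / 16))⁻¹ * Real.sin (1 / 16) := by field_simp
        _ ≤ C * Real.cos (barrierArg ν μ 100 w) := by gcongr; linarith
    nlinarith [norm_nonneg (barrier ν μ 100 z)]

end GaugeBarriers

section CuspGeometry

variable {γf : ℝ → ℝ}

/-- The geometry of `Ω` near the boundary point `1` in the coordinate `w = exp (-z)`. -/
structure IsCuspDomain (γf : ℝ → ℝ) (Ω : Set ℂ) (ρ₁ : ℝ) : Prop where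
  pos : 0 < ρ₁
  le_half : ρ₁ ≤ 1 / 2
  isOpen : IsOpen Ω
  subset_ball : Ω ⊆ ball 0 1
  lt_re : ∀ z : ℂ, ‖z‖ < ρ₁ → Complex.exp (-z) ∈ Ω → γf |z.im| < z.re
  mem_of_le : ∀ z : ℂ, ‖z‖ < ρ₁ → 0 < z.re → γf |z.im| + γf |z.im| ^ 2 ≤ z.re →
    Complex.exp (-z) ∈ Ω
  frontier_mem : ∀ z : ℂ, ‖z‖ < ρ₁ → Complex.exp (-z) ∈ closure Ω → Complex.exp (-z) ∉ Ω →
    γf |z.im| ≤ z.re ∧ z.re ≤ γf |z.im| + γf |z.im| ^ 2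
  far : ∀ ρ > 0, ∃ R < 1, ∀ w ∈ Ω, (∀ z : ℂ, ‖z‖ < ρ → Complex.exp (-z) ≠ w) → ‖w‖ ≤ R

lemma mem_of_segment {Ω : Set ℂ} (hΩ : IsOpen Ω) {p q : ℂ}
    (h : ∀ z ∈ segment ℝ p q, Complex.exp (-z) ∉ frontier Ω) (hp : Complex.exp (-p) ∈ Ω) :
    Complex.exp (-q) ∈ Ω := by
  have hc : IsPreconnected ((fun z : ℂ => Complex.exp (-z)) '' segment ℝ p q) :=
    (convex_segment p q).isPreconnected.image _ (by fun_prop)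
  refine hc.subset_left_of_subset_union hΩ isClosed_closure.isOpen_compl (v := (closure Ω)ᶜ)
    ?_ ?_ ?_ (mem_image_of_mem _ (right_mem_segment ℝ p q))
  · exact (disjoint_compl_right).mono_left subset_closure
  · rintro _ ⟨z, hz, rfl⟩
    by_cases h1 : Complex.exp (-z) ∈ closure Ω
    · by_contra h2
      refine h z hz ⟨h1, ?_⟩
      rw [hΩ.interior_eq]
      exact fun h3 => h2 (Or.inl h3)
    · exact Or.inr h1
  · exact ⟨_, mem_image_of_mem _ (left_mem_segment ℝ p q), hp⟩

lemma lt_one_sub_exp_neg {g s : ℝ} (hg : 0 ≤ g) (hg4 : g ≤ 1 / 4) (hs : 0 < s)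
    (h : g + g ^ 2 ≤ s) : g < 1 - Real.exp (-s) := by
  have h1 := Real.quadratic_le_exp_of_nonneg hs.le
  have h2 : Real.exp (-s) * Real.exp s = 1 := by rw [← Real.exp_add]; simp
  have h3 := Real.exp_pos (-s)
  have h4 : Real.exp (-s) * (1 + s + s ^ 2 / 2) ≤ 1 := by
    calc Real.exp (-s) * (1 + s + s ^ 2 / 2) ≤ Real.exp (-s) * Real.exp s := by gcongr
      _ = 1 := h2
  by_contra! h5
  have h6 : (1 - g) * (1 + s + s ^ 2 / 2) ≤ 1 := by
    refine le_trans ?_ h4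
    gcongr; linarith
  rcases eq_or_lt_of_le hg with rfl | hg0
  · nlinarith
  · have h7 : (g + g ^ 2) ^ 2 ≤ s ^ 2 := by gcongr
    have h8 : (1 - g) * (1 + (g + g ^ 2) + (g + g ^ 2) ^ 2 / 2) ≤ 1 := by
      refine le_trans ?_ h6
      have : 0 ≤ 1 - g := by linarith
      gcongr
    have h9 : (1 - g) * (1 + (g + g ^ 2) + (g + g ^ 2) ^ 2 / 2) - 1 =
        g ^ 2 * (1 / 2 - g / 2 * 3 + g ^ 0 * (g - g ^ 2 / 2 - g ^ 3 / 2)) + 0 := by ring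
    have h10 : 0 < g ^ 2 * (1 / 2 - g / 2 * 3 + g ^ 0 * (g - g ^ 2 / 2 - g ^ 3 / 2)) := by
      have : 0 < 1 / 2 - g / 2 * 3 + g ^ 0 * (g - g ^ 2 / 2 - g ^ 3 / 2) := by
        rw [pow_zero]
        have h11 : g ^ 2 ≤ 1 / 16 := by nlinarith
        have h12 : g ^ 3 ≤ 1 / 64 := by
          calc g ^ 3 ≤ (1 / 4) ^ 3 := by gcongr
            _ = _ := by norm_num
        linarith
      positivity
    linarith

lemma exists_isCuspDomain (hγ : IsGauge γf) {Ω : Set ℂ} (hΩ_open : IsOpen Ω) (hΩ_sub : Ω ⊆ ball (0 : ℂ) 1)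
    (hΩ_bd : frontier Ω ∩ frontier (ball (0 : ℂ) 1) = {1})
    (hΩ_polar : ∃ ε > 0, ∀ r θ : ℝ, |1 - r| < ε → |θ| < ε →
      (((r : ℂ) * Complex.exp (θ * Complex.I) ∈ frontier Ω) ↔ 1 - r = γf |θ|)) :
    ∃ ρ₁, IsCuspDomain γf Ω ρ₁ := by
  obtain ⟨ε, hε, hpol⟩ := hΩ_polar
  have hpi := Real.pi_gt_three
  set a := min ε 1 / 8 with ha
  have ha0 : 0 < a := by positivity
  have haε : a ≤ ε / 8 := by rw [ha]; gcongr; exact min_le_left _ _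
  have ha1 : a ≤ 1 / 8 := by rw [ha]; gcongr; exact min_le_right _ _
  have hea : 0 < 1 - Real.exp (-a) := by
    have := Real.exp_lt_exp.2 (neg_lt_zero.2 ha0); rw [Real.exp_zero] at this; linarith
  have hγ0 : Tendsto γf (𝓝[>] 0) (𝓝 0) := by
    have h1 := hγ.cont 0 ⟨le_rfl, by linarith⟩
    rw [ContinuousWithinAt, hγ.zero] at h1
    refine h1.mono_left ?_
    rw [← nhdsWithin_Ioc_eq_nhdsGT Real.pi_pos]; exact nhdsWithin_mono _ Ioc_subset_Icc_self
  obtain ⟨b, hb1, hb2, hb3, hb4⟩ : ∃ b : ℝ, γf b < 1 - Real.exp (-a) ∧ γf b < 1 / 4 ∧ 0 < b ∧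
      b < a := by
    have h1 := hγ0.eventually (Iio_mem_nhds hea)
    have h2 := hγ0.eventually (Iio_mem_nhds (by norm_num : (0 : ℝ) < 1 / 4))
    obtain ⟨b, h1, h2, h3⟩ := (h1.and (h2.and (Ioo_mem_nhdsGT ha0))).exists
    exact ⟨b, h1, h2, h3.1, h3.2⟩
  have hγb : ∀ t : ℝ, |t| ≤ b → 0 ≤ γf |t| ∧ γf |t| ≤ γf b := fun t ht =>
    ⟨hγ.nonneg ⟨abs_nonneg _, by linarith⟩,
      hγ.mono ⟨abs_nonneg _, by linarith⟩ ⟨hb3.le, by linarith⟩ ht⟩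
  have hfr : ∀ z : ℂ, |z.re| ≤ a → |z.im| ≤ b →
      (Complex.exp (-z) ∈ frontier Ω ↔ 1 - Real.exp (-z.re) = γf |z.im|) := by
    intro z hz1 hz2
    have h1 : Complex.exp (-z) =
        ((Real.exp (-z.re) : ℝ) : ℂ) * Complex.exp ((-z.im : ℝ) * Complex.I) := by
      rw [Complex.ofReal_exp, ← Complex.exp_add]
      congr 1
      apply Complex.ext <;> simp
    rw [h1, hpol _ _ _ (by rw [abs_neg]; linarith), abs_neg]
    have := Real.abs_exp_sub_one_le (x := -z.re) (by rw [abs_neg]; linarith)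
    rw [abs_neg] at this
    rw [abs_sub_comm]; linarith
  -- below the curve
  have hbelow : ∀ z : ℂ, |z.re| ≤ a → |z.im| ≤ b → 1 - Real.exp (-z.re) < γf |z.im| →
      Complex.exp (-z) ∉ Ω := by
    intro z hz1 hz2 hz3 hmem
    have h1 : Complex.exp (-(⟨-a, z.im⟩ : ℂ)) ∈ Ω := by
      refine mem_of_segment hΩ_open (p := z) ?_ hmem
      rintro _ ⟨u, v, hu, hv, huv, rfl⟩ hcon
      have hre : (u • z + v • (⟨-a, z.im⟩ : ℂ)).re = u * z.re - v * a := by simp; ring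
      have him : (u • z + v • (⟨-a, z.im⟩ : ℂ)).im = z.im := by
        simp; rw [← add_mul, huv, one_mul]
      have hz1' := abs_le.1 hz1
      have hv' : v = 1 - u := by linarith
      have hle : u * z.re - v * a ≤ z.re := by rw [hv']; nlinarith
      have hge : -a ≤ u * z.re - v * a := by rw [hv']; nlinarith
      rw [hfr _ (by rw [hre, abs_le]; constructor <;> linarith) (by rw [him]; exact hz2), hre,
        him] at hcon
      have := Real.exp_le_exp.2 (neg_le_neg hle)
      linarith
    have h2 := hΩ_sub h1
    rw [mem_ball_zero_iff, Complex.norm_exp] at h2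
    simp at h2
    linarith
  -- above the curve
  have hup : ∀ z : ℂ, |z.re| ≤ a → |z.im| ≤ b → γf |z.im| < 1 - Real.exp (-z.re) →
      (∀ w ∈ segment ℝ z ⟨a, z.im⟩, Complex.exp (-w) ∉ frontier Ω) ∧
      (∀ w ∈ segment ℝ (⟨a, z.im⟩ : ℂ) a, Complex.exp (-w) ∉ frontier Ω) := by
    intro z hz1 hz2 hz3
    constructor
    · rintro _ ⟨u, v, hu, hv, huv, rfl⟩ hcon
      have hre : (u • z + v • (⟨a, z.im⟩ : ℂ)).re = u * z.re + v * a := by simp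
      have him : (u • z + v • (⟨a, z.im⟩ : ℂ)).im = z.im := by
        simp; rw [← add_mul, huv, one_mul]
      have hz1' := abs_le.1 hz1
      have hv' : v = 1 - u := by linarith
      have hle : u * z.re + v * a ≤ a := by rw [hv']; nlinarith
      have hge : z.re ≤ u * z.re + v * a := by rw [hv']; nlinarith
      rw [hfr _ (by rw [hre, abs_le]; constructor <;> linarith) (by rw [him]; exact hz2), hre,
        him] at hcon
      have := Real.exp_le_exp.2 (neg_le_neg hge)
      linarith
    · rintro _ ⟨u, v, hu, hv, huv, rfl⟩ hcon
      have hre : (u • (⟨a, z.im⟩ : ℂ) + v • (a : ℂ)).re = a := by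
        simp; rw [← add_mul, huv, one_mul]
      have him : (u • (⟨a, z.im⟩ : ℂ) + v • (a : ℂ)).im = u * z.im := by simp
      have h1 : |u * z.im| ≤ b := by
        rw [abs_mul, abs_of_nonneg hu]
        have hu1 : u ≤ 1 := by linarith
        nlinarith [abs_nonneg z.im]
      rw [hfr _ (by rw [hre, abs_of_pos ha0]) (by rw [him]; exact h1), hre, him] at hcon
      have := (hγb _ h1).2
      linarith
  have hone : (1 : ℂ) ∈ frontier Ω := by
    have : (1 : ℂ) ∈ frontier Ω ∩ frontier (ball (0 : ℂ) 1) := by rw [hΩ_bd]; rfl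
    exact this.1
  have hnot : ∀ w ∈ Ω, w ∉ frontier Ω := fun w hw h => h.2 (by rwa [hΩ_open.interior_eq])
  have habs : ∀ z : ℂ, ‖z‖ < b → |z.re| ≤ a ∧ |z.im| ≤ b := fun z hz =>
    ⟨by linarith [Complex.abs_re_le_norm z], by linarith [Complex.abs_im_le_norm z]⟩
  have hlt : ∀ z : ℂ, ‖z‖ < b → Complex.exp (-z) ∈ Ω → γf |z.im| < 1 - Real.exp (-z.re) := by
    intro z hz hmem
    obtain ⟨h1, h2⟩ := habs z hz
    rcases lt_trichotomy (γf |z.im|) (1 - Real.exp (-z.re)) with h3 | h3 | h3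
    · exact h3
    · exact absurd ((hfr z h1 h2).2 h3.symm) (hnot _ hmem)
    · exact absurd hmem (hbelow z h1 h2 h3)
  have hamem : Complex.exp (-(a : ℂ)) ∈ Ω := by
    have h1 : ContinuousAt Complex.log 1 := continuousAt_clog (by simp)
    have h2 : ∀ᶠ w in 𝓝 (1 : ℂ), Complex.log w ∈ ball (0 : ℂ) b := by
      refine h1.eventually ?_
      rw [Complex.log_one]; exact ball_mem_nhds _ hb3
    have h3 : ∀ᶠ w in 𝓝 (1 : ℂ), w ≠ 0 := isOpen_ne.mem_nhds one_ne_zero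
    obtain ⟨w, ⟨hw1, hw2⟩, hw3⟩ := mem_closure_iff_nhds.1 hone.1 _ (h2.and h3)
    rw [mem_ball_zero_iff] at hw1
    have h4 : Complex.exp (- -Complex.log w) ∈ Ω := by rwa [neg_neg, Complex.exp_log hw2]
    have h5 : ‖-Complex.log w‖ < b := by rwa [norm_neg]
    obtain ⟨h6, h7⟩ := habs _ h5
    obtain ⟨h8, h9⟩ := hup _ h6 h7 (hlt _ h5 h4)
    exact mem_of_segment hΩ_open h9 (mem_of_segment hΩ_open h8 h4)
  have hmem : ∀ z : ℂ, ‖z‖ < b → γf |z.im| < 1 - Real.exp (-z.re) → Complex.exp (-z) ∈ Ω := by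
    intro z hz hγz
    obtain ⟨h6, h7⟩ := habs _ hz
    obtain ⟨h8, h9⟩ := hup _ h6 h7 hγz
    refine mem_of_segment hΩ_open (p := ⟨a, z.im⟩) (by rwa [segment_symm])
      (mem_of_segment hΩ_open (p := a) (by rwa [segment_symm]) hamem)
  have hle_re : ∀ s : ℝ, 1 - Real.exp (-s) ≤ s := fun s => by
    linarith [Real.add_one_le_exp (-s)]
  refine ⟨b, hb3, by linarith, hΩ_open, hΩ_sub, fun z hz h => (hlt z hz h).trans_le (hle_re _),
    fun z hz h0 h => ?_, fun z hz h1 h2 => ?_, fun ρ hρ => ?_⟩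
  · have h1 := hγb _ (habs z hz).2
    exact hmem z hz (lt_one_sub_exp_neg h1.1 (by linarith) h0 h)
  · have h3 : Complex.exp (-z) ∈ frontier Ω := ⟨h1, by rwa [hΩ_open.interior_eq]⟩
    rw [hfr z (habs z hz).1 (habs z hz).2] at h3
    have h4 := hγb _ (habs z hz).2
    refine ⟨h3 ▸ hle_re _, ?_⟩
    by_contra! h5
    have := lt_one_sub_exp_neg h4.1 (by linarith) (by nlinarith [h4.1, sq_nonneg (γf |z.im|)]) h5.le
    linarith
  · set K := closure Ω ∩ ((fun z : ℂ => Complex.exp (-z)) '' ball 0 ρ)ᶜ with hK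
    have hopen : IsOpen ((fun z : ℂ => Complex.exp (-z)) '' ball 0 ρ) := by
      have h1 : (fun z : ℂ => Complex.exp (-z)) '' ball 0 ρ =
          Complex.exp '' ((fun z => -z) '' ball 0 ρ) := by rw [image_image]
      rw [h1]
      exact Complex.isOpenMap_exp _ ((Homeomorph.neg ℂ).isOpenMap _ isOpen_ball)
    have hcl : closure Ω ⊆ closedBall 0 1 :=
      closure_minimal (hΩ_sub.trans ball_subset_closedBall) isClosed_closedBall
    have hKc : IsCompact K := ((isCompact_closedBall (0 : ℂ) 1).of_isClosed_subset
      isClosed_closure hcl).inter_right hopen.isClosed_compl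
    have hKΩ : ∀ w ∈ Ω, (∀ z : ℂ, ‖z‖ < ρ → Complex.exp (-z) ≠ w) → w ∈ K := by
      rintro w hw h1
      refine ⟨subset_closure hw, ?_⟩
      rintro ⟨z, hz, rfl⟩
      exact h1 z (by simpa using hz) rfl
    rcases K.eq_empty_or_nonempty with hemp | hne
    · exact ⟨0, one_pos, fun w hw h1 => absurd (hKΩ w hw h1) (by rw [hemp]; simp)⟩
    · obtain ⟨w0, hw0, hmax⟩ := hKc.exists_isMaxOn hne continuous_norm.continuousOn
      refine ⟨‖w0‖, ?_, fun w hw h1 => hmax (hKΩ w hw h1)⟩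
      have h2 : ‖w0‖ ≤ 1 := by simpa using hcl hw0.1
      refine lt_of_le_of_ne h2 fun h3 => hw0.2 ?_
      have h4 : w0 ∉ Ω := fun h => by
        have := hΩ_sub h; rw [mem_ball_zero_iff] at this; linarith
      have h5 : w0 ∈ frontier Ω ∩ frontier (ball (0 : ℂ) 1) :=
        ⟨⟨hw0.1, by rwa [hΩ_open.interior_eq]⟩, by
          rw [frontier_ball _ one_ne_zero]; simpa using h3⟩
      rw [hΩ_bd] at h5
      exact ⟨0, by simpa using hρ, by simpa using h5.symm⟩

end CuspGeometry

section Comparison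

/-- The properties of an inverse Riemann map `ψ : Ω → 𝔻` with `ψ 0 = 0`. -/
structure IsInverseMap (Ω : Set ℂ) (ψ : ℂ → ℂ) (δ : ℝ) : Prop where
  isOpen : IsOpen Ω
  diff : DifferentiableOn ℂ ψ Ω
  lt_one : ∀ w ∈ Ω, ‖ψ w‖ < 1
  ne_zero : ∀ w ∈ Ω, w ≠ 0 → ψ w ≠ 0
  tendsto : ∀ w ∉ Ω, ∀ r < 1, ∀ᶠ v in 𝓝[Ω] w, r < ‖ψ v‖
  pos : 0 < δ
  le_norm : ∀ w ∈ Ω, 1 / 2 ≤ ‖w‖ → δ ≤ ‖ψ w‖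

variable {Ω : Set ℂ} {ψ : ℂ → ℂ} {δ : ℝ}

lemma IsInverseMap.differentiableAt_comp (h : IsInverseMap Ω ψ δ) {z : ℂ}
    (hz : Complex.exp (-z) ∈ Ω) : DifferentiableAt ℂ (fun z => ψ (Complex.exp (-z))) z := by
  have h1 : DifferentiableAt ℂ ψ (Complex.exp (-z)) :=
    (h.diff _ hz).differentiableAt (h.isOpen.mem_nhds hz)
  exact h1.comp z (by fun_prop)

lemma IsInverseMap.ne_zero_comp (h : IsInverseMap Ω ψ δ) {z : ℂ}
    (hz : Complex.exp (-z) ∈ Ω) : ψ (Complex.exp (-z)) ≠ 0 :=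
  h.ne_zero _ hz (Complex.exp_ne_zero _)

lemma IsInverseMap.norm_mul_exp_le (h : IsInverseMap Ω ψ δ) {D : Set ℂ} (hD : IsOpen D)
    (hb : Bornology.IsBounded D) (hDΩ : ∀ z ∈ D, Complex.exp (-z) ∈ Ω) {F : ℂ → ℂ}
    (hF : DifferentiableOn ℂ F D)
    (h1 : ∀ z ∈ frontier D, Complex.exp (-z) ∉ Ω → ∀ ε > 0, ∀ᶠ v in 𝓝[D] z, (F v).re ≤ ε)
    (h2 : ∀ z ∈ frontier D, Complex.exp (-z) ∈ Ω → ContinuousWithinAt F D z ∧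
      ‖ψ (Complex.exp (-z))‖ * Real.exp (F z).re ≤ 1) :
    ∀ z ∈ D, ‖ψ (Complex.exp (-z))‖ * Real.exp (F z).re ≤ 1 := by
  have hG : DifferentiableOn ℂ (fun z => ψ (Complex.exp (-z)) * Complex.exp (F z)) D :=
    fun z hz => (h.differentiableAt_comp (hDΩ z hz)).differentiableWithinAt.mul (hF z hz).cexp
  have hn : ∀ z, ‖ψ (Complex.exp (-z)) * Complex.exp (F z)‖ =
      ‖ψ (Complex.exp (-z))‖ * Real.exp (F z).re := fun z => by
    rw [norm_mul, Complex.norm_exp]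
  intro z hz
  rw [← hn]
  refine norm_le_one_of_frontier hD hb hG (fun z hz ε hε => ?_) z hz
  by_cases hzΩ : Complex.exp (-z) ∈ Ω
  · obtain ⟨h3, h4⟩ := h2 z hz hzΩ
    have h5 : ContinuousWithinAt (fun z => ‖ψ (Complex.exp (-z)) * Complex.exp (F z)‖) D z :=
      ((h.differentiableAt_comp hzΩ).continuousAt.continuousWithinAt.mul
        h3.cexp).norm
    have h6 := Tendsto.eventually_lt_const (u := 1 + ε) (by beta_reduce; rw [hn]; linarith) h5
    filter_upwards [h6] with v hv using le_of_lt hv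
  · have h3 := h1 z hz hzΩ (Real.log (1 + ε)) (Real.log_pos (by linarith))
    filter_upwards [h3, self_mem_nhdsWithin] with v hv hvD
    rw [hn]
    calc ‖ψ (Complex.exp (-v))‖ * Real.exp (F v).re ≤ 1 * Real.exp (Real.log (1 + ε)) := by
          gcongr; exact (h.lt_one _ (hDΩ v hvD)).le
      _ = 1 + ε := by rw [one_mul, Real.exp_log (by linarith)]

lemma IsInverseMap.exp_le_norm (h : IsInverseMap Ω ψ δ) {D : Set ℂ} (hD : IsOpen D)
    (hb : Bornology.IsBounded D) (hDΩ : ∀ z ∈ D, Complex.exp (-z) ∈ Ω) {F : ℂ → ℂ}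
    (hF : DifferentiableOn ℂ F D)
    (h1 : ∀ z ∈ frontier D, Complex.exp (-z) ∉ Ω → ∀ ε > 0, ∀ᶠ v in 𝓝[D] z, (F v).re ≤ ε)
    (h2 : ∀ z ∈ frontier D, Complex.exp (-z) ∈ Ω → ContinuousWithinAt F D z ∧
      Real.exp (F z).re ≤ ‖ψ (Complex.exp (-z))‖) :
    ∀ z ∈ D, Real.exp (F z).re ≤ ‖ψ (Complex.exp (-z))‖ := by
  have hG : DifferentiableOn ℂ (fun z => (ψ (Complex.exp (-z)))⁻¹ * Complex.exp (F z)) D :=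
    fun z hz => ((h.differentiableAt_comp (hDΩ z hz)).inv
      (h.ne_zero_comp (hDΩ z hz))).differentiableWithinAt.mul (hF z hz).cexp
  have hn : ∀ z, ‖(ψ (Complex.exp (-z)))⁻¹ * Complex.exp (F z)‖ =
      Real.exp (F z).re / ‖ψ (Complex.exp (-z))‖ := fun z => by
    rw [norm_mul, Complex.norm_exp, norm_inv, div_eq_inv_mul]
  have hle : ∀ z, Complex.exp (-z) ∈ Ω → (Real.exp (F z).re ≤ ‖ψ (Complex.exp (-z))‖ ↔
      ‖(ψ (Complex.exp (-z)))⁻¹ * Complex.exp (F z)‖ ≤ 1) := fun z hz => by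
    rw [hn, div_le_one (norm_pos_iff.2 (h.ne_zero_comp hz))]
  intro z hz
  rw [hle z (hDΩ z hz)]
  refine norm_le_one_of_frontier hD hb hG (fun z hz ε hε => ?_) z hz
  by_cases hzΩ : Complex.exp (-z) ∈ Ω
  · obtain ⟨h3, h4⟩ := h2 z hz hzΩ
    rw [hle z hzΩ] at h4
    have h5 : ContinuousWithinAt (fun z => ‖(ψ (Complex.exp (-z)))⁻¹ * Complex.exp (F z)‖) D z :=
      (((h.differentiableAt_comp hzΩ).inv
        (h.ne_zero_comp hzΩ)).continuousAt.continuousWithinAt.mul h3.cexp).norm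
    have h6 := Tendsto.eventually_lt_const (u := 1 + ε) (by linarith) h5
    filter_upwards [h6] with v hv using le_of_lt hv
  · set q := √(1 + ε) with hq
    have hq1 : 1 < q := by rw [hq, Real.lt_sqrt] <;> linarith
    have hqq : q * q = 1 + ε := Real.mul_self_sqrt (by linarith)
    have h3 := h1 z hz hzΩ (Real.log q) (Real.log_pos hq1)
    have h4 := h.tendsto _ hzΩ q⁻¹ (inv_lt_one_of_one_lt₀ hq1)
    have h5 : Tendsto (fun v : ℂ => Complex.exp (-v)) (𝓝[D] z) (𝓝[Ω] (Complex.exp (-z))) := by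
      refine tendsto_nhdsWithin_iff.2 ⟨?_, ?_⟩
      · have : Continuous fun v : ℂ => Complex.exp (-v) := by fun_prop
        exact (this.tendsto z).mono_left nhdsWithin_le_nhds
      · filter_upwards [self_mem_nhdsWithin] with v hv using hDΩ v hv
    filter_upwards [h3, h5.eventually h4] with v hv hv2
    rw [hn]
    calc Real.exp (F v).re / ‖ψ (Complex.exp (-v))‖ ≤ Real.exp (Real.log q) / q⁻¹ := by
          gcongr
      _ = 1 + ε := by rw [Real.exp_log (by linarith), div_inv_eq_mul, hqq]

end Comparison

section CuspEstimates

variable {γf : ℝ → ℝ}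

lemma IsGauge.Gam_le_add_log (h : IsGauge γf) {x y : ℝ} (hx : 0 < x) (hxy : x ≤ y)
    (hy : y ≤ Real.pi) : Gam γf x ≤ Gam γf y + Real.log (y / x) := by
  have h1 := h.Gam_sub_le hx hxy hy
  have h3 : 0 ≤ Real.log (y / x) := Real.log_nonneg (by rwa [le_div_iff₀ hx, one_mul])
  have hpi := Real.pi_gt_three
  have h2 : γf y / y ≤ 1 := by
    refine (h.mono_quot ⟨(hx.trans_le hxy).le, hy⟩ ⟨by linarith, le_rfl⟩ hy).trans ?_
    beta_reduce
    rw [div_le_one (by linarith)]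
    linarith [h.le_one Real.pi ⟨by linarith, le_rfl⟩]
  have h4 : 2 / Real.pi ≤ 1 := by rw [div_le_one] <;> linarith
  have h5 : 2 / Real.pi * (γf y / y * Real.log (y / x)) ≤ 1 * (1 * Real.log (y / x)) := by
    have := h.quot_nonneg (t := y) ⟨(hx.trans_le hxy).le, hy⟩
    gcongr
  linarith

lemma IsGauge.exp_neg_Gam_le (h : IsGauge γf) {x y : ℝ} (hx : 0 < x) (hxy : x ≤ y)
    (hy : y ≤ Real.pi) : Real.exp (-Gam γf y) ≤ y / x * Real.exp (-Gam γf x) := by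
  have h1 := h.Gam_le_add_log hx hxy hy
  rw [← Real.exp_log (div_pos (hx.trans_le hxy) hx), ← Real.exp_add]
  exact Real.exp_le_exp.2 (by linarith)

lemma IsGauge.exp_neg_Gam_mono (h : IsGauge γf) {x y : ℝ} (hx : 0 < x) (hxy : x ≤ y)
    (hy : y ≤ Real.pi) : Real.exp (-Gam γf x) ≤ Real.exp (-Gam γf y) :=
  Real.exp_le_exp.2 (neg_le_neg (h.Gam_anti hx hxy hy))

lemma IsGauge.continuous_comp_abs_im (h : IsGauge γf) :
    ContinuousOn (fun z : ℂ => γf |z.im|) (closedBall 0 Real.pi) := by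
  refine h.cont.comp (by fun_prop) fun z hz => ⟨abs_nonneg _, ?_⟩
  exact (Complex.abs_im_le_norm z).trans (by simpa using hz)

lemma IsGauge.comp_abs_nonneg (h : IsGauge γf) {z : ℂ} (hz : ‖z‖ ≤ 1) : 0 ≤ γf |z.im| :=
  h.nonneg ⟨abs_nonneg _, by linarith [Complex.abs_im_le_norm z, Real.pi_gt_three]⟩

lemma IsGauge.re_pos (h : IsGauge γf) {z : ℂ} (hz : ‖z‖ ≤ 1) (hz0 : z ≠ 0)
    (hle : γf |z.im| ≤ z.re) : 0 < z.re := by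
  rcases eq_or_ne z.im 0 with h0 | h0
  · rw [h0, abs_zero, h.zero] at hle
    refine lt_of_le_of_ne hle fun h1 => hz0 (Complex.ext h1.symm h0)
  · exact (h.pos _ ⟨abs_pos.2 h0,
      by linarith [Complex.abs_im_le_norm z, Real.pi_gt_three]⟩).trans_le hle

lemma isOpen_preimage_exp_neg {Ω : Set ℂ} (hΩ : IsOpen Ω) :
    IsOpen {z : ℂ | Complex.exp (-z) ∈ Ω} :=
  hΩ.preimage (f := fun z : ℂ => Complex.exp (-z)) (by fun_prop)

lemma mem_frontier_inter_ball {Ω : Set ℂ} (hΩ : IsOpen Ω) {ρ : ℝ} {z : ℂ}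
    (hz : z ∈ frontier ({z : ℂ | Complex.exp (-z) ∈ Ω} ∩ ball 0 ρ)) :
    Complex.exp (-z) ∈ closure Ω ∧ ‖z‖ ≤ ρ ∧ (Complex.exp (-z) ∈ Ω → ‖z‖ = ρ) := by
  have ho : IsOpen ({z : ℂ | Complex.exp (-z) ∈ Ω} ∩ ball 0 ρ) :=
    (isOpen_preimage_exp_neg hΩ).inter isOpen_ball
  have hc : Continuous fun z : ℂ => Complex.exp (-z) := by fun_prop
  obtain ⟨h1, h2⟩ := hz
  rw [ho.interior_eq] at h2
  have h3 : ‖z‖ ≤ ρ := by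
    have := closure_mono inter_subset_right h1
    simpa using closure_ball_subset_closedBall this
  refine ⟨?_, h3, fun h4 => ?_⟩
  · have := closure_mono inter_subset_left h1
    exact (hc.closure_preimage_subset Ω) this
  · by_contra h5
    exact h2 ⟨h4, by simpa using lt_of_le_of_ne h3 h5⟩

lemma half_le_norm_exp_neg {z : ℂ} (hz : ‖z‖ ≤ 1 / 2) : 1 / 2 ≤ ‖Complex.exp (-z)‖ := by
  rw [Complex.norm_exp]
  have h1 := Real.add_one_le_exp (-z).re
  have h2 := Complex.re_le_norm z
  simp only [Complex.neg_re] at h1 ⊢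
  linarith

lemma one_sub_exp_neg_ge {u b : ℝ} (hu : 0 ≤ u) (hub : u ≤ b) :
    u / (1 + b) ≤ 1 - Real.exp (-u) := by
  have h1 : Real.exp (-u) ≤ (1 + u)⁻¹ := by
    rw [Real.exp_neg]; gcongr; linarith [Real.add_one_le_exp u]
  have h2 : u / (1 + b) ≤ u / (1 + u) := by gcongr
  have h3 : u / (1 + u) = 1 - (1 + u)⁻¹ := by field_simp; ring
  linarith

variable {Ω : Set ℂ} {ψ : ℂ → ℂ} {δ ρ₁ : ℝ}

lemma exists_one_sub_sq_le_norm_mul (hγ : IsGauge γf) (hc : IsCuspDomain γf Ω ρ₁)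
    (hψ : IsInverseMap Ω ψ δ) : ∃ C > 0, ∃ ρ ∈ Ioc (0 : ℝ) (1 / 2), ρ < ρ₁ ∧
      ∀ z : ℂ, Complex.exp (-z) ∈ Ω → ‖z‖ < ρ →
        1 - ‖ψ (Complex.exp (-z))‖ ^ 2 ≤ C * (‖z‖ * Real.exp (-Gam γf ‖z‖)) := by
  obtain ⟨ρ0, hρ0, F₁, F₂, C, hC, hdiff, hnorm, hpos, -, -⟩ := hγ.exists_barriers
  have hρ₁ := hc.pos
  set ρ := min ρ0 (ρ₁ / 2) with hρdef
  have hρ : 0 < ρ := lt_min hρ0.1 (by linarith)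
  have hρ_le : ρ ≤ ρ0 := min_le_left _ _
  have hρlt : ρ < ρ₁ := (min_le_right _ _).trans_lt (by linarith)
  have hρh : ρ ≤ 1 / 2 := hρ_le.trans hρ0.2
  have hpi := Real.pi_gt_three
  set K := sphere (0 : ℂ) ρ ∩ {z | γf |z.im| - z.re ≤ 0} with hK
  have hKc : IsCompact K := by
    refine (isCompact_sphere _ _).of_isClosed_subset ?_ inter_subset_left
    refine ContinuousOn.preimage_isClosed_of_isClosed (t := Iic 0)
      (f := fun z : ℂ => γf |z.im| - z.re) ?_ isClosed_sphere isClosed_Iic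
    refine (hγ.continuous_comp_abs_im.mono fun z hz => ?_).sub (by fun_prop)
    simp at hz ⊢; linarith
  have hKmem : ∀ z ∈ K, ‖z‖ = ρ ∧ γf |z.im| ≤ z.re ∧ 0 < z.re := by
    rintro z ⟨hz1, hz2⟩
    simp only [mem_sphere_iff_norm, sub_zero, mem_setOf_eq] at hz1 hz2
    have h0 : z ≠ 0 := by rintro rfl; simp at hz1; linarith
    exact ⟨hz1, by linarith, hγ.re_pos (by linarith) h0 (by linarith)⟩
  obtain ⟨m, hm, hmK⟩ : ∃ m > 0, ∀ z ∈ K, m ≤ (F₁ z).re := by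
    rcases K.eq_empty_or_nonempty with h0 | h0
    · exact ⟨1, one_pos, by simp [h0]⟩
    · have hcont : ContinuousOn (fun z => (F₁ z).re) K := fun z hz =>
        (Complex.continuous_re.continuousAt.comp
          (hdiff z (hKmem z hz).2.2).1.continuousAt).continuousWithinAt
      obtain ⟨z0, hz0, hmin⟩ := hKc.exists_isMinOn h0 hcont
      obtain ⟨h1, h2, h3⟩ := hKmem z0 hz0
      exact ⟨_, hpos z0 h3 (by linarith) h2, fun z hz => hmin hz⟩
  set M := (|Real.log δ| + 1) / m with hM
  have hM0 : 0 < M := by positivity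
  have hmain := hψ.exp_le_norm (D := {z : ℂ | Complex.exp (-z) ∈ Ω} ∩ ball 0 ρ)
    (F := fun z => -(M : ℂ) * F₁ z)
    ((isOpen_preimage_exp_neg hc.isOpen).inter isOpen_ball)
    (isBounded_ball.subset inter_subset_right) (fun z hz => hz.1) ?_ ?_ ?_
  · refine ⟨2 * M * C, by positivity, ρ, ⟨hρ, hρh⟩, hρlt, fun z hz hzρ => ?_⟩
    have h1 := hmain z ⟨hz, by simpa using hzρ⟩
    have h2 := hc.lt_re z (by linarith) hz
    have h3 : 0 < z.re := (hγ.comp_abs_nonneg (by linarith)).trans_lt h2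
    have h4 := (hnorm z h3 (by linarith)).1
    have h5 := (Complex.re_le_norm (F₁ z)).trans h4
    simp only [← Complex.ofReal_neg, Complex.re_ofReal_mul] at h1
    have h6 : Real.exp (-M * (F₁ z).re) ^ 2 ≤ ‖ψ (Complex.exp (-z))‖ ^ 2 := by gcongr
    rw [← Real.exp_nat_mul] at h6
    have h7 := Real.add_one_le_exp ((2 : ℕ) * (-M * (F₁ z).re))
    push_cast at h6 h7
    nlinarith [mul_le_mul_of_nonneg_left h5 hM0.le]
  · intro z hz
    have h2 := hc.lt_re z (lt_trans (by simpa using hz.2) hρlt) hz.1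
    have h3 : ‖z‖ < ρ := by simpa using hz.2
    have h4 : 0 < z.re := (hγ.comp_abs_nonneg (by linarith)).trans_lt h2
    exact ((hdiff z h4).1.const_mul _).differentiableWithinAt
  · intro z hz hzΩ ε hε
    filter_upwards [self_mem_nhdsWithin] with v hv
    have h3 : ‖v‖ < ρ := by simpa using hv.2
    have h2 := hc.lt_re v (by linarith) hv.1
    have h4 : 0 < v.re := (hγ.comp_abs_nonneg (by linarith)).trans_lt h2
    have h5 := hpos v h4 (by linarith) h2.le
    simp only [← Complex.ofReal_neg, Complex.re_ofReal_mul]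
    nlinarith
  · intro z hz hzΩ
    obtain ⟨-, h1, h2⟩ := mem_frontier_inter_ball hc.isOpen hz
    have h3 := h2 hzΩ
    have h4 := hc.lt_re z (by linarith) hzΩ
    have h5 : 0 < z.re := (hγ.comp_abs_nonneg (by linarith)).trans_lt h4
    refine ⟨((hdiff z h5).1.const_mul _).continuousAt.continuousWithinAt, ?_⟩
    simp only [← Complex.ofReal_neg, Complex.re_ofReal_mul]
    refine le_trans ?_ (hψ.le_norm _ hzΩ (half_le_norm_exp_neg (by linarith)))
    have h6 := hmK z ⟨by simpa using h3, by simp only [mem_setOf_eq]; linarith⟩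
    rw [← Real.exp_log hψ.pos]
    refine Real.exp_le_exp.2 ?_
    have h7 : M * m = |Real.log δ| + 1 := by rw [hM]; field_simp
    nlinarith [neg_abs_le (Real.log δ), mul_le_mul_of_nonneg_left h6 hM0.le]

lemma exists_norm_mul_le_one_sub (hγ : IsGauge γf) (hc : IsCuspDomain γf Ω ρ₁)
    (hψ : IsInverseMap Ω ψ δ) : ∃ c > 0, ∃ ρ ∈ Ioc (0 : ℝ) (1 / 2), ρ < ρ₁ ∧
      ∀ z : ℂ, Complex.exp (-z) ∈ Ω → ‖z‖ < ρ → ‖z‖ / 8 ≤ z.re →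
        c * (‖z‖ * Real.exp (-Gam γf ‖z‖)) ≤ 1 - ‖ψ (Complex.exp (-z))‖ := by
  obtain ⟨ρ0, hρ0, F₁, F₂, C, hC, hdiff, hnorm, -, hneg, hge⟩ := hγ.exists_barriers
  have hρ₁ := hc.pos
  set ρ := min ρ0 (ρ₁ / 2) with hρdef
  have hρ : 0 < ρ := lt_min hρ0.1 (by linarith)
  have hρ_le : ρ ≤ ρ0 := min_le_left _ _
  have hρlt : ρ < ρ₁ := (min_le_right _ _).trans_lt (by linarith)
  have hρh : ρ ≤ 1 / 2 := hρ_le.trans hρ0.2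
  have hpi := Real.pi_gt_three
  have hF2 : ∀ z : ℂ, 0 < z.re → ‖z‖ ≤ ρ → ‖F₂ z‖ ≤ C * ‖z‖ := fun z h1 h2 => by
    refine (hnorm z h1 (by linarith)).2.1.trans ?_
    have h3 : 0 < ‖z‖ := by linarith [Complex.re_le_norm z]
    have h4 : Real.exp (-Gam γf ‖z‖) ≤ 1 :=
      Real.exp_le_one_iff.2 (neg_nonpos.2 (hγ.Gam_nonneg h3 (by linarith)))
    calc C * (‖z‖ * Real.exp (-Gam γf ‖z‖)) ≤ C * (‖z‖ * 1) := by gcongr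
      _ = _ := by ring
  set K := sphere (0 : ℂ) ρ ∩ {z | γf |z.im| + γf |z.im| ^ 2 - z.re ≤ 0} with hK
  have hKc : IsCompact K := by
    refine (isCompact_sphere _ _).of_isClosed_subset ?_ inter_subset_left
    refine ContinuousOn.preimage_isClosed_of_isClosed (t := Iic 0)
      (f := fun z : ℂ => γf |z.im| + γf |z.im| ^ 2 - z.re) ?_ isClosed_sphere isClosed_Iic
    have : ContinuousOn (fun z : ℂ => γf |z.im|) (sphere 0 ρ) :=
      hγ.continuous_comp_abs_im.mono fun z hz => by simp at hz ⊢; linarith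
    exact (this.add (this.pow 2)).sub (by fun_prop)
  have hKmem : ∀ z ∈ K, ‖z‖ = ρ ∧ Complex.exp (-z) ∈ Ω := by
    rintro z ⟨hz1, hz2⟩
    simp only [mem_sphere_iff_norm, sub_zero, mem_setOf_eq] at hz1 hz2
    have h0 : z ≠ 0 := by rintro rfl; simp at hz1; linarith
    have h1 := hγ.re_pos (by linarith) h0 (by nlinarith)
    exact ⟨hz1, hc.mem_of_le z (by linarith) h1 (by linarith)⟩
  obtain ⟨b, hb0, hb1, hbK⟩ : ∃ b : ℝ, 0 < b ∧ b < 1 ∧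
      ∀ z ∈ K, ‖ψ (Complex.exp (-z))‖ ≤ b := by
    rcases K.eq_empty_or_nonempty with h0 | h0
    · exact ⟨1 / 2, by norm_num, by norm_num, by simp [h0]⟩
    · have hcont : ContinuousOn (fun z => ‖ψ (Complex.exp (-z))‖) K := fun z hz =>
        (hψ.differentiableAt_comp (hKmem z hz).2).continuousAt.norm.continuousWithinAt
      obtain ⟨z0, hz0, hmax⟩ := hKc.exists_isMaxOn h0 hcont
      exact ⟨_, norm_pos_iff.2 (hψ.ne_zero_comp (hKmem z0 hz0).2),
        hψ.lt_one _ (hKmem z0 hz0).2, fun z hz => hmax hz⟩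
  set c := -Real.log b / C with hcdef
  have hlog : Real.log b < 0 := Real.log_neg hb0 hb1
  have hc0 : 0 < c := div_pos (by linarith) hC
  have hmain := hψ.norm_mul_exp_le (D := {z : ℂ | Complex.exp (-z) ∈ Ω} ∩ ball 0 ρ)
    (F := fun z => (c : ℂ) * F₂ z)
    ((isOpen_preimage_exp_neg hc.isOpen).inter isOpen_ball)
    (isBounded_ball.subset inter_subset_right) (fun z hz => hz.1) ?_ ?_ ?_
  · refine ⟨c / C ^ 2 / (1 + c / C ^ 2), by positivity, ρ, ⟨hρ, hρh⟩, hρlt,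
      fun z hz hzρ hz8 => ?_⟩
    have h1 := hmain z ⟨hz, by simpa using hzρ⟩
    have h2 := hc.lt_re z (by linarith) hz
    have h3 : 0 < z.re := (hγ.comp_abs_nonneg (by linarith)).trans_lt h2
    have hz0 : 0 < ‖z‖ := by linarith [Complex.re_le_norm z]
    have h4 := (hnorm z h3 (by linarith)).2.2
    have h5 := hge z h3 (by linarith) hz8
    simp only [Complex.re_ofReal_mul] at h1
    set X := ‖z‖ * Real.exp (-Gam γf ‖z‖) with hX
    have hX0 : 0 ≤ X := by positivity
    have hX1 : X ≤ 1 := by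
      have : Real.exp (-Gam γf ‖z‖) ≤ 1 :=
        Real.exp_le_one_iff.2 (neg_nonpos.2 (hγ.Gam_nonneg hz0 (by linarith)))
      calc X ≤ 1 * 1 := by rw [hX]; gcongr; linarith
        _ = 1 := one_mul 1
    have h6 : c / C ^ 2 * X ≤ c * (F₂ z).re := by
      have : X ≤ C ^ 2 * (F₂ z).re := by
        calc X ≤ C * ‖F₂ z‖ := h4
          _ ≤ C * (C * (F₂ z).re) := by gcongr
          _ = _ := by ring
      calc c / C ^ 2 * X ≤ c / C ^ 2 * (C ^ 2 * (F₂ z).re) := by gcongr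
        _ = _ := by field_simp
    have h7 : ‖ψ (Complex.exp (-z))‖ ≤ Real.exp (-(c / C ^ 2 * X)) := by
      rw [← le_div_iff₀ (Real.exp_pos _), one_div, ← Real.exp_neg] at h1
      exact h1.trans (Real.exp_le_exp.2 (by linarith))
    have h8 := one_sub_exp_neg_ge (u := c / C ^ 2 * X) (b := c / C ^ 2) (by positivity)
      (mul_le_of_le_one_right (by positivity) hX1)
    calc c / C ^ 2 / (1 + c / C ^ 2) * X = c / C ^ 2 * X / (1 + c / C ^ 2) := by ring
      _ ≤ _ := by linarith
  · intro z hz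
    have h2 := hc.lt_re z (lt_trans (by simpa using hz.2) hρlt) hz.1
    have h3 : ‖z‖ < ρ := by simpa using hz.2
    have h4 : 0 < z.re := (hγ.comp_abs_nonneg (by linarith)).trans_lt h2
    exact ((hdiff z h4).2.const_mul _).differentiableWithinAt
  · intro z hz hzΩ ε hε
    obtain ⟨h0, h1, -⟩ := mem_frontier_inter_ball hc.isOpen hz
    obtain ⟨h2, h3⟩ := hc.frontier_mem z (by linarith) h0 hzΩ
    rcases eq_or_ne z 0 with rfl | hz0
    · have h4 : ∀ᶠ v : ℂ in 𝓝[{z : ℂ | Complex.exp (-z) ∈ Ω} ∩ ball 0 ρ] 0,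
          c * (C * ‖v‖) < ε := by
        refine Tendsto.eventually_lt_const (v := c * (C * ‖(0 : ℂ)‖)) (by simpa using hε) ?_
        have : Continuous fun v : ℂ => c * (C * ‖v‖) := by fun_prop
        exact (this.tendsto 0).mono_left nhdsWithin_le_nhds
      filter_upwards [self_mem_nhdsWithin, h4] with v hv hv2
      have h3 : ‖v‖ < ρ := by simpa using hv.2
      have h2 := hc.lt_re v (by linarith) hv.1
      have h4 : 0 < v.re := (hγ.comp_abs_nonneg (by linarith)).trans_lt h2
      have h5 := (Complex.re_le_norm _).trans (hF2 v h4 h3.le)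
      simp only [Complex.re_ofReal_mul]
      nlinarith [mul_le_mul_of_nonneg_left h5 hc0.le]
    · have h4 := hγ.re_pos (by linarith) hz0 h2
      have h5 := hneg z h4 (by linarith) h3
      have h6 : ContinuousAt (fun v => ((c : ℂ) * F₂ v).re) z :=
        Complex.continuous_re.continuousAt.comp ((hdiff z h4).2.const_mul _).continuousAt
      have h7 := Tendsto.eventually_lt_const (u := ε)
        (by beta_reduce; rw [Complex.re_ofReal_mul]; nlinarith) h6.tendsto
      filter_upwards [nhdsWithin_le_nhds h7] with v hv using le_of_lt hv
  · intro z hz hzΩ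
    obtain ⟨-, h1, h2⟩ := mem_frontier_inter_ball hc.isOpen hz
    have h3 := h2 hzΩ
    have h4 := hc.lt_re z (by linarith) hzΩ
    have h5 : 0 < z.re := (hγ.comp_abs_nonneg (by linarith)).trans_lt h4
    refine ⟨((hdiff z h5).2.const_mul _).continuousAt.continuousWithinAt, ?_⟩
    simp only [Complex.re_ofReal_mul]
    rcases le_total z.re (γf |z.im| + γf |z.im| ^ 2) with h6 | h6
    · have h7 := hneg z h5 (by linarith) h6
      have h8 : Real.exp (c * (F₂ z).re) ≤ 1 :=
        Real.exp_le_one_iff.2 (mul_nonpos_of_nonneg_of_nonpos hc0.le h7)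
      exact mul_le_one₀ (hψ.lt_one _ hzΩ).le (Real.exp_pos _).le h8
    · have h7 := hbK z ⟨by simpa using h3, by simp only [mem_setOf_eq]; linarith⟩
      have h8 : (F₂ z).re ≤ C := (Complex.re_le_norm _).trans ((hF2 z h5 h3.le).trans
        (by nlinarith))
      calc ‖ψ (Complex.exp (-z))‖ * Real.exp (c * (F₂ z).re) ≤ b * Real.exp (c * C) := by
            gcongr
        _ = b * Real.exp (-Real.log b) := by rw [hcdef]; congr 2; field_simp
        _ = 1 := by rw [Real.exp_neg, Real.exp_log hb0]; field_simp

end CuspEstimates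

section CuspSharpEstimates

variable {γf : ℝ → ℝ} {Ω : Set ℂ} {ψ : ℂ → ℂ} {δ ρ₁ : ℝ}

lemma re_quadratic (L : ℝ) (θ : ℝ) (z : ℂ) :
    (2 * (L : ℂ) * (z - θ * Complex.I) - (z - θ * Complex.I) ^ 2).re =
      2 * L * z.re - z.re ^ 2 + (z.im - θ) ^ 2 := by
  simp [pow_two]; ring

lemma re_cubic (L b θ : ℝ) (z : ℂ) :
    ((L : ℂ) ^ 2 * (z - b - θ * Complex.I) + (z - b - θ * Complex.I) ^ 3).re =
      L ^ 2 * (z.re - b) + (z.re - b) ^ 3 - 3 * (z.re - b) * (z.im - θ) ^ 2 := by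
  have h1 : ((L : ℂ) ^ 2 * (z - b - θ * Complex.I)).re = L ^ 2 * (z.re - b) := by
    rw [← Complex.ofReal_pow, Complex.re_ofReal_mul]; simp
  rw [Complex.add_re, h1]
  simp [pow_succ]; ring

lemma norm_le_of_re_im {z : ℂ} {a b : ℝ} (h1 : |z.re| ≤ a) (h2 : |z.im| ≤ b) : ‖z‖ ≤ a + b :=
  (Complex.norm_le_abs_re_add_abs_im z).trans (add_le_add h1 h2)

lemma exists_one_sub_sq_le_re_mul (hγ : IsGauge γf) (hc : IsCuspDomain γf Ω ρ₁)
    (hψ : IsInverseMap Ω ψ δ) : ∃ C > 0, ∃ ρ > 0, ρ ≤ 1 / 8 ∧ ρ < ρ₁ ∧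
      ∀ z : ℂ, Complex.exp (-z) ∈ Ω → ‖z‖ < ρ →
        1 - ‖ψ (Complex.exp (-z))‖ ^ 2 ≤ C * (z.re * Real.exp (-Gam γf ‖z‖)) := by
  obtain ⟨C, hC, ρ, hρ, hρ₁, hmain⟩ := exists_one_sub_sq_le_norm_mul hγ hc hψ
  have hpi := Real.pi_gt_three
  set ρ' := min (ρ / 4) (1 / (4 * C)) with hρ'
  have hρ'0 : 0 < ρ' := lt_min (by linarith [hρ.1]) (by positivity)
  have hρ'1 : ρ' ≤ ρ / 4 := min_le_left _ _
  have hρ'2 : ρ' ≤ 1 / (4 * C) := min_le_right _ _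
  have hρ0 := hρ.1
  have hρ2 := hρ.2
  refine ⟨128 * C, by positivity, ρ', hρ'0, by linarith, by linarith, fun z hz hzρ => ?_⟩
  have hz1 := hc.lt_re z (by linarith) hz
  have hz2 : 0 < z.re := (hγ.comp_abs_nonneg (by linarith)).trans_lt hz1
  set t := ‖z‖ with ht
  have ht0 : 0 < t := by linarith [Complex.re_le_norm z]
  have htpos : 0 < Real.exp (-Gam γf t) := Real.exp_pos _
  by_cases hs : t / 4 ≤ z.re
  · calc 1 - ‖ψ (Complex.exp (-z))‖ ^ 2 ≤ C * (t * Real.exp (-Gam γf t)) :=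
          hmain z hz (by linarith)
      _ ≤ C * ((4 * z.re) * Real.exp (-Gam γf t)) := by gcongr; linarith
      _ ≤ 128 * C * (z.re * Real.exp (-Gam γf t)) := by
          have : 0 ≤ C * (z.re * Real.exp (-Gam γf t)) := by positivity
          linarith
  push Not at hs
  set L := t / 4 with hL
  have hL0 : 0 < L := by positivity
  set E := Real.exp (-Gam γf (2 * t)) with hE
  have hE0 : 0 < E := Real.exp_pos _
  have hE1 : E ≤ 1 := Real.exp_le_one_iff.2
    (neg_nonpos.2 (hγ.Gam_nonneg (by linarith) (by linarith)))
  have hE2 : E ≤ 2 * Real.exp (-Gam γf t) := by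
    have := hγ.exp_neg_Gam_le ht0 (y := 2 * t) (by linarith) (by linarith)
    rwa [mul_div_cancel_right₀ _ ht0.ne'] at this
  set B := 2 * C * t * E with hB
  have hB0 : 0 < B := by positivity
  have hBh : B ≤ 1 / 2 := by
    calc B ≤ 2 * C * t * 1 := by rw [hB]; gcongr
      _ ≤ 2 * C * (1 / (4 * C)) * 1 := by gcongr; linarith
      _ = 1 / 2 := by field_simp; norm_num
  set D := {w : ℂ | Complex.exp (-w) ∈ Ω} ∩ ({w : ℂ | 0 < w.re} ∩ {w | w.re < L} ∩
    {w | |w.im - z.im| < L}) with hD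
  set Q := {w : ℂ | 0 ≤ w.re} ∩ {w | w.re ≤ L} ∩ {w : ℂ | |w.im - z.im| ≤ L} with hQ
  have hQc : IsClosed Q := by
    refine ((isClosed_le (by fun_prop) (by fun_prop)).inter
      (isClosed_le (by fun_prop) (by fun_prop))).inter (isClosed_le (by fun_prop) (by fun_prop))
  have hDQ : D ⊆ Q := fun w hw => by
    obtain ⟨-, ⟨h1, h2⟩, h3⟩ := hw
    simp only [mem_setOf_eq] at h1 h2 h3
    refine ⟨⟨h1.le, h2.le⟩, ?_⟩
    simp only [mem_setOf_eq]; exact h3.le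
  have hDo : IsOpen D := (isOpen_preimage_exp_neg hc.isOpen).inter
    (((isOpen_lt (by fun_prop) (by fun_prop)).inter (isOpen_lt (by fun_prop) (by fun_prop))).inter
      (isOpen_lt (by fun_prop) (by fun_prop)))
  have hQn : ∀ w ∈ Q, ‖w‖ ≤ 2 * t := by
    rintro w ⟨⟨h1, h2⟩, h3⟩
    simp only [mem_setOf_eq] at h1 h2 h3
    have h4 : |w.im| ≤ L + t := by
      have h5 := Complex.abs_im_le_norm z
      have h6 := abs_add_le (w.im - z.im) z.im
      rw [sub_add_cancel] at h6
      linarith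
    have := norm_le_of_re_im (a := L) (by rw [abs_of_nonneg h1]; exact h2) h4
    linarith
  have hcmp := hψ.exp_le_norm (D := D)
    (F := fun w => ((-(2 * B / L ^ 2) : ℝ) : ℂ) *
      (2 * (L : ℂ) * (w - (z.im : ℝ) * Complex.I) - (w - (z.im : ℝ) * Complex.I) ^ 2))
    hDo (isBounded_ball.subset (t := ball 0 1) fun w hw => ?_) (fun w hw => hw.1)
    (Differentiable.differentiableOn (by fun_prop)) ?_ ?_
  · have h1 := hcmp z ⟨hz, ⟨hz2, hs⟩, by simpa using hL0⟩
    rw [Complex.re_ofReal_mul, re_quadratic] at h1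
    have h2 : Real.exp (-(2 * B / L ^ 2) * (2 * L * z.re)) ≤ ‖ψ (Complex.exp (-z))‖ := by
      refine le_trans (Real.exp_le_exp.2 ?_) h1
      rw [sub_self]
      have : 0 ≤ 2 * B / L ^ 2 * z.re ^ 2 := by positivity
      linarith
    have h3 : Real.exp (-(2 * B / L ^ 2) * (2 * L * z.re)) ^ 2 ≤ ‖ψ (Complex.exp (-z))‖ ^ 2 := by
      gcongr
    rw [← Real.exp_nat_mul] at h3
    have h4 := Real.add_one_le_exp ((2 : ℕ) * (-(2 * B / L ^ 2) * (2 * L * z.re)))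
    have h5 : ((2 : ℕ) : ℝ) * (-(2 * B / L ^ 2) * (2 * L * z.re)) = -(64 * C * z.re * E) := by
      rw [hB, hL]; push_cast; field_simp; ring
    rw [h5] at h3 h4
    have h6 : 64 * C * z.re * E ≤ 64 * C * z.re * (2 * Real.exp (-Gam γf t)) := by gcongr
    linarith
  · have := hQn w (hDQ hw)
    simp only [mem_ball_zero_iff]; linarith
  · intro w hw hwΩ ε hε
    filter_upwards [self_mem_nhdsWithin] with v hv
    rw [Complex.re_ofReal_mul, re_quadratic]
    obtain ⟨-, ⟨h1, h2⟩, h3⟩ := hv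
    simp only [mem_setOf_eq] at h1 h2
    have h4 : 0 ≤ 2 * L * v.re - v.re ^ 2 + (v.im - z.im) ^ 2 := by nlinarith
    have h5 : 0 ≤ 2 * B / L ^ 2 := by positivity
    nlinarith
  · intro w hw hwΩ
    refine ⟨Continuous.continuousWithinAt (by fun_prop), ?_⟩
    have hwQ : w ∈ Q := closure_minimal hDQ hQc hw.1
    have hwn := hQn w hwQ
    have hwD : w ∉ D := fun h => by
      have := hw.2; rw [hDo.interior_eq] at this; exact this h
    obtain ⟨⟨h1, h2⟩, h3⟩ := hwQ
    simp only [mem_setOf_eq] at h1 h2 h3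
    have h4 : 0 < w.re := (hγ.comp_abs_nonneg (by linarith)).trans_lt
      (hc.lt_re w (by linarith) hwΩ)
    have hw0 : 0 < ‖w‖ := by linarith [Complex.re_le_norm w]
    have h5 : L ^ 2 ≤ 2 * L * w.re - w.re ^ 2 + (w.im - z.im) ^ 2 := by
      rcases eq_or_lt_of_le h2 with h6 | h6
      · rw [h6]; nlinarith [sq_nonneg (w.im - z.im)]
      · have h7 : |w.im - z.im| = L := by
          by_contra h8
          exact hwD ⟨hwΩ, ⟨h4, h6⟩, lt_of_le_of_ne h3 h8⟩
        rw [← sq_abs (w.im - z.im), h7]; nlinarith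
    rw [Complex.re_ofReal_mul, re_quadratic]
    have h6 : Real.exp (-(2 * B / L ^ 2) *
        (2 * L * w.re - w.re ^ 2 + (w.im - z.im) ^ 2)) ≤ Real.exp (-(2 * B)) := by
      refine Real.exp_le_exp.2 ?_
      have : 2 * B / L ^ 2 * L ^ 2 ≤ 2 * B / L ^ 2 *
        (2 * L * w.re - w.re ^ 2 + (w.im - z.im) ^ 2) := by gcongr
      rw [div_mul_cancel₀ _ (by positivity)] at this
      linarith
    refine h6.trans ?_
    have h7 : 1 - ‖ψ (Complex.exp (-w))‖ ^ 2 ≤ B := by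
      refine (hmain w hwΩ (by linarith)).trans ?_
      have h8 := hγ.exp_neg_Gam_mono hw0 hwn (by linarith)
      calc C * (‖w‖ * Real.exp (-Gam γf ‖w‖)) ≤ C * ((2 * t) * E) := by gcongr
        _ = B := by rw [hB]; ring
    refine le_of_sq_le_sq ?_ (norm_nonneg _)
    rw [← Real.exp_nat_mul]
    have h8 := one_sub_exp_neg_ge (u := 4 * B) (b := 4 * B) (by positivity) le_rfl
    have h9 : B ≤ 4 * B / (1 + 4 * B) := by
      rw [le_div_iff₀ (by positivity)]; nlinarith
    have h10 : ((2 : ℕ) : ℝ) * -(2 * B) = -(4 * B) := by push_cast; ring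
    rw [h10]; linarith

lemma exists_re_mul_le_one_sub_sq (hγ : IsGauge γf) (hc : IsCuspDomain γf Ω ρ₁)
    (hψ : IsInverseMap Ω ψ δ) : ∃ c > 0, ∃ ρ > 0, ρ ≤ 1 / 8 ∧ ρ < ρ₁ ∧
      ∀ z : ℂ, 0 < z.im → z.im < ρ → 4 * γf (2 * z.im) ≤ z.re → z.re ≤ z.im / 8 →
        Complex.exp (-z) ∈ Ω ∧
        c * (z.re * Real.exp (-Gam γf z.im)) ≤ 1 - ‖ψ (Complex.exp (-z))‖ ^ 2 := by
  obtain ⟨c, hc0, ρ, hρ, hρ₁, hmain⟩ := exists_norm_mul_le_one_sub hγ hc hψ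
  have hpi := Real.pi_gt_three
  have hρ0 := hρ.1
  have hρ2 := hρ.2
  refine ⟨c / (1 + c) / 4, by positivity, ρ / 4, by linarith, by linarith, by linarith,
    fun z hθ hθρ hs1 hs2 => ?_⟩
  set θ := z.im with hθdef
  set L := θ / 4 with hL
  have hL0 : 0 < L := by positivity
  have hg0 : 0 < γf (2 * θ) := hγ.pos _ ⟨by linarith, by linarith⟩
  have hg1 : γf (2 * θ) ≤ 1 := hγ.le_one _ ⟨by linarith, by linarith⟩
  set b := 2 * γf (2 * θ) with hb
  set E := Real.exp (-Gam γf (θ / 2)) with hE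
  have hE0 : 0 < E := Real.exp_pos _
  have hE1 : E ≤ 1 := Real.exp_le_one_iff.2
    (neg_nonpos.2 (hγ.Gam_nonneg (by linarith) (by linarith)))
  have hE2 : Real.exp (-Gam γf θ) ≤ 2 * E := by
    have := hγ.exp_neg_Gam_le (x := θ / 2) (y := θ) (by linarith) (by linarith) (by linarith)
    rwa [show θ / (θ / 2) = 2 by field_simp] at this
  set D := {w : ℂ | b < w.re} ∩ {w | w.re < b + L} ∩ {w : ℂ | |w.im - θ| < L} with hD
  set Q := {w : ℂ | b ≤ w.re} ∩ {w | w.re ≤ b + L} ∩ {w : ℂ | |w.im - θ| ≤ L} with hQ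
  have hQc : IsClosed Q := by
    refine ((isClosed_le (by fun_prop) (by fun_prop)).inter
      (isClosed_le (by fun_prop) (by fun_prop))).inter (isClosed_le (by fun_prop) (by fun_prop))
  have hDQ : D ⊆ Q := fun w hw => by
    obtain ⟨⟨h1, h2⟩, h3⟩ := hw
    simp only [mem_setOf_eq] at h1 h2 h3
    refine ⟨⟨h1.le, h2.le⟩, ?_⟩
    simp only [mem_setOf_eq]; exact h3.le
  have hDo : IsOpen D :=
    ((isOpen_lt (by fun_prop) (by fun_prop)).inter (isOpen_lt (by fun_prop) (by fun_prop))).inter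
      (isOpen_lt (by fun_prop) (by fun_prop))
  have hQn : ∀ w ∈ Q, ‖w‖ ≤ 2 * θ ∧ θ / 2 ≤ ‖w‖ ∧ Complex.exp (-w) ∈ Ω := by
    rintro w ⟨⟨h1, h2⟩, h3⟩
    simp only [mem_setOf_eq] at h1 h2 h3
    obtain ⟨h4, h5⟩ := abs_le.1 h3
    have h6 : |w.im| ≤ 5 * L := by rw [abs_le]; constructor <;> linarith
    have h7 : ‖w‖ ≤ 2 * θ := by
      have := norm_le_of_re_im (a := b + L) (by rw [abs_of_nonneg] <;> linarith) h6
      linarith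
    refine ⟨h7, by linarith [(le_abs_self _).trans (Complex.abs_im_le_norm w)],
      hc.mem_of_le w (by linarith) (by linarith) ?_⟩
    have h8 : γf |w.im| ≤ γf (2 * θ) :=
      hγ.mono ⟨abs_nonneg _, by linarith⟩ ⟨by linarith, by linarith⟩ (by linarith)
    have h9 := hγ.comp_abs_nonneg (z := w) (by linarith)
    nlinarith
  have hzQ : z ∈ Q := ⟨⟨by simp only [mem_setOf_eq]; linarith, by
    simp only [mem_setOf_eq]; linarith⟩, by simp only [mem_setOf_eq]; rw [← hθdef, sub_self, abs_zero]; exact hL0.le⟩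
  have hzD : z ∈ D := ⟨⟨by simp only [mem_setOf_eq]; linarith, by
    simp only [mem_setOf_eq]; linarith⟩, by simp only [mem_setOf_eq]; rw [← hθdef, sub_self, abs_zero]; exact hL0⟩
  refine ⟨(hQn z hzQ).2.2, ?_⟩
  have hcmp := hψ.norm_mul_exp_le (D := D)
    (F := fun w => ((c * E / L ^ 2 : ℝ) : ℂ) *
      ((L : ℂ) ^ 2 * (w - (b : ℝ) - (θ : ℝ) * Complex.I) + (w - (b : ℝ) - (θ : ℝ) * Complex.I) ^ 3))
    hDo (isBounded_ball.subset (t := ball 0 1) fun w hw => ?_)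
    (fun w hw => (hQn w (hDQ hw)).2.2)
    (Differentiable.differentiableOn (by fun_prop)) ?_ ?_
  · have h1 := hcmp z hzD
    rw [Complex.re_ofReal_mul, re_cubic, ← hθdef, sub_self] at h1
    set x := z.re - b with hx
    have hx1 : z.re / 2 ≤ x := by linarith
    have hx2 : x ≤ 1 := by linarith
    have hx0 : 0 ≤ x := by linarith
    have h2 : c * E * x ≤ c * E / L ^ 2 * (L ^ 2 * x + x ^ 3 - 3 * x * 0 ^ 2) := by
      have : 0 ≤ c * E / L ^ 2 * x ^ 3 := by positivity
      have h3 : c * E / L ^ 2 * (L ^ 2 * x) = c * E * x := by field_simp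
      linarith
    have h3 : ‖ψ (Complex.exp (-z))‖ ≤ Real.exp (-(c * E * x)) := by
      rw [← le_div_iff₀ (Real.exp_pos _), one_div, ← Real.exp_neg] at h1
      exact h1.trans (Real.exp_le_exp.2 (by linarith))
    have h4 := one_sub_exp_neg_ge (u := c * E * x) (b := c) (by positivity)
      (by calc c * E * x ≤ c * 1 * 1 := by gcongr
            _ = c := by ring)
    have h5 : ‖ψ (Complex.exp (-z))‖ ^ 2 ≤ ‖ψ (Complex.exp (-z))‖ := by
      have := hψ.lt_one _ (hQn z hzQ).2.2
      nlinarith [norm_nonneg (ψ (Complex.exp (-z)))]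
    have h6 : c / (1 + c) / 4 * (z.re * Real.exp (-Gam γf θ)) ≤ c * E * x / (1 + c) := by
      calc c / (1 + c) / 4 * (z.re * Real.exp (-Gam γf θ)) ≤
            c / (1 + c) / 4 * ((2 * x) * (2 * E)) := by
            gcongr <;> linarith
        _ = _ := by ring
    linarith
  · have := (hQn w (hDQ hw)).1
    simp only [mem_ball_zero_iff]; linarith
  · intro w hw hwΩ
    exact absurd (hQn w (closure_minimal hDQ hQc hw.1)).2.2 hwΩ
  · intro w hw hwΩ
    refine ⟨Continuous.continuousWithinAt (by fun_prop), ?_⟩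
    have hwQ : w ∈ Q := closure_minimal hDQ hQc hw.1
    obtain ⟨hw1, hw2, -⟩ := hQn w hwQ
    have hwD : w ∉ D := fun h => by
      have := hw.2; rw [hDo.interior_eq] at this; exact this h
    obtain ⟨⟨h1, h2⟩, h3⟩ := hwQ
    simp only [mem_setOf_eq] at h1 h2 h3
    rw [Complex.re_ofReal_mul, re_cubic]
    set x := w.re - b with hx
    have hx0 : 0 ≤ x := by linarith
    have hxL : x ≤ L := by linarith
    have hlt := hψ.lt_one _ hwΩ
    have hneg : L ^ 2 * x + x ^ 3 - 3 * x * (w.im - θ) ^ 2 ≤ 0 →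
        ‖ψ (Complex.exp (-w))‖ * Real.exp (c * E / L ^ 2 *
          (L ^ 2 * x + x ^ 3 - 3 * x * (w.im - θ) ^ 2)) ≤ 1 := fun h => by
      refine mul_le_one₀ hlt.le (Real.exp_pos _).le (Real.exp_le_one_iff.2 ?_)
      exact mul_nonpos_of_nonneg_of_nonpos (by positivity) h
    by_cases h4 : |w.im - θ| = L
    · apply hneg
      rw [← sq_abs (w.im - θ), h4]
      have : x ^ 2 ≤ L ^ 2 := by gcongr
      nlinarith
    by_cases h5 : x = 0
    · apply hneg; rw [h5]; simp
    have h6 : x = L := by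
      by_contra h7
      refine hwD ⟨⟨?_, ?_⟩, lt_of_le_of_ne h3 h4⟩
      · have := lt_of_le_of_ne hx0 (Ne.symm h5)
        simp only [mem_setOf_eq]; linarith
      · have := lt_of_le_of_ne hxL h7
        simp only [mem_setOf_eq]; linarith
    have h7 := hmain w hwΩ (by linarith) (by linarith)
    have h8 := hγ.exp_neg_Gam_mono (x := θ / 2) (by linarith) hw2 (by linarith)
    have h9 : c * (2 * L * E) ≤ c * (‖w‖ * Real.exp (-Gam γf ‖w‖)) := by
      gcongr; linarith
    have h10 : ‖ψ (Complex.exp (-w))‖ ≤ Real.exp (-(c * (2 * L * E))) := by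
      linarith [Real.add_one_le_exp (-(c * (2 * L * E)))]
    calc _ ≤ Real.exp (-(c * (2 * L * E))) * Real.exp (c * (2 * L * E)) := by
          refine mul_le_mul h10 (Real.exp_le_exp.2 ?_) (Real.exp_pos _).le (Real.exp_pos _).le
          have h11 : L ^ 2 * x + x ^ 3 - 3 * x * (w.im - θ) ^ 2 ≤ 2 * L ^ 3 := by
            rw [h6]; nlinarith [sq_nonneg (w.im - θ)]
          calc c * E / L ^ 2 * (L ^ 2 * x + x ^ 3 - 3 * x * (w.im - θ) ^ 2) ≤
                c * E / L ^ 2 * (2 * L ^ 3) := by gcongr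
            _ = _ := by field_simp
      _ = 1 := by rw [← Real.exp_add]; simp

end CuspSharpEstimates

section WeightedSpace

variable {α : ℝ} {H1 : Type} [NormedAddCommGroup H1] [InnerProductSpace ℂ H1] [CompleteSpace H1]
  {e1 : H1 →ₗ[ℂ] (ℂ → ℂ)}

lemma one_sub_norm_sq_pos {z : ℂ} (hz : z ∈ ball (0 : ℂ) 1) : 0 < 1 - ‖z‖ ^ 2 := by
  have h1 : ‖z‖ < 1 := by simpa using hz
  nlinarith [norm_nonneg z]

lemma weight_sq (hα : 0 < α) {z : ℂ} (hz : z ∈ ball (0 : ℂ) 1) :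
    Real.sqrt (((α + 1) / Real.pi) * (1 - ‖z‖ ^ 2) ^ α) ^ 2 =
      (α + 1) / Real.pi * (1 - ‖z‖ ^ 2) ^ α := by
  have := one_sub_norm_sq_pos hz
  have := Real.pi_pos
  exact Real.sq_sqrt (by positivity)

lemma ofReal_norm_sq_mul {E : Type*} [NormedAddCommGroup E] (x : E) (y : ℝ) :
    ENNReal.ofReal (‖x‖ ^ 2 * y) = ‖x‖ₑ ^ 2 * ENNReal.ofReal y := by
  rw [ENNReal.ofReal_mul (by positivity), ENNReal.ofReal_pow (norm_nonneg _), ofReal_norm_eq_enorm]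

lemma IsHSpace.differentiableAt {ω : ℂ → ℝ} (h : IsHSpace ω e1) (f : H1) {z : ℂ}
    (hz : z ∈ ball (0 : ℂ) 1) : DifferentiableAt ℂ (e1 f) z :=
  (h.holo f z hz).differentiableAt (isOpen_ball.mem_nhds hz)

lemma IsHSpace.differentiableOn_deriv {ω : ℂ → ℝ} (h : IsHSpace ω e1) (f : H1) :
    DifferentiableOn ℂ (deriv (e1 f)) (ball 0 1) :=
  (h.holo f).deriv isOpen_ball

lemma IsHSpace.lintegral_lt_top {ω : ℂ → ℝ} (h : IsHSpace ω e1)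
    (hω : ContinuousOn ω (ball 0 1)) (hωb : ∃ M, ∀ z ∈ ball (0 : ℂ) 1, ω z ^ 2 ≤ M) (f : H1) :
    (∫⁻ z in ball (0 : ℂ) 1, ENNReal.ofReal (‖deriv (e1 f) z‖ ^ 2 * ω z ^ 2)) < ⊤ := by
  set I : H1 → ℝ≥0∞ := fun f =>
    ∫⁻ z in ball (0 : ℂ) 1, ENNReal.ofReal (‖deriv (e1 f) z‖ ^ 2 * ω z ^ 2) with hI
  have hcont : ∀ f, ContinuousOn (fun z => ‖deriv (e1 f) z‖ ^ 2 * ω z ^ 2) (ball 0 1) := fun f =>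
    ((h.differentiableOn_deriv f).continuousOn.norm.pow 2).mul (hω.pow 2)
  have hnorm : ∀ f, I f = ⊤ → ‖f‖ ^ 2 = ‖e1 f 0‖ ^ 2 := by
    intro f hf
    rw [h.norm_sq f, integral_eq_lintegral_of_nonneg_ae
      (Eventually.of_forall fun z => by positivity)
      ((hcont f).aestronglyMeasurable measurableSet_ball)]
    have : ∫⁻ z in ball (0 : ℂ) 1, ENNReal.ofReal (‖deriv (e1 f) z‖ ^ 2 * ω z ^ 2) = ⊤ := hf
    rw [this]; simp
  have hsub : ∀ f g, I f < ⊤ → I g < ⊤ → I (f - g) < ⊤ := by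
    intro f g hf hg
    have h1 : I (f - g) ≤ 2 * I f + 2 * I g := by
      have hm : ∀ f, AEMeasurable (fun z => ENNReal.ofReal (‖deriv (e1 f) z‖ ^ 2 * ω z ^ 2))
          (volume.restrict (ball 0 1)) := fun f =>
        ((hcont f).aemeasurable measurableSet_ball).ennreal_ofReal
      rw [hI]; beta_reduce
      rw [← lintegral_const_mul'' _ (hm f), ← lintegral_const_mul'' _ (hm g),
        ← lintegral_add_left' ((hm f).const_mul _)]
      refine setLIntegral_mono_ae' measurableSet_ball (Eventually.of_forall fun z hz => ?_)
      have h2 : deriv (e1 (f - g)) z = deriv (e1 f) z - deriv (e1 g) z := by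
        rw [map_sub]; exact deriv_sub (h.differentiableAt f hz) (h.differentiableAt g hz)
      rw [h2, show (2 : ℝ≥0∞) = ENNReal.ofReal 2 by simp, ← ENNReal.ofReal_mul (by norm_num),
        ← ENNReal.ofReal_mul (by norm_num), ← ENNReal.ofReal_add (by positivity) (by positivity)]
      refine ENNReal.ofReal_le_ofReal ?_
      have h3 := norm_sub_le (deriv (e1 f) z) (deriv (e1 g) z)
      have h4 : ‖deriv (e1 f) z - deriv (e1 g) z‖ ^ 2 ≤
          2 * ‖deriv (e1 f) z‖ ^ 2 + 2 * ‖deriv (e1 g) z‖ ^ 2 := by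
        nlinarith [norm_nonneg (deriv (e1 f) z - deriv (e1 g) z), norm_nonneg (deriv (e1 f) z),
          norm_nonneg (deriv (e1 g) z), sq_nonneg (‖deriv (e1 f) z‖ - ‖deriv (e1 g) z‖)]
      nlinarith [mul_le_mul_of_nonneg_right h4 (sq_nonneg (ω z))]
    refine h1.trans_lt (ENNReal.add_lt_top.2 ⟨?_, ?_⟩) <;>
      exact ENNReal.mul_lt_top (by simp) ‹_›
  by_contra hf
  have hf : I f = ⊤ := not_lt_top_iff.1 hf
  obtain ⟨M, hM⟩ := hωb
  obtain ⟨g, hg⟩ := h.surj id differentiableOn_id (by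
    calc _ ≤ ∫⁻ z in ball (0 : ℂ) 1, ENNReal.ofReal M :=
          setLIntegral_mono' measurableSet_ball fun z hz => by
            refine ENNReal.ofReal_le_ofReal ?_
            simpa using hM z hz
      _ < ⊤ := by
        rw [setLIntegral_const]
        exact ENNReal.mul_lt_top ENNReal.ofReal_lt_top measure_ball_lt_top)
  have hgI : I g < ⊤ := by
    calc I g ≤ ∫⁻ z in ball (0 : ℂ) 1, ENNReal.ofReal M :=
          setLIntegral_mono' measurableSet_ball fun z hz => by
            refine ENNReal.ofReal_le_ofReal ?_
            have : deriv (e1 g) z = 1 := by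
              rw [Filter.EventuallyEq.deriv_eq (f := id) ?_, deriv_id]
              filter_upwards [isOpen_ball.mem_nhds hz] with w hw using hg w hw
            rw [this]; simpa using hM z hz
      _ < ⊤ := by
        rw [setLIntegral_const]
        exact ENNReal.mul_lt_top ENNReal.ofReal_lt_top measure_ball_lt_top
  have hgI' : I (-g) < ⊤ := by
    have h0 : I 0 < ⊤ := by
      have := hsub g g hgI hgI
      rwa [sub_self] at this
    have := hsub 0 g h0 hgI
    rwa [zero_sub] at this
  have h1 : I (f + g) = ⊤ := not_lt_top_iff.1 fun h1 => by
    have := hsub _ _ h1 hgI; rw [add_sub_cancel_right, hf] at this; exact lt_irrefl _ this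
  have h2 : I (f - g) = ⊤ := not_lt_top_iff.1 fun h1 => by
    have := hsub _ _ h1 hgI'; rw [sub_neg_eq_add, sub_add_cancel, hf] at this
    exact lt_irrefl _ this
  have h0 : e1 g 0 = 0 := hg 0 (by simp)
  have h3 := parallelogram_law_with_norm ℂ f g
  have h4 := hnorm _ h1
  have h5 := hnorm _ h2
  have h6 := hnorm _ hf
  rw [map_add, Pi.add_apply, h0, add_zero] at h4
  rw [map_sub, Pi.sub_apply, h0, sub_zero] at h5
  have h7 : ‖g‖ = 0 := by
    have : ‖g‖ * ‖g‖ = 0 := by nlinarith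
    simpa using this
  have h8 := hg (1 / 2) (by simp; norm_num)
  rw [norm_eq_zero.1 h7] at h8
  simp at h8

lemma continuousOn_weight (hα : 0 < α) : ContinuousOn (fun z : ℂ => (1 - ‖z‖ ^ 2) ^ α) (ball 0 1) :=
  ContinuousOn.rpow_const (by fun_prop) fun z hz => Or.inr hα.le

lemma IsHSpace.ofReal_norm_sq (hα : 0 < α)
    (h : IsHSpace (fun w => Real.sqrt (((α + 1) / Real.pi) * (1 - ‖w‖ ^ 2) ^ α)) e1) (f : H1) :
    ENNReal.ofReal (‖f‖ ^ 2) = ENNReal.ofReal (‖e1 f 0‖ ^ 2) +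
      ENNReal.ofReal ((α + 1) / Real.pi) *
        ∫⁻ z in ball (0 : ℂ) 1, ‖deriv (e1 f) z‖ₑ ^ 2 * ENNReal.ofReal ((1 - ‖z‖ ^ 2) ^ α) := by
  have hpi := Real.pi_pos
  have hcw : ContinuousOn (fun w : ℂ => Real.sqrt (((α + 1) / Real.pi) * (1 - ‖w‖ ^ 2) ^ α))
      (ball 0 1) := (continuousOn_const.mul (continuousOn_weight hα)).sqrt
  have hfin := h.lintegral_lt_top hcw ⟨(α + 1) / Real.pi, fun z hz => by
    rw [weight_sq hα hz]
    refine mul_le_of_le_one_right (by positivity) (Real.rpow_le_one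
      (one_sub_norm_sq_pos hz).le (by linarith [sq_nonneg ‖z‖]) hα.le)⟩ f
  have hcont : ContinuousOn (fun z => ‖deriv (e1 f) z‖ ^ 2 *
      Real.sqrt (((α + 1) / Real.pi) * (1 - ‖z‖ ^ 2) ^ α) ^ 2) (ball 0 1) :=
    ((h.differentiableOn_deriv f).continuousOn.norm.pow 2).mul (hcw.pow 2)
  rw [h.norm_sq f, ENNReal.ofReal_add (by positivity)
    (integral_nonneg fun z => by positivity), integral_eq_lintegral_of_nonneg_ae
      (Eventually.of_forall fun z => by positivity)
      (hcont.aestronglyMeasurable measurableSet_ball), ENNReal.ofReal_toReal hfin.ne]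
  congr 1
  rw [← lintegral_const_mul'' _ ?_]
  · refine setLIntegral_congr_fun measurableSet_ball fun z hz => ?_
    beta_reduce
    rw [weight_sq hα hz, ofReal_norm_sq_mul, ENNReal.ofReal_mul (by positivity)]
    ring
  · exact (((h.differentiableOn_deriv f).continuousOn.enorm.aemeasurable
      measurableSet_ball).pow_const 2).mul ((continuousOn_weight hα).aemeasurable
        measurableSet_ball).ennreal_ofReal

end WeightedSpace

section ChangeOfVariables

lemma abs_det_smul_one (a : ℂ) :
    ENNReal.ofReal |(a • (1 : ℂ →L[ℝ] ℂ)).det| = ‖a‖ₑ ^ 2 := by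
  have h1 : ((a • (1 : ℂ →L[ℝ] ℂ) : ℂ →L[ℝ] ℂ) : ℂ →ₗ[ℝ] ℂ) = Algebra.lmul ℝ ℂ a := by
    ext <;> simp
  have h2 : (a • (1 : ℂ →L[ℝ] ℂ)).det = Complex.normSq a := by
    rw [ContinuousLinearMap.det, h1, ← Algebra.norm_complex_apply, Algebra.norm_apply]
  rw [h2, Complex.normSq_eq_norm_sq, abs_of_nonneg (by positivity),
    ENNReal.ofReal_pow (norm_nonneg _), ofReal_norm_eq_enorm]

lemma lintegral_image_eq_of_hasDerivAt {s : Set ℂ} (hs : MeasurableSet s) {φ φ' : ℂ → ℂ}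
    (hd : ∀ z ∈ s, HasDerivAt φ (φ' z) z) (hi : InjOn φ s) (g : ℂ → ℝ≥0∞) :
    ∫⁻ w in φ '' s, g w = ∫⁻ z in s, ‖φ' z‖ₑ ^ 2 * g (φ z) := by
  rw [lintegral_image_eq_lintegral_abs_det_fderiv_mul volume hs
    (fun z hz => (hd z hz).complexToReal_fderiv.hasFDerivWithinAt) hi]
  simp_rw [abs_det_smul_one]

lemma injOn_exp_neg : InjOn (fun z : ℂ => Complex.exp (-z)) (ball 0 1) := by
  intro z hz w hw h
  have hpi := Real.pi_gt_three
  have h1 : ∀ z ∈ ball (0 : ℂ) 1, |z.im| < 1 := fun z hz =>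
    (Complex.abs_im_le_norm z).trans_lt (by simpa using hz)
  have h2 := abs_lt.1 (h1 z hz)
  have h3 := abs_lt.1 (h1 w hw)
  have := Complex.exp_inj_of_neg_pi_lt_of_le_pi (x := -z) (y := -w)
    (by simp; linarith) (by simp; linarith) (by simp; linarith) (by simp; linarith) h
  exact neg_injective this

lemma lintegral_exp_neg_image {s : Set ℂ} (hs : MeasurableSet s) (hs1 : s ⊆ ball 0 1)
    (g : ℂ → ℝ≥0∞) :
    ∫⁻ w in (fun z : ℂ => Complex.exp (-z)) '' s, g w =
      ∫⁻ z in s, ‖Complex.exp (-z)‖ₑ ^ 2 * g (Complex.exp (-z)) := by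
  rw [lintegral_image_eq_of_hasDerivAt (φ' := fun z => -Complex.exp (-z)) hs (fun z _ => ?_)
    (injOn_exp_neg.mono hs1)]
  · simp
  · simpa using (hasDerivAt_neg z).cexp

lemma enorm_exp_neg_sq_bounds {z : ℂ} (hz : z ∈ ball (0 : ℂ) 1) :
    ENNReal.ofReal (1 / 9) ≤ ‖Complex.exp (-z)‖ₑ ^ 2 := by
  rw [← ofReal_norm_eq_enorm, ← ENNReal.ofReal_pow (norm_nonneg _)]
  refine ENNReal.ofReal_le_ofReal ?_
  have h1 : -1 ≤ (-z).re := by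
    have := (Complex.re_le_norm z).trans_lt (by simpa using hz : ‖z‖ < 1)
    simp; linarith
  have h2 : (1 / 3 : ℝ) ≤ ‖Complex.exp (-z)‖ := by
    rw [Complex.norm_exp]
    have h3 : (1 / 3 : ℝ) ≤ Real.exp (-1) := by
      rw [Real.exp_neg, one_div]
      gcongr
      linarith [Real.exp_one_lt_three]
    exact h3.trans (Real.exp_le_exp.2 h1)
  calc (1 / 9 : ℝ) = (1 / 3) ^ 2 := by norm_num
    _ ≤ _ := by gcongr

lemma enorm_exp_neg_sq_le_one {z : ℂ} (hz : 0 ≤ z.re) : ‖Complex.exp (-z)‖ₑ ^ 2 ≤ 1 := by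
  rw [← ofReal_norm_eq_enorm, ← ENNReal.ofReal_pow (norm_nonneg _)]
  refine ENNReal.ofReal_le_one.2 (pow_le_one₀ (norm_nonneg _) ?_)
  rw [Complex.norm_exp]
  exact Real.exp_le_one_iff.2 (by simpa using hz)

variable {α : ℝ} {H1 : Type} [NormedAddCommGroup H1] [InnerProductSpace ℂ H1] [CompleteSpace H1]
  {e1 : H1 →ₗ[ℂ] (ℂ → ℂ)}

/-- A composition operator `T` on `ℋ_α` whose symbol `φ` maps `𝔻` conformally onto `Ω`, with
inverse `ψ`. -/
structure IsCompData (α : ℝ) (Ω : Set ℂ) (φ ψ : ℂ → ℂ) (e1 : H1 →ₗ[ℂ] (ℂ → ℂ))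
    (T : H1 →L[ℂ] H1) : Prop where
  pos : 0 < α
  space : IsHSpace (fun w => Real.sqrt (((α + 1) / Real.pi) * (1 - ‖w‖ ^ 2) ^ α)) e1
  comp : ∀ f : H1, ∀ z ∈ ball (0 : ℂ) 1, e1 (T f) z = e1 f (φ z)
  diff : DifferentiableOn ℂ φ (ball 0 1)
  injOn : InjOn φ (ball 0 1)
  image : φ '' ball 0 1 = Ω
  zero : φ 0 = 0
  subset : Ω ⊆ ball 0 1
  isOpen : IsOpen Ω
  left_inv : ∀ z ∈ ball (0 : ℂ) 1, ψ (φ z) = z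

variable {Ω : Set ℂ} {φ ψ : ℂ → ℂ} {T : H1 →L[ℂ] H1}

lemma IsCompData.ofReal_norm_sq (h : IsCompData α Ω φ ψ e1 T) (f : H1) :
    ENNReal.ofReal (‖T f‖ ^ 2) = ENNReal.ofReal (‖e1 f 0‖ ^ 2) +
      ENNReal.ofReal ((α + 1) / Real.pi) *
        ∫⁻ w in Ω, ‖deriv (e1 f) w‖ₑ ^ 2 * ENNReal.ofReal ((1 - ‖ψ w‖ ^ 2) ^ α) := by
  have hd : ∀ z ∈ ball (0 : ℂ) 1, HasDerivAt φ (deriv φ z) z := fun z hz =>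
    ((h.diff z hz).differentiableAt (isOpen_ball.mem_nhds hz)).hasDerivAt
  rw [h.space.ofReal_norm_sq h.pos (T f), h.comp f 0 (by simp), h.zero]
  congr 2
  rw [← h.image, lintegral_image_eq_of_hasDerivAt measurableSet_ball hd h.injOn]
  refine setLIntegral_congr_fun measurableSet_ball fun z hz => ?_
  beta_reduce
  have hφz : φ z ∈ ball (0 : ℂ) 1 := h.subset (h.image ▸ mem_image_of_mem _ hz)
  have h1 : deriv (e1 (T f)) z = deriv (e1 f) (φ z) * deriv φ z := by
    have h2 : e1 (T f) =ᶠ[𝓝 z] (e1 f) ∘ φ := by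
      filter_upwards [isOpen_ball.mem_nhds hz] with w hw using h.comp f w hw
    rw [h2.deriv_eq]
    exact ((h.space.differentiableAt f hφz).hasDerivAt.comp z (hd z hz)).deriv
  rw [h1, h.left_inv z hz, enorm_mul, mul_pow]
  ring

end ChangeOfVariables

section FunctionEstimates

variable {α : ℝ} {H1 : Type} [NormedAddCommGroup H1] [InnerProductSpace ℂ H1] [CompleteSpace H1]
  {e1 : H1 →ₗ[ℂ] (ℂ → ℂ)}

lemma le_ofReal_of_ofReal_mul_le {c x : ℝ} (hc : 0 < c) (hx : 0 ≤ x) {I : ℝ≥0∞}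
    (h : ENNReal.ofReal c * I ≤ ENNReal.ofReal x) : I ≤ ENNReal.ofReal (c⁻¹ * x) := by
  calc I = ENNReal.ofReal (c⁻¹ * c) * I := by rw [inv_mul_cancel₀ hc.ne']; simp
    _ = ENNReal.ofReal c⁻¹ * (ENNReal.ofReal c * I) := by
      rw [ENNReal.ofReal_mul (by positivity), mul_assoc]
    _ ≤ ENNReal.ofReal c⁻¹ * ENNReal.ofReal x := by gcongr
    _ = _ := by rw [ENNReal.ofReal_mul (by positivity)]

lemma IsHSpace.lintegral_le (hα : 0 < α)
    (h : IsHSpace (fun w => Real.sqrt (((α + 1) / Real.pi) * (1 - ‖w‖ ^ 2) ^ α)) e1) (f : H1) :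
    ∫⁻ z in ball (0 : ℂ) 1, ‖deriv (e1 f) z‖ₑ ^ 2 * ENNReal.ofReal ((1 - ‖z‖ ^ 2) ^ α) ≤
      ENNReal.ofReal (((α + 1) / Real.pi)⁻¹ * ‖f‖ ^ 2) := by
  have hpi := Real.pi_pos
  refine le_ofReal_of_ofReal_mul_le (by positivity) (by positivity) ?_
  rw [h.ofReal_norm_sq hα f]; exact le_add_self

lemma IsHSpace.norm_apply_zero_le (hα : 0 < α)
    (h : IsHSpace (fun w => Real.sqrt (((α + 1) / Real.pi) * (1 - ‖w‖ ^ 2) ^ α)) e1) (f : H1) :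
    ‖e1 f 0‖ ≤ ‖f‖ := by
  have h1 : ENNReal.ofReal (‖e1 f 0‖ ^ 2) ≤ ENNReal.ofReal (‖f‖ ^ 2) := by
    rw [h.ofReal_norm_sq hα f]; exact le_self_add
  rw [ENNReal.ofReal_le_ofReal_iff (by positivity)] at h1
  exact le_of_sq_le_sq h1 (norm_nonneg _)

lemma IsHSpace.exists_lintegral_ball_le (hα : 0 < α)
    (h : IsHSpace (fun w => Real.sqrt (((α + 1) / Real.pi) * (1 - ‖w‖ ^ 2) ^ α)) e1)
    {R : ℝ} (hR : R < 1) : ∃ C > 0, ∀ f : H1,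
      ∫⁻ z in ball (0 : ℂ) R, ‖deriv (e1 f) z‖ₑ ^ 2 ≤ ENNReal.ofReal (C * ‖f‖ ^ 2) := by
  have hpi := Real.pi_pos
  rcases le_or_gt R 0 with h0 | h0
  · exact ⟨1, one_pos, fun f => by simp [ball_eq_empty.2 h0]⟩
  have hc : 0 < (1 - R ^ 2) ^ α := Real.rpow_pos_of_pos (by nlinarith) _
  refine ⟨((1 - R ^ 2) ^ α)⁻¹ * ((α + 1) / Real.pi)⁻¹, by positivity, fun f => ?_⟩
  rw [mul_assoc]
  refine le_ofReal_of_ofReal_mul_le hc (by positivity) ?_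
  refine le_trans ?_ (h.lintegral_le hα f)
  rw [← lintegral_const_mul' _ _ ENNReal.ofReal_ne_top]
  refine (setLIntegral_mono' measurableSet_ball fun z hz => ?_).trans
    (lintegral_mono_set (ball_subset_ball hR.le))
  rw [mul_comm]
  have hz1 : ‖z‖ < R := by simpa using hz
  gcongr <;> nlinarith [norm_nonneg z]

lemma IsHSpace.exists_norm_deriv_le (hα : 0 < α)
    (h : IsHSpace (fun w => Real.sqrt (((α + 1) / Real.pi) * (1 - ‖w‖ ^ 2) ^ α)) e1)
    {R : ℝ} (hR : R < 1) : ∃ C > 0, ∀ f : H1, ∀ w : ℂ, ‖w‖ ≤ R →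
      ‖deriv (e1 f) w‖ ≤ C * ‖f‖ := by
  have hpi := Real.pi_pos
  set r := (1 - R) / 2 with hr
  have hr0 : 0 < r := by linarith
  obtain ⟨C, hC, hCf⟩ := h.exists_lintegral_ball_le hα (R := R + r) (by linarith)
  refine ⟨√((r ^ 2 * Real.pi)⁻¹ * C), by positivity, fun f w hw => ?_⟩
  have hsub : ball w r ⊆ ball 0 (R + r) := fun z hz => by
    have h1 : ‖z - w‖ < r := by simpa [dist_eq_norm] using hz
    have h2 := norm_add_le (z - w) w
    rw [sub_add_cancel] at h2
    simp only [mem_ball_zero_iff]; linarith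
  have h1 := enorm_sq_mul_volume_ball_le (h := deriv (e1 f)) (c := w) (R := r)
    ((h.differentiableOn_deriv f).mono (hsub.trans (ball_subset_ball (by linarith))))
  have h2 := h1.trans ((lintegral_mono_set hsub).trans (hCf f))
  rw [Complex.volume_ball, mul_comm, ← ofReal_norm_eq_enorm,
    ← ENNReal.ofReal_pow (norm_nonneg _)] at h2
  have h3 : ENNReal.ofReal r ^ 2 * (NNReal.pi : ℝ≥0∞) = ENNReal.ofReal (r ^ 2 * Real.pi) := by
    rw [ENNReal.ofReal_mul (by positivity), ENNReal.ofReal_pow hr0.le]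
    congr 1
    rw [← NNReal.coe_real_pi, ENNReal.ofReal_coe_nnreal]
  rw [h3] at h2
  have h4 := le_ofReal_of_ofReal_mul_le (by positivity) (by positivity) h2
  rw [ENNReal.ofReal_le_ofReal_iff (by positivity)] at h4
  refine le_of_sq_le_sq ?_ (by positivity)
  rw [mul_pow, Real.sq_sqrt (by positivity)]
  linarith

lemma IsHSpace.exists_functional (hα : 0 < α)
    (h : IsHSpace (fun w => Real.sqrt (((α + 1) / Real.pi) * (1 - ‖w‖ ^ 2) ^ α)) e1)
    (k : ℕ) {w : ℂ} (hw : w ∈ ball (0 : ℂ) 1) :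
    ∃ l : H1 →L[ℂ] ℂ, ∀ f, l f = iteratedDeriv k (deriv (e1 f)) w := by
  have hw1 : ‖w‖ < 1 := by simpa using hw
  have hcd : ∀ f, ContDiffAt ℂ k (deriv (e1 f)) w := fun f =>
    ((h.differentiableOn_deriv f).contDiffOn isOpen_ball).contDiffAt (isOpen_ball.mem_nhds hw)
  have hadd : ∀ f g, iteratedDeriv k (deriv (e1 (f + g))) w =
      iteratedDeriv k (deriv (e1 f)) w + iteratedDeriv k (deriv (e1 g)) w := fun f g => by
    have h1 : deriv (e1 (f + g)) =ᶠ[𝓝 w] deriv (e1 f) + deriv (e1 g) := by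
      filter_upwards [isOpen_ball.mem_nhds hw] with z hz
      rw [map_add]
      exact deriv_add (h.differentiableAt f hz) (h.differentiableAt g hz)
    rw [h1.iteratedDeriv_eq, iteratedDeriv_add (hcd f) (hcd g)]
  have hsmul : ∀ (c : ℂ) f, iteratedDeriv k (deriv (e1 (c • f))) w =
      c * iteratedDeriv k (deriv (e1 f)) w := fun c f => by
    have h1 : deriv (e1 (c • f)) =ᶠ[𝓝 w] c • deriv (e1 f) := by
      filter_upwards [isOpen_ball.mem_nhds hw] with z hz
      rw [map_smul]
      exact deriv_const_smul c (h.differentiableAt f hz)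
    rw [h1.iteratedDeriv_eq, iteratedDeriv_const_smul (hcd f), smul_eq_mul]
  obtain ⟨C, hC, hCf⟩ := h.exists_norm_deriv_le hα (R := (1 + ‖w‖) / 2) (by linarith)
  set r := (1 - ‖w‖) / 2 with hr
  have hr0 : 0 < r := by linarith
  have hball : ∀ z, dist z w ≤ r → ‖z‖ ≤ (1 + ‖w‖) / 2 := fun z hz => by
    rw [dist_eq_norm] at hz
    have h2 := norm_add_le (z - w) w
    rw [sub_add_cancel] at h2
    linarith
  let L : H1 →ₗ[ℂ] ℂ :=
    { toFun := fun f => iteratedDeriv k (deriv (e1 f)) w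
      map_add' := hadd
      map_smul' := hsmul }
  refine ⟨L.mkContinuous (k.factorial * C / r ^ k) fun f => ?_, fun f => rfl⟩
  have h1 : DiffContOnCl ℂ (deriv (e1 f)) (ball w r) := by
    refine DifferentiableOn.diffContOnCl ?_
    refine (h.differentiableOn_deriv f).mono fun z hz => ?_
    have := hball z (closure_ball_subset_closedBall hz)
    simp only [mem_ball_zero_iff]; linarith
  have h2 := Complex.norm_iteratedDeriv_le_of_forall_mem_sphere_norm_le k hr0 h1
    (fun z hz => hCf f z (hball z (le_of_eq hz)))
  calc ‖L f‖ ≤ _ := h2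
    _ = _ := by ring

lemma IsHSpace.isBigO_comp_exp {ω : ℂ → ℝ} (h : IsHSpace ω e1) {f : H1} {c : ℂ} (hc : 0 < c.re)
    {m : ℕ} (hm : ∀ i < m, iteratedDeriv i (deriv (e1 f)) (Complex.exp (-c)) = 0) :
    (fun z => deriv (e1 f) (Complex.exp (-z))) =O[𝓝 c] fun z => ‖z - c‖ ^ m := by
  have hmem : Complex.exp (-c) ∈ ball (0 : ℂ) 1 := by
    rw [mem_ball_zero_iff, Complex.norm_exp]
    exact Real.exp_lt_one_iff.2 (by simpa using hc)
  have h1 := isBigO_of_iteratedDeriv_eq_zero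
    ((h.differentiableOn_deriv f).analyticAt (isOpen_ball.mem_nhds hmem)) hm
  have hd : DifferentiableAt ℂ (fun z : ℂ => Complex.exp (-z)) c := by fun_prop
  refine (h1.comp_tendsto hd.continuousAt.tendsto).trans ?_
  exact (hd.isBigO_sub.norm_norm).pow m

lemma differentiableOn_comp_exp {ω : ℂ → ℝ} (h : IsHSpace ω e1) (f : H1) :
    DifferentiableOn ℂ (fun z => deriv (e1 f) (Complex.exp (-z))) {z | 0 < z.re} := by
  refine (h.differentiableOn_deriv f).comp (by fun_prop) fun z hz => ?_
  rw [mem_ball_zero_iff, Complex.norm_exp]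
  exact Real.exp_lt_one_iff.2 (by simpa using hz)

lemma exp_neg_mem_ball {z : ℂ} (hz : 0 < z.re) : Complex.exp (-z) ∈ ball (0 : ℂ) 1 := by
  rw [mem_ball_zero_iff, Complex.norm_exp]
  exact Real.exp_lt_one_iff.2 (by simpa using hz)

lemma re_le_two_mul_one_sub {z : ℂ} (hz : 0 < z.re) (hz1 : ‖z‖ < 1) :
    z.re ≤ 2 * (1 - ‖Complex.exp (-z)‖ ^ 2) := by
  have h1 : z.re ≤ 1 := (Complex.re_le_norm z).trans hz1.le
  rw [Complex.norm_exp, ← Real.exp_nat_mul]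
  have h2 := one_sub_exp_neg_ge (u := 2 * z.re) (b := 2) (by linarith) (by linarith)
  have h3 : ((2 : ℕ) : ℝ) * (-z).re = -(2 * z.re) := by push_cast; simp
  rw [h3]; linarith

lemma lintegral_comp_exp_le {s : Set ℂ} (hs : MeasurableSet s) (hs1 : s ⊆ ball 0 1)
    (g : ℂ → ℝ≥0∞) : ∫⁻ z in s, g (Complex.exp (-z)) ≤
      9 * ∫⁻ w in (fun z : ℂ => Complex.exp (-z)) '' s, g w := by
  rw [lintegral_exp_neg_image hs hs1, ← lintegral_const_mul' _ _ (by simp)]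
  refine setLIntegral_mono' hs fun z hz => ?_
  have h1 := enorm_exp_neg_sq_bounds (hs1 hz)
  calc g (Complex.exp (-z)) = 9 * ENNReal.ofReal (1 / 9) * g (Complex.exp (-z)) := by
        rw [show (9 : ℝ≥0∞) = ENNReal.ofReal 9 by simp, ← ENNReal.ofReal_mul (by norm_num)]
        norm_num
    _ ≤ 9 * ‖Complex.exp (-z)‖ₑ ^ 2 * g (Complex.exp (-z)) := by gcongr
    _ = _ := by rw [mul_assoc]

lemma IsHSpace.exists_lintegral_halfPlane_le (hα : 0 < α)
    (h : IsHSpace (fun w => Real.sqrt (((α + 1) / Real.pi) * (1 - ‖w‖ ^ 2) ^ α)) e1) :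
    ∃ C > 0, ∀ f : H1, ∫⁻ z in {z : ℂ | 0 < z.re} ∩ ball 0 1,
      ‖deriv (e1 f) (Complex.exp (-z))‖ₑ ^ 2 * ENNReal.ofReal (z.re ^ α) ≤
        ENNReal.ofReal (C * ‖f‖ ^ 2) := by
  have hpi := Real.pi_pos
  have hms : MeasurableSet ({z : ℂ | 0 < z.re} ∩ ball 0 1) :=
    (measurableSet_lt (by fun_prop) (by fun_prop)).inter measurableSet_ball
  refine ⟨2 ^ α * (9 * ((α + 1) / Real.pi)⁻¹), by positivity, fun f => ?_⟩
  calc ∫⁻ z in {z : ℂ | 0 < z.re} ∩ ball 0 1,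
      ‖deriv (e1 f) (Complex.exp (-z))‖ₑ ^ 2 * ENNReal.ofReal (z.re ^ α) ≤
      ∫⁻ z in {z : ℂ | 0 < z.re} ∩ ball 0 1, ENNReal.ofReal (2 ^ α) *
        (‖deriv (e1 f) (Complex.exp (-z))‖ₑ ^ 2 *
          ENNReal.ofReal ((1 - ‖Complex.exp (-z)‖ ^ 2) ^ α)) := by
        refine setLIntegral_mono' hms fun z hz => ?_
        rw [mul_left_comm]
        gcongr
        rw [← ENNReal.ofReal_mul (by positivity)]
        refine ENNReal.ofReal_le_ofReal ?_
        have hz0 : 0 < z.re := hz.1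
        have h1 := re_le_two_mul_one_sub hz0 (by simpa using hz.2)
        rw [← Real.mul_rpow (by norm_num) (by linarith)]
        gcongr
    _ ≤ ENNReal.ofReal (2 ^ α) * (9 * ∫⁻ w in ball (0 : ℂ) 1,
        ‖deriv (e1 f) w‖ₑ ^ 2 * ENNReal.ofReal ((1 - ‖w‖ ^ 2) ^ α)) := by
        rw [lintegral_const_mul' _ _ ENNReal.ofReal_ne_top]
        gcongr
        refine (lintegral_comp_exp_le hms inter_subset_right fun w =>
          ‖deriv (e1 f) w‖ₑ ^ 2 * ENNReal.ofReal ((1 - ‖w‖ ^ 2) ^ α)).trans ?_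
        gcongr
        rintro _ ⟨z, hz, rfl⟩
        exact exp_neg_mem_ball hz.1
    _ ≤ ENNReal.ofReal (2 ^ α) * (9 * ENNReal.ofReal (((α + 1) / Real.pi)⁻¹ * ‖f‖ ^ 2)) := by
        gcongr; exact h.lintegral_le hα f
    _ = _ := by
        rw [show (9 : ℝ≥0∞) = ENNReal.ofReal 9 by simp, ← ENNReal.ofReal_mul (by norm_num),
          ← ENNReal.ofReal_mul (by positivity)]
        congr 1; ring

variable {Ω : Set ℂ} {φ ψ : ℂ → ℂ} {T : H1 →L[ℂ] H1} {γf : ℝ → ℝ} {ρ₁ δ : ℝ}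

lemma IsCompData.exists_le_norm_sq (h : IsCompData α Ω φ ψ e1 T) :
    ∃ C > 0, ∀ s : Set ℂ, MeasurableSet s → s ⊆ ball 0 1 → (∀ z ∈ s, Complex.exp (-z) ∈ Ω) →
      ∀ f : H1, ∫⁻ z in s, ‖deriv (e1 f) (Complex.exp (-z))‖ₑ ^ 2 *
        ENNReal.ofReal ((1 - ‖ψ (Complex.exp (-z))‖ ^ 2) ^ α) ≤ ENNReal.ofReal (C * ‖T f‖ ^ 2) := by
  have hpi := Real.pi_pos
  have hα := h.pos
  refine ⟨9 * ((α + 1) / Real.pi)⁻¹, by positivity, fun s hs hs1 hsΩ f => ?_⟩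
  refine (lintegral_comp_exp_le hs hs1 fun w =>
    ‖deriv (e1 f) w‖ₑ ^ 2 * ENNReal.ofReal ((1 - ‖ψ w‖ ^ 2) ^ α)).trans ?_
  rw [mul_assoc, ENNReal.ofReal_mul (by norm_num)]
  rw [show ENNReal.ofReal 9 = 9 by simp]
  gcongr
  refine le_ofReal_of_ofReal_mul_le (by positivity) (by positivity) ?_
  rw [h.ofReal_norm_sq f]
  refine le_trans ?_ le_add_self
  gcongr
  rintro _ ⟨z, hz, rfl⟩
  exact hsΩ z hz

lemma IsCompData.exists_norm_sq_le (h : IsCompData α Ω φ ψ e1 T) (hγ : IsGauge γf)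
    (hc : IsCuspDomain γf Ω ρ₁) (hψ : IsInverseMap Ω ψ δ) :
    ∃ C > 0, ∃ ρ > 0, ρ ≤ 1 / 8 ∧ ρ < ρ₁ ∧ ∃ R < 1, ∀ f : H1, e1 f 0 = 0 →
      ENNReal.ofReal (‖T f‖ ^ 2) ≤ ENNReal.ofReal C *
        ((∫⁻ w in ball (0 : ℂ) R, ‖deriv (e1 f) w‖ₑ ^ 2) +
         ∫⁻ z in {z : ℂ | Complex.exp (-z) ∈ Ω} ∩ ball 0 ρ,
          ‖deriv (e1 f) (Complex.exp (-z))‖ₑ ^ 2 *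
            ENNReal.ofReal ((z.re * Real.exp (-Gam γf ‖z‖)) ^ α)) := by
  obtain ⟨C, hC, ρ, hρ, hρ8, hρ₁, hle⟩ := exists_one_sub_sq_le_re_mul hγ hc hψ
  obtain ⟨R, hR, hfar⟩ := hc.far ρ hρ
  have hpi := Real.pi_pos
  have hα := h.pos
  set s := {z : ℂ | Complex.exp (-z) ∈ Ω} ∩ ball 0 ρ with hs
  have hms : MeasurableSet s :=
    ((isOpen_preimage_exp_neg hc.isOpen).inter isOpen_ball).measurableSet
  have hre : ∀ z ∈ s, 0 < z.re := fun z hz => by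
    have h1 : ‖z‖ < ρ := by simpa using hz.2
    exact (hγ.comp_abs_nonneg (by linarith)).trans_lt (hc.lt_re z (by linarith) hz.1)
  refine ⟨(α + 1) / Real.pi * (1 + C ^ α), by positivity, ρ, hρ, hρ8, hρ₁, (R + 1) / 2,
    by linarith, fun f hf => ?_⟩
  set J₁ := ∫⁻ w in ball (0 : ℂ) ((R + 1) / 2), ‖deriv (e1 f) w‖ₑ ^ 2
  set J₂ := ∫⁻ z in s, ‖deriv (e1 f) (Complex.exp (-z))‖ₑ ^ 2 *
            ENNReal.ofReal ((z.re * Real.exp (-Gam γf ‖z‖)) ^ α)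
  rw [h.ofReal_norm_sq f, hf, norm_zero, ENNReal.ofReal_mul (by positivity), mul_assoc]
  simp only [ne_eq, OfNat.ofNat_ne_zero, not_false_eq_true, zero_pow, ENNReal.ofReal_zero, zero_add]
  gcongr
  have hcov : Ω ⊆ (ball 0 ((R + 1) / 2) ∩ Ω) ∪ (fun z : ℂ => Complex.exp (-z)) '' s := by
    intro w hw
    by_cases h1 : ∀ z : ℂ, ‖z‖ < ρ → Complex.exp (-z) ≠ w
    · left
      exact ⟨by simp only [mem_ball_zero_iff]; linarith [hfar w hw h1], hw⟩
    · push Not at h1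
      obtain ⟨z, hz, rfl⟩ := h1
      exact Or.inr ⟨z, ⟨hw, by simpa using hz⟩, rfl⟩
  refine (lintegral_mono_set hcov).trans ((lintegral_union_le _ _ _).trans ?_)
  have h1 : ∫⁻ w in ball (0 : ℂ) ((R + 1) / 2) ∩ Ω,
      ‖deriv (e1 f) w‖ₑ ^ 2 * ENNReal.ofReal ((1 - ‖ψ w‖ ^ 2) ^ α) ≤ J₁ := by
    refine (setLIntegral_mono' (measurableSet_ball.inter hc.isOpen.measurableSet)
      fun w hw => ?_).trans (lintegral_mono_set inter_subset_left)
    refine mul_le_of_le_one_right' (ENNReal.ofReal_le_one.2 ?_)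
    have := hψ.lt_one w hw.2
    exact Real.rpow_le_one (by nlinarith [norm_nonneg (ψ w)]) (by linarith [sq_nonneg ‖ψ w‖]) hα.le
  have h2 : ∫⁻ w in (fun z : ℂ => Complex.exp (-z)) '' s,
      ‖deriv (e1 f) w‖ₑ ^ 2 * ENNReal.ofReal ((1 - ‖ψ w‖ ^ 2) ^ α) ≤
      ENNReal.ofReal (C ^ α) * J₂ := by
    rw [lintegral_exp_neg_image hms (inter_subset_right.trans (ball_subset_ball (by linarith))),
      ← lintegral_const_mul' _ _ ENNReal.ofReal_ne_top]
    refine setLIntegral_mono' hms fun z hz => ?_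
    have h3 := hle z hz.1 (by simpa using hz.2)
    have h4 := hψ.lt_one _ hz.1
    have h5 := hre z hz
    calc ‖Complex.exp (-z)‖ₑ ^ 2 * (‖deriv (e1 f) (Complex.exp (-z))‖ₑ ^ 2 *
          ENNReal.ofReal ((1 - ‖ψ (Complex.exp (-z))‖ ^ 2) ^ α)) ≤
          1 * (‖deriv (e1 f) (Complex.exp (-z))‖ₑ ^ 2 *
          ENNReal.ofReal ((C * (z.re * Real.exp (-Gam γf ‖z‖))) ^ α)) := by
          gcongr
          · exact enorm_exp_neg_sq_le_one h5.le
          · nlinarith [norm_nonneg (ψ (Complex.exp (-z)))]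
      _ = _ := by
          rw [Real.mul_rpow hC.le (by positivity), ENNReal.ofReal_mul (by positivity)]
          ring
  calc _ ≤ J₁ + ENNReal.ofReal (C ^ α) * J₂ := add_le_add h1 h2
    _ ≤ ENNReal.ofReal (1 + C ^ α) * J₁ + ENNReal.ofReal (1 + C ^ α) * J₂ := by
        gcongr
        · refine le_mul_of_one_le_left' (ENNReal.one_le_ofReal.2 ?_)
          have : 0 < C ^ α := by positivity
          linarith
        · linarith
    _ = _ := by rw [mul_add]

end FunctionEstimates

section Boxes

variable {γf : ℝ → ℝ}

lemma IsGauge.quot_mono (h : IsGauge γf) {x y : ℝ} (hx : 0 ≤ x) (hxy : x ≤ y) (hy : y ≤ Real.pi) :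
    γf x / x ≤ γf y / y := h.mono_quot ⟨hx, hxy.trans hy⟩ ⟨hx.trans hxy, hy⟩ hxy

lemma IsGauge.quot_le_one (h : IsGauge γf) {x : ℝ} (hx : 0 ≤ x) (hxy : x ≤ Real.pi) :
    γf x / x ≤ 1 := by
  have hpi := Real.pi_gt_three
  refine (h.quot_mono hx hxy le_rfl).trans ?_
  rw [div_le_one (by linarith)]
  have := h.le_one Real.pi ⟨by linarith, le_rfl⟩
  linarith

lemma half_pow_pos (k : ℕ) : (0 : ℝ) < (1 / 2) ^ k := by positivity

lemma half_pow_le_one (k : ℕ) : (1 / 2 : ℝ) ^ k ≤ 1 := pow_le_one₀ (by norm_num) (by norm_num)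

lemma half_pow_mem (k : ℕ) : (1 / 2 : ℝ) ^ k ∈ Ioc 0 Real.pi :=
  ⟨half_pow_pos k, (half_pow_le_one k).trans one_mem_Ioc_pi.2⟩

lemma half_pow_anti {k l : ℕ} (h : k ≤ l) : (1 / 2 : ℝ) ^ l ≤ (1 / 2) ^ k :=
  pow_le_pow_of_le_one (by norm_num) (by norm_num) h

/-- The centre of the Whitney box `(2^{-l-1}, 2^{-l}] × [i 2^{-l}, (i+1) 2^{-l})`. -/
def boxCenter (b : ℕ × ℤ) : ℂ := ⟨3 / 4 * (1 / 2) ^ b.1, (b.2 + 1 / 2) * (1 / 2) ^ b.1⟩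

/-- The part of the cusp at distance about `2^{-k}` from its vertex. -/
def cuspAnnulus (Ω : Set ℂ) (ρ : ℝ) (k : ℕ) : Set ℂ :=
  {z | Complex.exp (-z) ∈ Ω ∧ ‖z‖ < ρ ∧ (1 / 2) ^ (k + 1) < ‖z‖ ∧ ‖z‖ ≤ (1 / 2) ^ k}

lemma exists_dist_boxCenter {z : ℂ} (hz : 0 < z.re) (hz1 : z.re ≤ 1) :
    ∃ b : ℕ × ℤ, (1 / 2) ^ (b.1 + 1) < z.re ∧ z.re ≤ (1 / 2) ^ b.1 ∧
      b.2 = ⌊z.im * 2 ^ b.1⌋ ∧ dist z (boxCenter b) < 14 / 25 * (1 / 2) ^ b.1 := by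
  obtain ⟨l, hl1, hl2⟩ := exists_nat_pow_near_of_lt_one hz hz1
    (by norm_num : (0 : ℝ) < 1 / 2) (by norm_num)
  refine ⟨(l, ⌊z.im * 2 ^ l⌋), hl1, hl2, rfl, ?_⟩
  set L : ℝ := (1 / 2) ^ l with hL
  have hL0 : 0 < L := half_pow_pos l
  have h2 : (2 : ℝ) ^ l * L = 1 := by rw [hL, ← mul_pow]; norm_num
  have h3 := Int.floor_le (z.im * 2 ^ l)
  have h4 := Int.lt_floor_add_one (z.im * 2 ^ l)
  set i : ℝ := (⌊z.im * 2 ^ l⌋ : ℝ) with hi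
  have h5 : i * L ≤ z.im := by
    calc i * L ≤ z.im * 2 ^ l * L := by gcongr
      _ = z.im := by rw [mul_assoc, h2, mul_one]
  have h6 : z.im ≤ (i + 1) * L := by
    calc z.im = z.im * 2 ^ l * L := by rw [mul_assoc, h2, mul_one]
      _ ≤ _ := by gcongr
  rw [pow_succ] at hl1
  rw [Complex.dist_eq_re_im]
  simp only [boxCenter]
  rw [← hi, ← hL, Real.sqrt_lt' (by positivity)]
  nlinarith

lemma norm_re_im_of_dist_boxCenter {w : ℂ} {b : ℕ × ℤ} {a : ℝ}
    (h : dist w (boxCenter b) < a * (1 / 2) ^ b.1) :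
    |w.re - 3 / 4 * (1 / 2) ^ b.1| < a * (1 / 2) ^ b.1 ∧
      |w.im - (b.2 + 1 / 2) * (1 / 2) ^ b.1| < a * (1 / 2) ^ b.1 := by
  rw [dist_eq_norm] at h
  exact ⟨(Complex.abs_re_le_norm (w - boxCenter b)).trans_lt h,
    (Complex.abs_im_le_norm (w - boxCenter b)).trans_lt h⟩

lemma IsGauge.exists_boxes {Ω : Set ℂ} {ρ₁ ρ : ℝ} (hγ : IsGauge γf) (hc : IsCuspDomain γf Ω ρ₁)
    (hρ8 : ρ ≤ 1 / 8) (hρ₁ : ρ < ρ₁) (k : ℕ) : ∃ P : Finset (ℕ × ℤ),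
      (P.card : ℝ) ≤ 24 * (γf ((1 / 2) ^ (k + 2)) / (1 / 2) ^ (k + 2))⁻¹ ∧
      ∀ z ∈ cuspAnnulus Ω ρ k, ∃ b ∈ P, (1 / 2) ^ (b.1 + 1) < z.re ∧
        dist z (boxCenter b) < 14 / 25 * (1 / 2) ^ b.1 := by
  set κ := γf ((1 / 2) ^ (k + 2)) / (1 / 2) ^ (k + 2) with hκ
  have hκ0 : 0 < κ := hγ.quot_pos (half_pow_mem _)
  have hκ1 : κ ≤ 1 := hγ.quot_le_one (half_pow_pos _).le (half_pow_mem _).2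
  have hfl : 1 ≤ ⌊4 * κ⁻¹⌋₊ := by
    rw [Nat.one_le_floor_iff]
    have := (one_le_inv₀ hκ0).2 hκ1
    linarith
  set J := Nat.log 2 ⌊4 * κ⁻¹⌋₊ + 1 with hJ
  have hJ1 : ((2 : ℝ) ^ J) ≤ 8 * κ⁻¹ := by
    have h1 : 2 ^ Nat.log 2 ⌊4 * κ⁻¹⌋₊ ≤ ⌊4 * κ⁻¹⌋₊ := Nat.pow_log_le_self 2 (by omega)
    have h2 : ((2 ^ Nat.log 2 ⌊4 * κ⁻¹⌋₊ : ℕ) : ℝ) ≤ 4 * κ⁻¹ :=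
      (Nat.cast_le.2 h1).trans (Nat.floor_le (by positivity))
    push_cast at h2
    rw [hJ, pow_succ]; linarith
  have hJ2 : ∀ j : ℕ, (2 : ℝ) ^ j ≤ 4 * κ⁻¹ → j < J := fun j hj => by
    have h1 : 2 ^ j ≤ ⌊4 * κ⁻¹⌋₊ := Nat.le_floor (by push_cast; exact hj)
    exact Nat.lt_succ_of_le (Nat.le_log_of_pow_le one_lt_two h1)
  refine ⟨(Finset.range J).biUnion fun j =>
    (Finset.Icc (-(2 ^ j : ℤ)) (2 ^ j)).image fun i => (k + j, i), ?_, fun z hz => ?_⟩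
  · have h1 : ((Finset.range J).biUnion fun j =>
        (Finset.Icc (-(2 ^ j : ℤ)) (2 ^ j)).image fun i => (k + j, i)).card ≤
        ∑ j ∈ Finset.range J, 3 * 2 ^ j := by
      refine Finset.card_biUnion_le.trans (Finset.sum_le_sum fun j _ => ?_)
      refine Finset.card_image_le.trans ?_
      rw [Int.card_Icc]
      have : (1 : ℤ) ≤ 2 ^ j := one_le_pow₀ (by norm_num)
      zify
      rw [Int.toNat_of_nonneg (by linarith)]
      linarith
    have h2 : ∑ j ∈ Finset.range J, 3 * 2 ^ j ≤ 3 * 2 ^ J := by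
      rw [← Finset.mul_sum, Nat.geomSum_eq le_rfl]
      simp
    have h3 := Nat.cast_le (α := ℝ).2 (h1.trans h2)
    push_cast at h3
    linarith
  · obtain ⟨hzΩ, hzρ, hz1, hz2⟩ := hz
    have hlt := hc.lt_re z (hzρ.trans hρ₁) hzΩ
    have hpi := Real.pi_gt_three
    have him : |z.im| ≤ ‖z‖ := Complex.abs_im_le_norm z
    have hlow : γf ((1 / 2) ^ (k + 2)) ≤ z.re := by
      rcases le_total ((1 / 2) ^ (k + 2)) |z.im| with h1 | h1
      · exact (hγ.mono ⟨(half_pow_pos _).le, (half_pow_mem _).2⟩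
          ⟨abs_nonneg _, by linarith⟩ h1).trans hlt.le
      · have h2 : 0 < z.re :=
          (hγ.nonneg ⟨abs_nonneg z.im, by linarith⟩).trans_lt hlt
        have h3 : ‖z‖ ≤ |z.re| + |z.im| := Complex.norm_le_abs_re_add_abs_im z
        rw [abs_of_pos h2] at h3
        have h4 : γf ((1 / 2) ^ (k + 2)) ≤ (1 / 2) ^ (k + 2) := by
          rwa [hκ, div_le_one (half_pow_pos _)] at hκ1
        rw [pow_add] at h1 h4 ⊢
        rw [pow_add] at hz1
        norm_num at h1 h4 hz1 ⊢
        linarith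
    have hre : 0 < z.re := (hγ.pos _ (half_pow_mem _)).trans_le hlow
    have hre1 : z.re ≤ ‖z‖ := Complex.re_le_norm z
    obtain ⟨b, hb1, hb2, hb3, hb4⟩ := exists_dist_boxCenter hre (by linarith)
    have hkb : k ≤ b.1 := by
      by_contra hcon
      have : (1 / 2 : ℝ) ^ k ≤ (1 / 2) ^ (b.1 + 1) := half_pow_anti (by omega)
      linarith
    obtain ⟨j, hj⟩ := Nat.exists_eq_add_of_le hkb
    have h2 : (2 : ℝ) ^ b.1 * (1 / 2) ^ b.1 = 1 := by rw [← mul_pow]; norm_num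
    have h2j : (2 : ℝ) ^ b.1 * (1 / 2) ^ k = 2 ^ j := by
      rw [hj, pow_add, mul_right_comm, ← mul_pow]; norm_num
    refine ⟨b, ?_, hb1, hb4⟩
    simp only [Finset.mem_biUnion, Finset.mem_range, Finset.mem_image, Finset.mem_Icc]
    refine ⟨j, hJ2 j ?_, b.2, ?_, by rw [← hj]⟩
    · have h5 : (2 : ℝ) ^ b.1 * γf ((1 / 2) ^ (k + 2)) ≤ 1 := by
        calc (2 : ℝ) ^ b.1 * γf ((1 / 2) ^ (k + 2)) ≤ 2 ^ b.1 * (1 / 2) ^ b.1 := by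
              gcongr; exact hlow.trans hb2
          _ = 1 := h2
      rw [← hγ.mul_quot, ← hκ] at h5
      have h6 : (2 : ℝ) ^ b.1 * ((1 / 2) ^ (k + 2) * κ) = 2 ^ j * κ / 4 := by
        rw [← h2j, pow_add]; ring
      rw [h6] at h5
      rw [← div_eq_mul_inv, le_div_iff₀ hκ0]
      linarith
    · have h7 := abs_le.1 (him.trans hz2)
      have h8 : z.im * 2 ^ b.1 ≤ 2 ^ j := by
        rw [← h2j, mul_comm]; gcongr; exact h7.2
      have h9 : -(2 ^ j) ≤ z.im * 2 ^ b.1 := by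
        rw [← h2j, mul_comm z.im, ← mul_neg]; gcongr; exact h7.1
      rw [hb3]
      constructor
      · rw [Int.le_floor]; push_cast; exact h9
      · have := (Int.floor_le (z.im * 2 ^ b.1)).trans h8
        exact_mod_cast this

lemma sum_setLIntegral_le {ι κ : Type*} [Fintype κ] [DecidableEq κ] {E : Type*} [MeasurableSpace E]
    {μ : Measure E} (B : Finset ι) (D : ι → Set E) {S : Set E} (hD : ∀ b ∈ B, MeasurableSet (D b))
    (hS : ∀ b ∈ B, D b ⊆ S) (col : ι → κ)
    (hcol : ∀ a ∈ B, ∀ b ∈ B, col a = col b → a ≠ b → Disjoint (D a) (D b)) (F : E → ℝ≥0∞) :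
    ∑ b ∈ B, ∫⁻ z in D b, F z ∂μ ≤ Fintype.card κ * ∫⁻ z in S, F z ∂μ := by
  rw [← Finset.sum_fiberwise B col]
  calc _ ≤ ∑ _c : κ, ∫⁻ z in S, F z ∂μ := by
        refine Finset.sum_le_sum fun c _ => ?_
        rw [← lintegral_biUnion_finset]
        · exact lintegral_mono_set (iUnion₂_subset fun b hb => hS b (Finset.mem_filter.1 hb).1)
        · intro a ha b hb hab
          simp only [Finset.coe_filter, mem_setOf_eq] at ha hb
          exact hcol a ha.1 b hb.1 (ha.2.trans hb.2.symm) hab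
        · exact fun b hb => hD b (Finset.mem_filter.1 hb).1
    _ = _ := by rw [Finset.sum_const, Finset.card_univ, nsmul_eq_mul]

end Boxes

section BoxEstimate

variable {γf : ℝ → ℝ} {Ω : Set ℂ} {ρ₁ ρ α : ℝ}

lemma lintegral_biUnion_finset_le {ι E : Type*} [MeasurableSpace E] {μ : Measure E}
    (B : Finset ι) (s : ι → Set E) (F : E → ℝ≥0∞) :
    ∫⁻ z in ⋃ b ∈ B, s b, F z ∂μ ≤ ∑ b ∈ B, ∫⁻ z in s b, F z ∂μ := by
  classical
  induction B using Finset.induction_on with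
  | empty => simp
  | insert a t ha ih =>
    rw [Finset.set_biUnion_insert, Finset.sum_insert ha]
    exact (lintegral_union_le _ _ _).trans (by gcongr)

lemma measurableSet_cuspAnnulus (hΩ : IsOpen Ω) (k : ℕ) :
    MeasurableSet (cuspAnnulus Ω ρ k) := by
  have h1 : cuspAnnulus Ω ρ k = ({z : ℂ | Complex.exp (-z) ∈ Ω} ∩ ball 0 ρ) ∩
      norm ⁻¹' Ioc ((1 / 2) ^ (k + 1)) ((1 / 2) ^ k) := by
    ext z; simp [cuspAnnulus, and_assoc]
  rw [h1]
  exact ((isOpen_preimage_exp_neg hΩ).inter isOpen_ball).measurableSet.inter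
    (measurable_norm measurableSet_Ioc)

lemma lintegral_box_le {H : ℂ → ℂ} (hH : DifferentiableOn ℂ H {z | 0 < z.re}) {b : ℕ × ℤ} {m : ℕ}
    (hm : m ≠ 0) (hO : H =O[𝓝 (boxCenter b)] fun z => ‖z - boxCenter b‖ ^ m) (hα : 0 < α) :
    ENNReal.ofReal ((131 / 100 * (1 / 2) ^ b.1) ^ α) *
      ∫⁻ z in ball (boxCenter b) (14 / 25 * (1 / 2) ^ b.1), ‖H z‖ₑ ^ 2 ≤
    ENNReal.ofReal (27 ^ α * (64 * (8 / 9) ^ (2 * m))) *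
      ∫⁻ z in ball (boxCenter b) (7 / 10 * (1 / 2) ^ b.1), ‖H z‖ₑ ^ 2 * ENNReal.ofReal (z.re ^ α) := by
  set L : ℝ := (1 / 2) ^ b.1 with hL
  have hL0 : 0 < L := half_pow_pos _
  have hrad : 14 / 25 * L + 2 * (7 / 100 * L) = 7 / 10 * L := by ring
  have hre : ∀ z ∈ ball (boxCenter b) (7 / 10 * L), 1 / 20 * L ≤ z.re := fun z hz => by
    have := (abs_lt.1 (norm_re_im_of_dist_boxCenter (mem_ball.1 hz)).1).1
    rw [← hL] at this; linarith
  have h1 := lintegral_enorm_sq_ball_le_of_isBigO (h := H) (c := boxCenter b)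
    (r := 14 / 25 * L) (ρ := 7 / 100 * L) (by positivity) (by positivity)
    (hH.mono fun z hz => by
      rw [hrad] at hz
      have := hre z hz
      simp only [mem_setOf_eq]; linarith) hm hO
  rw [hrad, show 14 / 25 * L / (7 / 100 * L) = 8 by field_simp; norm_num,
    show 14 / 25 * L / (14 / 25 * L + 7 / 100 * L) = 8 / 9 by field_simp; norm_num] at h1
  norm_num1 at h1
  calc _ ≤ ENNReal.ofReal ((131 / 100 * L) ^ α) * (ENNReal.ofReal (64 * (8 / 9) ^ (2 * m)) *
        ∫⁻ z in ball (boxCenter b) (7 / 10 * L), ‖H z‖ₑ ^ 2) := by gcongr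
    _ ≤ ENNReal.ofReal (27 ^ α * (1 / 20 * L) ^ α) * (ENNReal.ofReal (64 * (8 / 9) ^ (2 * m)) *
        ∫⁻ z in ball (boxCenter b) (7 / 10 * L), ‖H z‖ₑ ^ 2) := by
        gcongr
        rw [← Real.mul_rpow (by norm_num) (by positivity)]
        gcongr 1
        linarith
    _ = ENNReal.ofReal (27 ^ α * (64 * (8 / 9) ^ (2 * m))) *
        ∫⁻ z in ball (boxCenter b) (7 / 10 * L),
          ENNReal.ofReal ((1 / 20 * L) ^ α) * ‖H z‖ₑ ^ 2 := by
        rw [lintegral_const_mul' _ _ ENNReal.ofReal_ne_top,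
          ENNReal.ofReal_mul (p := 27 ^ α) (q := (1 / 20 * L) ^ α) (by positivity),
          ENNReal.ofReal_mul (p := 27 ^ α) (q := 64 * (8 / 9) ^ (2 * m)) (by positivity)]
        ring
    _ ≤ _ := by
        refine mul_le_mul' le_rfl ?_
        refine setLIntegral_mono' measurableSet_ball fun z hz => ?_
        rw [mul_comm]
        gcongr
        exact hre z hz

/-- The colour of a box; enlarged boxes of the same colour are disjoint. -/
def boxColour (x : Σ _ : ℕ, ℕ × ℤ) : ZMod 8 × ZMod 5 × ZMod 2 := (x.1, x.2.1, x.2.2)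

lemma disjoint_of_modEq {A : ℕ → Set ℂ} {a b N : ℕ} (hab : (a : ZMod N) = b) (hne : a ≠ b)
    (h : ∀ k l, k + N ≤ l → Disjoint (A k) (A l)) : Disjoint (A a) (A b) := by
  rw [ZMod.natCast_eq_natCast_iff] at hab
  rcases lt_or_gt_of_ne hne with h1 | h1
  · refine h a b ?_
    have := Nat.le_of_dvd (by omega) ((Nat.modEq_iff_dvd' h1.le).1 hab)
    omega
  · refine (h b a ?_).symm
    have := Nat.le_of_dvd (by omega) ((Nat.modEq_iff_dvd' h1.le).1 hab.symm)
    omega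

lemma disjoint_enlarged_boxes {x y : Σ _ : ℕ, ℕ × ℤ} (hxy : x ≠ y) (hc : boxColour x = boxColour y)
    (h : ∀ u : Σ _ : ℕ, ℕ × ℤ, u = x ∨ u = y →
      ball (boxCenter u.2) (7 / 10 * (1 / 2) ^ u.2.1) ⊆
        {w : ℂ | (1 / 2) ^ (u.1 + 6) < ‖w‖ ∧ ‖w‖ < 4 * (1 / 2) ^ u.1}) :
    Disjoint (ball (boxCenter x.2) (7 / 10 * (1 / 2) ^ x.2.1))
      (ball (boxCenter y.2) (7 / 10 * (1 / 2) ^ y.2.1)) := by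
  obtain ⟨k, l, i⟩ := x
  obtain ⟨k', l', i'⟩ := y
  simp only [boxColour, Prod.mk.injEq] at hc
  obtain ⟨hc1, hc2, hc3⟩ := hc
  by_cases hk : k = k'
  · by_cases hl : l = l'
    · subst hk hl
      have hi : i ≠ i' := fun h => hxy (by rw [h])
      rw [Set.disjoint_left]
      intro w hw1 hw2
      have h1 := (norm_re_im_of_dist_boxCenter (mem_ball.1 hw1)).2
      have h2 := (norm_re_im_of_dist_boxCenter (mem_ball.1 hw2)).2
      simp only at h1 h2
      have h3 : (2 : ℤ) ∣ i' - i := by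
        have := (ZMod.intCast_eq_intCast_iff i i' 2).1 hc3
        exact_mod_cast this.dvd
      have h4 : (2 : ℤ) ≤ |i' - i| := by
        refine Int.le_of_dvd (abs_pos.2 (sub_ne_zero.2 hi.symm)) ((dvd_abs _ _).2 h3)
      have h5 : (2 : ℝ) ≤ |(i' : ℝ) - i| := by exact_mod_cast h4
      have hL0 : (0 : ℝ) < (1 / 2) ^ l := half_pow_pos l
      have h6 : |(i' : ℝ) - i| * (1 / 2) ^ l ≤
          |w.im - (i + 1 / 2) * (1 / 2) ^ l| + |w.im - (i' + 1 / 2) * (1 / 2) ^ l| := by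
        rw [← abs_of_pos hL0, ← abs_mul, abs_of_pos hL0]
        have := abs_sub (w.im - (i + 1 / 2) * (1 / 2) ^ l) (w.im - (i' + 1 / 2) * (1 / 2) ^ l)
        refine le_trans (le_of_eq ?_) this
        congr 1; ring
      nlinarith
    · refine (disjoint_of_modEq (A := fun l => {w : ℂ | 1 / 20 * (1 / 2) ^ l < w.re ∧
        w.re < 29 / 20 * (1 / 2) ^ l}) hc2 hl fun a b hab => ?_).mono ?_ ?_
      · rw [Set.disjoint_left]
        intro w hw1 hw2
        have h1 := half_pow_anti hab
        rw [pow_add] at h1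
        have h2 := half_pow_pos a
        have := hw1.1; have := hw2.2
        norm_num at h1; linarith
      all_goals
        intro w hw
        have h1 := abs_lt.1 (norm_re_im_of_dist_boxCenter (mem_ball.1 hw)).1
        simp only at h1
        constructor <;> linarith
  · refine (disjoint_of_modEq (A := fun k => {w : ℂ | (1 / 2) ^ (k + 6) < ‖w‖ ∧
      ‖w‖ < 4 * (1 / 2) ^ k}) hc1 hk fun a b hab => ?_).mono (h _ (Or.inl rfl)) (h _ (Or.inr rfl))
    rw [Set.disjoint_left]
    intro w hw1 hw2
    have h1 := half_pow_anti hab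
    rw [pow_add] at h1
    have h2 := hw1.1
    have h3 := hw2.2
    rw [pow_add] at h2
    norm_num at h1 h2 h3; linarith

lemma enlarged_box_subset {k : ℕ} {z w : ℂ} {b : ℕ × ℤ} (hz : 0 < z.re) (hz8 : ‖z‖ < 1 / 8)
    (hz1 : (1 / 2) ^ (k + 1) < ‖z‖) (hz2 : ‖z‖ ≤ (1 / 2) ^ k) (hzb : (1 / 2) ^ (b.1 + 1) < z.re)
    (hzd : dist z (boxCenter b) < 14 / 25 * (1 / 2) ^ b.1)
    (hw : w ∈ ball (boxCenter b) (7 / 10 * (1 / 2) ^ b.1)) :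
    (1 / 2) ^ (k + 6) < ‖w‖ ∧ ‖w‖ < 4 * (1 / 2) ^ k ∧ 0 < w.re ∧ ‖w‖ < 1 := by
  have hL0 := half_pow_pos b.1
  have hk0 := half_pow_pos k
  have h1 := (abs_lt.1 (norm_re_im_of_dist_boxCenter (mem_ball.1 hw)).1).1
  have h2 : dist w z < 63 / 50 * (1 / 2) ^ b.1 := by
    have := dist_triangle_right w z (boxCenter b)
    rw [mem_ball] at hw
    linarith
  rw [dist_eq_norm] at h2
  have h3 := norm_sub_norm_le z w
  have h4 := norm_sub_norm_le w z
  rw [norm_sub_rev] at h3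
  have h5 := Complex.re_le_norm z
  have h6 := Complex.re_le_norm w
  have hlow : (1 / 2) ^ (k + 6) < ‖w‖ := by
    rcases le_or_gt b.1 (k + 1) with hb | hb
    · have := half_pow_anti hb
      rw [pow_add] at this ⊢
      norm_num at this h1 ⊢
      linarith
    · have := half_pow_anti (show k + 2 ≤ b.1 by omega)
      rw [pow_add] at this hz1 ⊢
      norm_num at this h2 hz1 ⊢
      linarith
  rw [pow_succ] at hzb
  refine ⟨hlow, ?_, ?_, ?_⟩ <;> linarith

lemma IsGauge.lintegral_near_le (hγ : IsGauge γf) (hc : IsCuspDomain γf Ω ρ₁)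
    (hρ8 : ρ ≤ 1 / 8) (hρ₁ : ρ < ρ₁) (hα : 0 < α) {P : ℕ → Finset (ℕ × ℤ)}
    (hP : ∀ k, ∀ z ∈ cuspAnnulus Ω ρ k, ∃ b ∈ P k, (1 / 2) ^ (b.1 + 1) < z.re ∧
        dist z (boxCenter b) < 14 / 25 * (1 / 2) ^ b.1)
    {n : ℕ} {m : ℕ → ℕ} (hm0 : ∀ k, m k ≠ 0) {K : ℝ} (hK : 0 < K)
    (hm : ∀ k < n, (8 / 9) ^ (2 * m k) * Real.exp (-(α * Gam γf ((1 / 2) ^ k))) ≤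
      K * Real.exp (-(α * Gam γf ((1 / 2) ^ n))))
    {H : ℂ → ℂ} (hH : DifferentiableOn ℂ H {z | 0 < z.re})
    (hO : ∀ k < n, ∀ b ∈ P k, H =O[𝓝 (boxCenter b)] fun z => ‖z - boxCenter b‖ ^ m k) :
    ∫⁻ z in {z : ℂ | Complex.exp (-z) ∈ Ω} ∩ ball 0 ρ,
        ‖H z‖ₑ ^ 2 * ENNReal.ofReal ((z.re * Real.exp (-Gam γf ‖z‖)) ^ α) ≤
      ENNReal.ofReal ((1 + 27 ^ α * 64 * 80 * K) * Real.exp (-(α * Gam γf ((1 / 2) ^ n)))) *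
        ∫⁻ z in {z : ℂ | 0 < z.re} ∩ ball 0 1, ‖H z‖ₑ ^ 2 * ENNReal.ofReal (z.re ^ α) := by
  classical
  set S := {z : ℂ | Complex.exp (-z) ∈ Ω} ∩ ball 0 ρ with hS
  set G : ℂ → ℝ≥0∞ := fun z =>
    ‖H z‖ₑ ^ 2 * ENNReal.ofReal ((z.re * Real.exp (-Gam γf ‖z‖)) ^ α) with hG
  set I := ∫⁻ z in {z : ℂ | 0 < z.re} ∩ ball 0 1, ‖H z‖ₑ ^ 2 * ENNReal.ofReal (z.re ^ α) with hI
  have hpi := Real.pi_gt_three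
  have hSm : MeasurableSet S :=
    ((isOpen_preimage_exp_neg hc.isOpen).inter isOpen_ball).measurableSet
  have hSre : ∀ z ∈ S, 0 < z.re ∧ ‖z‖ < 1 / 8 := fun z hz => by
    have h1 : ‖z‖ < ρ := by simpa using hz.2
    exact ⟨(hγ.comp_abs_nonneg (by linarith)).trans_lt (hc.lt_re z (by linarith) hz.1),
      by linarith⟩
  have hweight : ∀ z ∈ S, ∀ k, ‖z‖ ≤ (1 / 2) ^ k → (z.re * Real.exp (-Gam γf ‖z‖)) ^ α ≤
      Real.exp (-(α * Gam γf ((1 / 2) ^ k))) * z.re ^ α := fun z hz k hzk => by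
    have h1 := (hSre z hz).1
    have h2 : 0 < ‖z‖ := h1.trans_le (Complex.re_le_norm z)
    have h3 := hγ.Gam_anti h2 hzk (half_pow_mem k).2
    rw [Real.mul_rpow h1.le (Real.exp_pos _).le, ← Real.exp_mul, mul_comm]
    refine mul_le_mul_of_nonneg_right (Real.exp_le_exp.2 ?_) (by positivity)
    nlinarith
  set B := ((Finset.range n).sigma P).filter fun x => (cuspAnnulus Ω ρ x.1 ∩
    {z | (1 / 2) ^ (x.2.1 + 1) < z.re} ∩
    ball (boxCenter x.2) (14 / 25 * (1 / 2) ^ x.2.1)).Nonempty with hB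
  have hBmem : ∀ x ∈ B, x.1 < n ∧ x.2 ∈ P x.1 ∧
      ∀ w ∈ ball (boxCenter x.2) (7 / 10 * (1 / 2) ^ x.2.1), (1 / 2) ^ (x.1 + 6) < ‖w‖ ∧
        ‖w‖ < 4 * (1 / 2) ^ x.1 ∧ 0 < w.re ∧ ‖w‖ < 1 := fun x hx => by
    simp only [hB, Finset.mem_filter, Finset.mem_sigma, Finset.mem_range] at hx
    obtain ⟨⟨h1, h2⟩, z, ⟨⟨hz1, hz2, hz3, hz4⟩, hz5⟩, hz6⟩ := hx
    have h3 := hSre z ⟨hz1, by simpa using hz2⟩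
    exact ⟨h1, h2, fun w hw => enlarged_box_subset h3.1 h3.2 hz3 hz4 hz5 (mem_ball.1 hz6) hw⟩
  have hcov : S ⊆ (S ∩ {z | ‖z‖ ≤ (1 / 2) ^ n}) ∪ ⋃ x ∈ B, cuspAnnulus Ω ρ x.1 ∩
      ball (boxCenter x.2) (14 / 25 * (1 / 2) ^ x.2.1) := by
    intro z hz
    have h1 := hSre z hz
    have hz0 : 0 < ‖z‖ := h1.1.trans_le (Complex.re_le_norm z)
    rcases le_or_gt ‖z‖ ((1 / 2) ^ n) with h2 | h2
    · exact Or.inl ⟨hz, h2⟩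
    right
    obtain ⟨k, hk1, hk2⟩ := exists_nat_pow_near_of_lt_one hz0 (by linarith)
      (by norm_num : (0 : ℝ) < 1 / 2) (by norm_num)
    have hkn : k < n := by
      by_contra hcon
      have := half_pow_anti (not_lt.1 hcon)
      linarith
    have hzk : z ∈ cuspAnnulus Ω ρ k := ⟨hz.1, by simpa using hz.2, hk1, hk2⟩
    obtain ⟨b, hb, hb1, hb2⟩ := hP k z hzk
    simp only [mem_iUnion]
    refine ⟨⟨k, b⟩, ?_, hzk, mem_ball.2 hb2⟩
    simp only [hB, Finset.mem_filter, Finset.mem_sigma, Finset.mem_range]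
    exact ⟨⟨hkn, hb⟩, z, ⟨hzk, hb1⟩, mem_ball.2 hb2⟩
  have htail : ∫⁻ z in S ∩ {z | ‖z‖ ≤ (1 / 2) ^ n}, G z ≤
      ENNReal.ofReal (Real.exp (-(α * Gam γf ((1 / 2) ^ n)))) * I := by
    rw [hI, ← lintegral_const_mul' _ _ ENNReal.ofReal_ne_top]
    refine (setLIntegral_mono' (hSm.inter (measurableSet_le measurable_norm measurable_const))
      fun z hz => ?_).trans (lintegral_mono_set fun z hz => ?_)
    · calc ‖H z‖ₑ ^ 2 * ENNReal.ofReal ((z.re * Real.exp (-Gam γf ‖z‖)) ^ α) ≤ ‖H z‖ₑ ^ 2 * ENNReal.ofReal (Real.exp (-(α * Gam γf ((1 / 2) ^ n))) * z.re ^ α) := by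
            gcongr; exact hweight z hz.1 n hz.2
        _ = _ := by rw [ENNReal.ofReal_mul (Real.exp_pos _).le]; ring
    · have := hSre z hz.1
      exact ⟨this.1, by rw [mem_ball_zero_iff]; linarith⟩
  have hbox : ∀ x ∈ B, ∫⁻ z in cuspAnnulus Ω ρ x.1 ∩
      ball (boxCenter x.2) (14 / 25 * (1 / 2) ^ x.2.1), G z ≤
      ENNReal.ofReal (27 ^ α * 64 * K * Real.exp (-(α * Gam γf ((1 / 2) ^ n)))) *
        ∫⁻ z in ball (boxCenter x.2) (7 / 10 * (1 / 2) ^ x.2.1),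
          ‖H z‖ₑ ^ 2 * ENNReal.ofReal (z.re ^ α) := fun x hx => by
    obtain ⟨h1, h2, -⟩ := hBmem x hx
    calc _ ≤ ∫⁻ z in cuspAnnulus Ω ρ x.1 ∩ ball (boxCenter x.2) (14 / 25 * (1 / 2) ^ x.2.1),
          ENNReal.ofReal (Real.exp (-(α * Gam γf ((1 / 2) ^ x.1))) *
            (131 / 100 * (1 / 2) ^ x.2.1) ^ α) * ‖H z‖ₑ ^ 2 := by
          refine setLIntegral_mono' ((measurableSet_cuspAnnulus hc.isOpen _).inter
            measurableSet_ball) fun z hz => ?_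
          obtain ⟨⟨hz1, hz2, hz3, hz4⟩, hz5⟩ := hz
          have hzS : z ∈ S := ⟨hz1, by simpa using hz2⟩
          simp only [hG]
          rw [mul_comm]
          gcongr
          refine (hweight z hzS _ hz4).trans ?_
          have h3 := abs_lt.1 (norm_re_im_of_dist_boxCenter (mem_ball.1 hz5)).1
          have h4 := (hSre z hzS).1
          gcongr
          linarith
      _ ≤ ENNReal.ofReal (Real.exp (-(α * Gam γf ((1 / 2) ^ x.1)))) *
          (ENNReal.ofReal ((131 / 100 * (1 / 2) ^ x.2.1) ^ α) *
          ∫⁻ z in ball (boxCenter x.2) (14 / 25 * (1 / 2) ^ x.2.1), ‖H z‖ₑ ^ 2) := by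
          rw [lintegral_const_mul' _ _ ENNReal.ofReal_ne_top, ENNReal.ofReal_mul (by positivity),
            mul_assoc]
          gcongr
          exact inter_subset_right
      _ ≤ ENNReal.ofReal (Real.exp (-(α * Gam γf ((1 / 2) ^ x.1)))) *
          (ENNReal.ofReal (27 ^ α * (64 * (8 / 9) ^ (2 * m x.1))) *
          ∫⁻ z in ball (boxCenter x.2) (7 / 10 * (1 / 2) ^ x.2.1),
            ‖H z‖ₑ ^ 2 * ENNReal.ofReal (z.re ^ α)) := by
          refine mul_le_mul' le_rfl ?_
          exact lintegral_box_le hH (hm0 _) (hO _ h1 _ h2) hα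
      _ ≤ _ := by
          rw [← mul_assoc, ← ENNReal.ofReal_mul (Real.exp_pos _).le]
          gcongr ?_ * _
          refine ENNReal.ofReal_le_ofReal ?_
          have h5 := mul_le_mul_of_nonneg_left (hm _ h1)
            (show (0 : ℝ) ≤ 27 ^ α * 64 by positivity)
          calc _ = 27 ^ α * 64 * ((8 / 9) ^ (2 * m x.1) *
                Real.exp (-(α * Gam γf ((1 / 2) ^ x.1)))) := by ring
            _ ≤ _ := h5
            _ = _ := by ring
  have hsum : ∑ x ∈ B, ∫⁻ z in ball (boxCenter x.2) (7 / 10 * (1 / 2) ^ x.2.1),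
      ‖H z‖ₑ ^ 2 * ENNReal.ofReal (z.re ^ α) ≤ 80 * I := by
    have h1 := sum_setLIntegral_le (μ := volume) B
      (fun x => ball (boxCenter x.2) (7 / 10 * (1 / 2) ^ x.2.1))
      (S := {z : ℂ | 0 < z.re} ∩ ball 0 1) (fun _ _ => measurableSet_ball)
      (fun x hx w hw => ⟨((hBmem x hx).2.2 w hw).2.2.1,
        by rw [mem_ball_zero_iff]; exact ((hBmem x hx).2.2 w hw).2.2.2⟩) boxColour
      (fun x hx y hy hxy hne => disjoint_enlarged_boxes hne hxy fun u hu => by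
        intro w hw
        have hub : u ∈ B := by rcases hu with rfl | rfl <;> assumption
        have := (hBmem u hub).2.2 w hw
        exact ⟨this.1, this.2.1⟩)
      fun z => ‖H z‖ₑ ^ 2 * ENNReal.ofReal (z.re ^ α)
    refine h1.trans (le_of_eq ?_)
    rw [hI]
    congr 1
  calc _ ≤ _ := lintegral_mono_set hcov
    _ ≤ _ := lintegral_union_le _ _ _
    _ ≤ ENNReal.ofReal (Real.exp (-(α * Gam γf ((1 / 2) ^ n)))) * I +
        ∑ x ∈ B, ENNReal.ofReal (27 ^ α * 64 * K * Real.exp (-(α * Gam γf ((1 / 2) ^ n)))) *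
        ∫⁻ z in ball (boxCenter x.2) (7 / 10 * (1 / 2) ^ x.2.1),
          ‖H z‖ₑ ^ 2 * ENNReal.ofReal (z.re ^ α) :=
        add_le_add htail ((lintegral_biUnion_finset_le _ _ _).trans (Finset.sum_le_sum hbox))
    _ ≤ ENNReal.ofReal (Real.exp (-(α * Gam γf ((1 / 2) ^ n)))) * I +
        ENNReal.ofReal (27 ^ α * 64 * K * Real.exp (-(α * Gam γf ((1 / 2) ^ n)))) * (80 * I) := by
        rw [← Finset.mul_sum]
        gcongr
    _ = _ := by
        rw [show (80 : ℝ≥0∞) = ENNReal.ofReal 80 by simp, ← mul_assoc,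
          ← ENNReal.ofReal_mul (by positivity), ← add_mul,
          ← ENNReal.ofReal_add (by positivity) (by positivity)]
        congr 2
        ring

end BoxEstimate

section UpperBound

variable {α : ℝ} {H1 : Type} [NormedAddCommGroup H1] [InnerProductSpace ℂ H1] [CompleteSpace H1]
  {e1 : H1 →ₗ[ℂ] (ℂ → ℂ)}

lemma IsHSpace.approxNum_le_of_conditions (hα : 0 < α)
    (h : IsHSpace (fun w => Real.sqrt (((α + 1) / Real.pi) * (1 - ‖w‖ ^ 2) ^ α)) e1)
    (T : H1 →L[ℂ] H1) {I : Finset (ℂ × ℕ)} (hI : ∀ p ∈ I, p.1 ∈ ball (0 : ℂ) 1) {n : ℕ}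
    (hn : I.card + 1 ≤ n) {c : ℝ} (hc : 0 ≤ c)
    (hT : ∀ f : H1, e1 f 0 = 0 → (∀ p ∈ I, iteratedDeriv p.2 (deriv (e1 f)) p.1 = 0) →
      ‖T f‖ ≤ c * ‖f‖) : approxNum T n ≤ c := by
  have hex : ∀ p : I, ∃ l : H1 →L[ℂ] ℂ, ∀ f, l f = iteratedDeriv p.1.2 (deriv (e1 f)) p.1.1 :=
    fun p => h.exists_functional hα _ (hI p.1 p.2)
  choose L hL using hex
  let l₀ : H1 →L[ℂ] ℂ := LinearMap.mkContinuous ((LinearMap.proj 0).comp e1) 1 fun f => by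
    simpa using h.norm_apply_zero_le hα f
  refine approxNum_le_of_functionals T (ι := Option I) (by simpa using hn)
    (fun o => o.elim l₀ L) hc fun f hf => hT f ?_ fun p hp => ?_
  · simpa [l₀] using hf none
  · have := hf (some ⟨p, hp⟩)
    rwa [Option.elim_some, hL] at this

variable {Ω : Set ℂ} {φ ψ : ℂ → ℂ} {T : H1 →L[ℂ] H1} {γf : ℝ → ℝ} {ρ₁ δ : ℝ}

lemma IsGauge.Gam_half_pow_le (hγ : IsGauge γf) (k : ℕ) : Gam γf ((1 / 2) ^ k) ≤ k := by
  have h1 := hγ.Gam_sub_le (half_pow_pos k) (half_pow_le_one k) one_mem_Ioc_pi.2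
  have h2 := hγ.le_one 1 one_mem_Ioc_pi
  have hpi := Real.pi_gt_three
  have h3 : Real.log (1 / (1 / 2) ^ k) = k * Real.log 2 := by
    rw [one_div, ← inv_pow, Real.log_pow]; norm_num
  have h4 := Real.log_two_lt_d9
  have h5 : 0 < Real.log 2 := Real.log_pos one_lt_two
  rw [Gam_one, h3, div_one] at h1
  have h6 : 2 / Real.pi ≤ 1 := by rw [div_le_one (by linarith)]; linarith
  have h7 := (hγ.pos 1 one_mem_Ioc_pi).le
  calc Gam γf ((1 / 2) ^ k) ≤ 2 / Real.pi * (γf 1 * (k * Real.log 2)) := by linarith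
    _ ≤ 1 * (1 * (k * 1)) := by gcongr; linarith
    _ = k := by ring

/-- The order of vanishing imposed on the boxes of scale `2^{-k}`. -/
def vanishOrder (γf : ℝ → ℝ) (α : ℝ) (n k : ℕ) : ℕ :=
  1 + ⌈5 * α * (γf ((1 / 2) ^ (k + 2)) / (1 / 2) ^ (k + 2)) * ((n : ℝ) - k)⌉₊

lemma IsGauge.pow_vanishOrder_le (hγ : IsGauge γf) (hα : 0 < α) {n k : ℕ} (hk : k < n) :
    (8 / 9) ^ (2 * vanishOrder γf α n k) * Real.exp (-(α * Gam γf ((1 / 2) ^ k))) ≤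
      4 ^ α * Real.exp (-(α * Gam γf ((1 / 2) ^ n))) := by
  set κ := γf ((1 / 2) ^ (k + 2)) / (1 / 2) ^ (k + 2) with hκ
  have hκ0 : 0 < κ := hγ.quot_pos (half_pow_mem _)
  have hkn : (k : ℝ) < n := by exact_mod_cast hk
  have hΓ : Gam γf ((1 / 2) ^ n) - Gam γf ((1 / 2) ^ (k + 2)) ≤ κ * (n - k) := by
    rcases le_total (k + 2) n with h1 | h1
    · have h2 := hγ.Gam_sub_le (half_pow_pos n) (half_pow_anti h1) (half_pow_mem _).2
      obtain ⟨j, rfl⟩ := Nat.exists_eq_add_of_le h1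
      have h3 : Real.log ((1 / 2) ^ (k + 2) / (1 / 2) ^ (k + 2 + j)) = j * Real.log 2 := by
        rw [pow_add _ (k + 2) j, div_mul_cancel_left₀ (half_pow_pos _).ne', ← inv_pow,
          Real.log_pow]
        norm_num
      rw [h3, ← hκ] at h2
      have hpi := Real.pi_gt_three
      have h6 : 2 / Real.pi ≤ 1 := by rw [div_le_one (by linarith)]; linarith
      have h4 := Real.log_two_lt_d9
      have h5 : 0 < Real.log 2 := Real.log_pos one_lt_two
      refine h2.trans ?_
      calc _ ≤ 1 * (κ * (j * 1)) := by gcongr; linarith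
        _ ≤ κ * ((k + 2 + j : ℕ) - k) := by push_cast; nlinarith
    · have h2 := hγ.Gam_anti (half_pow_pos (k + 2)) (half_pow_anti h1) (half_pow_mem _).2
      nlinarith
  have h1 : (8 / 9 : ℝ) ^ 2 ≤ Real.exp (-(1 / 5)) := by
    have := Real.add_one_le_exp (-(1 / 5) : ℝ)
    norm_num at this ⊢; linarith
  have h2 : (8 / 9 : ℝ) ^ (2 * vanishOrder γf α n k) ≤
      Real.exp (-(α * (Gam γf ((1 / 2) ^ n) - Gam γf ((1 / 2) ^ (k + 2))))) := by
    rw [pow_mul]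
    calc _ ≤ Real.exp (-(1 / 5)) ^ vanishOrder γf α n k := by gcongr
      _ = Real.exp (-(1 / 5 * vanishOrder γf α n k)) := by rw [← Real.exp_nat_mul]; ring_nf
      _ ≤ _ := by
        rw [Real.exp_le_exp, neg_le_neg_iff]
        have h3 : 5 * α * κ * ((n : ℝ) - k) ≤ vanishOrder γf α n k := by
          have := Nat.le_ceil (5 * α * κ * ((n : ℝ) - k))
          rw [vanishOrder, ← hκ]; push_cast; linarith
        nlinarith
  have h3 := hγ.exp_neg_Gam_le (half_pow_pos (k + 2)) (half_pow_anti (show k ≤ k + 2 by omega))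
    (half_pow_mem _).2
  have h4 : (1 / 2 : ℝ) ^ k / (1 / 2) ^ (k + 2) = 4 := by
    rw [pow_add, div_mul_cancel_left₀ (half_pow_pos _).ne']; norm_num
  rw [h4] at h3
  have h5 : Real.exp (-(α * Gam γf ((1 / 2) ^ k))) ≤
      4 ^ α * Real.exp (-(α * Gam γf ((1 / 2) ^ (k + 2)))) := by
    have h6 := Real.rpow_le_rpow (Real.exp_pos _).le h3 hα.le
    rw [Real.mul_rpow (by norm_num) (Real.exp_pos _).le, ← Real.exp_mul, ← Real.exp_mul] at h6
    convert h6 using 3 <;> ring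
  calc _ ≤ Real.exp (-(α * (Gam γf ((1 / 2) ^ n) - Gam γf ((1 / 2) ^ (k + 2))))) *
        (4 ^ α * Real.exp (-(α * Gam γf ((1 / 2) ^ (k + 2))))) := by gcongr
    _ = 4 ^ α * (Real.exp (-(α * (Gam γf ((1 / 2) ^ n) - Gam γf ((1 / 2) ^ (k + 2))))) *
        Real.exp (-(α * Gam γf ((1 / 2) ^ (k + 2))))) := by ring
    _ = _ := by rw [← Real.exp_add]; ring_nf

lemma IsHSpace.exists_lintegral_ball_le_of_vanish (hα : 0 < α)
    (h : IsHSpace (fun w => Real.sqrt (((α + 1) / Real.pi) * (1 - ‖w‖ ^ 2) ^ α)) e1)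
    {R : ℝ} (hR : R < 1) : ∃ C > 0, ∃ N : ℕ, ∀ k : ℕ, ∀ f : H1,
      (∀ i < N * k + 1, iteratedDeriv i (deriv (e1 f)) 0 = 0) →
      ∫⁻ w in ball (0 : ℂ) R, ‖deriv (e1 f) w‖ₑ ^ 2 ≤
        ENNReal.ofReal (C * Real.exp (-(α * k)) * ‖f‖ ^ 2) := by
  set r := max R (1 / 2) with hr
  have hr0 : 0 < r := lt_of_lt_of_le (by norm_num) (le_max_right _ _)
  have hr1 : r < 1 := max_lt hR (by norm_num)
  set s := (1 - r) / 3 with hs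
  have hs0 : 0 < s := by linarith
  obtain ⟨C, hC, hCf⟩ := h.exists_lintegral_ball_le hα (R := r + 2 * s) (by linarith)
  set q := r / (r + s) with hq
  have hq0 : 0 < q := by positivity
  have hq1 : q < 1 := by rw [hq, div_lt_one (by positivity)]; linarith
  obtain ⟨N, hN⟩ := exists_pow_lt_of_lt_one (Real.exp_pos (-α))
    (pow_lt_one₀ hq0.le hq1 two_ne_zero)
  refine ⟨(r / s) ^ 2 * C, by positivity, N, fun k f hf => ?_⟩
  have h1 := isBigO_of_iteratedDeriv_eq_zero
    ((h.differentiableOn_deriv f).analyticAt (isOpen_ball.mem_nhds (mem_ball_self one_pos))) hf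
  have h2 := lintegral_enorm_sq_ball_le_of_isBigO hr0 hs0 ((h.differentiableOn_deriv f).mono
    (ball_subset_ball (by linarith))) (Nat.succ_ne_zero _) h1
  have h3 : q ^ (2 * (N * k + 1)) ≤ Real.exp (-(α * k)) := by
    calc q ^ (2 * (N * k + 1)) ≤ q ^ (2 * (N * k)) :=
          pow_le_pow_of_le_one hq0.le hq1.le (by omega)
      _ = ((q ^ 2) ^ N) ^ k := by rw [← pow_mul, ← pow_mul]
      _ ≤ Real.exp (-α) ^ k := by gcongr
      _ = _ := by rw [← Real.exp_nat_mul]; ring_nf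
  calc _ ≤ ∫⁻ w in ball (0 : ℂ) r, ‖deriv (e1 f) w‖ₑ ^ 2 :=
        lintegral_mono_set (ball_subset_ball (le_max_left _ _))
    _ ≤ _ := h2
    _ ≤ ENNReal.ofReal ((r / s) ^ 2 * Real.exp (-(α * k))) * ENNReal.ofReal (C * ‖f‖ ^ 2) := by
        refine mul_le_mul' (ENNReal.ofReal_le_ofReal ?_) (hCf f)
        exact mul_le_mul_of_nonneg_left h3 (by positivity)
    _ = _ := by
        rw [← ENNReal.ofReal_mul (by positivity)]
        congr 1; ring

lemma IsCompData.exists_approxNum_le (h : IsCompData α Ω φ ψ e1 T) (hγ : IsGauge γf)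
    (hc : IsCuspDomain γf Ω ρ₁) (hψ : IsInverseMap Ω ψ δ) :
    ∃ C > 0, ∀ k₁ : ℕ, 1 ≤ k₁ → ∀ n : ℕ,
      C * ((k₁ : ℝ) ^ 2 + ∑ k ∈ Finset.range k₁,
        (γf ((1 / 2) ^ (k + 2)) / (1 / 2) ^ (k + 2))⁻¹) ≤ n →
      approxNum T n ≤ C * Real.exp (-(α / 2) * Gam γf ((1 / 2) ^ k₁)) := by
  classical
  have hα := h.pos
  obtain ⟨C₁, hC₁, ρ, hρ, hρ8, hρ₁, R, hR, hTf⟩ := h.exists_norm_sq_le hγ hc hψ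
  obtain ⟨C₂, hC₂, N, hball⟩ := h.space.exists_lintegral_ball_le_of_vanish hα hR
  obtain ⟨C₃, hC₃, hhalf⟩ := h.space.exists_lintegral_halfPlane_le hα
  choose P hPcard hP using hγ.exists_boxes hc hρ8 hρ₁
  set A := C₁ * (C₂ + (1 + 27 ^ α * 64 * 80 * 4 ^ α) * C₃) with hA
  have hA0 : 0 < A := by positivity
  refine ⟨√A + (50 + N + 120 * α), by positivity, fun k₁ hk₁ n hn => ?_⟩
  set E := Real.exp (-(α / 2) * Gam γf ((1 / 2) ^ k₁)) with hE
  have hE2 : Real.exp (-(α * Gam γf ((1 / 2) ^ k₁))) = E ^ 2 := by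
    rw [hE, ← Real.exp_nat_mul]; congr 1; push_cast; ring
  refine le_trans ?_ (mul_le_mul_of_nonneg_right (show √A ≤ √A + (50 + N + 120 * α) by
    linarith [show (0 : ℝ) ≤ 50 + N + 120 * α by positivity]) (Real.exp_pos _).le)
  set m := vanishOrder γf α k₁ with hm
  set I : Finset (ℂ × ℕ) := ({0} ×ˢ Finset.range (N * k₁ + 1)) ∪
    ((Finset.range k₁).sigma P).biUnion fun x =>
      {Complex.exp (-(boxCenter x.2))} ×ˢ Finset.range (m x.1) with hI
  refine h.space.approxNum_le_of_conditions hα T (I := I) ?_ ?_ (by positivity)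
    fun f hf0 hf => ?_
  · intro p hp
    simp only [hI, Finset.mem_union, Finset.mem_product, Finset.mem_singleton,
      Finset.mem_biUnion] at hp
    rcases hp with ⟨h1, -⟩ | ⟨x, -, h1, -⟩
    · rw [h1]; exact mem_ball_self one_pos
    · rw [h1]
      refine exp_neg_mem_ball ?_
      have := half_pow_pos x.2.1
      simp only [boxCenter]; linarith
  · have h1 : I.card ≤ (N * k₁ + 1) + ∑ k ∈ Finset.range k₁, (P k).card * m k := by
      refine (Finset.card_union_le _ _).trans (add_le_add (by simp) ?_)
      refine Finset.card_biUnion_le.trans (le_of_eq ?_)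
      rw [Finset.sum_sigma]
      simp
    have h2 : ∀ k ∈ Finset.range k₁, ((P k).card : ℝ) * m k ≤
        48 * (γf ((1 / 2) ^ (k + 2)) / (1 / 2) ^ (k + 2))⁻¹ + 120 * α * k₁ := fun k hk => by
      have hk' : (k : ℝ) < k₁ := by exact_mod_cast Finset.mem_range.1 hk
      have h3 := hPcard k
      set κ := γf ((1 / 2) ^ (k + 2)) / (1 / 2) ^ (k + 2) with hκ
      have hκ0 : 0 < κ := hγ.quot_pos (half_pow_mem _)
      have h4 : (m k : ℝ) ≤ 2 + 5 * α * κ * k₁ := by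
        have h5 := Nat.ceil_lt_add_one (a := 5 * α * κ * ((k₁ : ℝ) - k))
          (mul_nonneg (by positivity) (by linarith))
        rw [hm, vanishOrder, ← hκ]; push_cast
        have h6 : 0 ≤ 5 * α * κ * k := by positivity
        linarith
      calc ((P k).card : ℝ) * m k ≤ (24 * κ⁻¹) * (2 + 5 * α * κ * k₁) := by gcongr
        _ = 48 * κ⁻¹ + 120 * α * k₁ * (κ⁻¹ * κ) := by ring
        _ = _ := by rw [inv_mul_cancel₀ hκ0.ne', mul_one]
    have h3 := Finset.sum_le_sum h2
    rw [Finset.sum_add_distrib, ← Finset.mul_sum, Finset.sum_const, Finset.card_range,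
      nsmul_eq_mul] at h3
    have h4 := Nat.cast_le (α := ℝ).2 h1
    push_cast at h4
    have hS : 0 ≤ ∑ k ∈ Finset.range k₁, (γf ((1 / 2) ^ (k + 2)) / (1 / 2) ^ (k + 2))⁻¹ :=
      Finset.sum_nonneg fun k _ => (inv_pos.2 (hγ.quot_pos (half_pow_mem _))).le
    set S := ∑ k ∈ Finset.range k₁, (γf ((1 / 2) ^ (k + 2)) / (1 / 2) ^ (k + 2))⁻¹
    have hk1 : (1 : ℝ) ≤ k₁ := by exact_mod_cast hk₁
    have h5 : (I.card : ℝ) + 1 ≤ n := by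
      refine le_trans ?_ hn
      have h6 : 0 ≤ √A := Real.sqrt_nonneg _
      have h7 : (k₁ : ℝ) ≤ k₁ ^ 2 := by nlinarith
      have h8 : (N : ℝ) * k₁ ≤ N * k₁ ^ 2 := by gcongr
      have h9 : 0 ≤ √A * (k₁ ^ 2 + S) := by positivity
      have h10 : 0 ≤ (N + 120 * α) * S := by positivity
      nlinarith
    exact_mod_cast h5
  · have hzero : ∀ i < N * k₁ + 1, iteratedDeriv i (deriv (e1 f)) 0 = 0 := fun i hi =>
      hf (0, i) (by simp only [hI, Finset.mem_union, Finset.mem_product, Finset.mem_singleton,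
        Finset.mem_range, true_and]; exact Or.inl hi)
    have h1 := hball k₁ f hzero
    have h2 := hγ.lintegral_near_le hc hρ8 hρ₁ hα hP (n := k₁) (m := m) (K := 4 ^ α)
      (fun k => by rw [hm, vanishOrder]; omega) (by positivity)
      (fun k hk => hγ.pow_vanishOrder_le hα hk) (differentiableOn_comp_exp h.space f)
      (fun k hk b hb => h.space.isBigO_comp_exp
        (by have := half_pow_pos b.1; simp only [boxCenter]; linarith) fun i hi =>
        hf (Complex.exp (-(boxCenter b)), i) (by
          simp only [hI, Finset.mem_union, Finset.mem_biUnion, Finset.mem_product,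
            Finset.mem_singleton, Finset.mem_range, Finset.mem_sigma]
          exact Or.inr ⟨⟨k, b⟩, ⟨hk, hb⟩, rfl, hi⟩))
    have h3 := h2.trans (mul_le_mul' le_rfl (hhalf f))
    rw [hE2, ← ENNReal.ofReal_mul (by positivity)] at h3
    have h4 : Real.exp (-(α * k₁)) ≤ E ^ 2 := by
      rw [← hE2, Real.exp_le_exp, neg_le_neg_iff]
      exact mul_le_mul_of_nonneg_left (hγ.Gam_half_pow_le k₁) hα.le
    have h5 : ENNReal.ofReal (‖T f‖ ^ 2) ≤ ENNReal.ofReal (A * E ^ 2 * ‖f‖ ^ 2) := by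
      refine (hTf f hf0).trans ((mul_le_mul' le_rfl (add_le_add h1 h3)).trans ?_)
      rw [← ENNReal.ofReal_add (by positivity) (by positivity),
        ← ENNReal.ofReal_mul (by positivity)]
      refine ENNReal.ofReal_le_ofReal ?_
      calc _ ≤ C₁ * (C₂ * E ^ 2 * ‖f‖ ^ 2 +
            (1 + 27 ^ α * 64 * 80 * 4 ^ α) * E ^ 2 * (C₃ * ‖f‖ ^ 2)) := by gcongr
        _ = _ := by rw [hA]; ring
    rw [ENNReal.ofReal_le_ofReal_iff (by positivity)] at h5
    refine le_of_sq_le_sq ?_ (by positivity)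
    rw [mul_pow, mul_pow, Real.sq_sqrt hA0.le]
    exact h5

end UpperBound

section TestFunctions

variable {α : ℝ} {H1 : Type} [NormedAddCommGroup H1] [InnerProductSpace ℂ H1] [CompleteSpace H1]
  {e1 : H1 →ₗ[ℂ] (ℂ → ℂ)}

lemma integral_one_add_norm_rpow_comp {δ : ℝ} (hδ : 0 < δ) (r : ℝ) (p : ℂ) :
    ∫ w : ℂ, (1 + ‖δ⁻¹ • (w - p)‖) ^ (-r) = δ ^ 2 * ∫ w : ℂ, (1 + ‖w‖) ^ (-r) := by
  rw [integral_sub_right_eq_self (fun w : ℂ => (1 + ‖δ⁻¹ • w‖) ^ (-r)) p,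
    Measure.integral_comp_inv_smul volume (fun w : ℂ => (1 + ‖w‖) ^ (-r)) δ,
    Complex.finrank_real_complex, abs_of_nonneg (by positivity), smul_eq_mul]

lemma integrable_one_add_norm_rpow_comp {δ r : ℝ} (hδ : 0 < δ) (hr : 2 < r) (p : ℂ) :
    Integrable (fun w : ℂ => (1 + ‖δ⁻¹ • (w - p)‖) ^ (-r)) := by
  have h1 : Integrable (fun w : ℂ => (1 + ‖w‖) ^ (-r)) :=
    integrable_one_add_norm (by rw [Complex.finrank_real_complex]; exact_mod_cast hr)
  have h2 := h1.comp_smul (R := δ⁻¹) (by positivity)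
  exact h2.comp_sub_right p

lemma one_sub_norm_le_norm_one_sub_mul {c w : ℂ} (hc : ‖c‖ < 1) (hw : ‖w‖ < 1) :
    1 - ‖c‖ ≤ ‖1 - starRingEnd ℂ c * w‖ ∧ 1 - ‖w‖ ≤ ‖1 - starRingEnd ℂ c * w‖ := by
  have h1 : 1 - ‖c‖ * ‖w‖ ≤ ‖1 - starRingEnd ℂ c * w‖ := by
    have := norm_sub_norm_le (1 : ℂ) (starRingEnd ℂ c * w)
    rwa [norm_one, norm_mul, RCLike.norm_conj] at this
  have h2 := norm_nonneg c
  have h3 := norm_nonneg w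
  constructor <;> nlinarith

lemma norm_inv_pow_sq_mul_le {c w : ℂ} (hα : 0 < α) {N : ℕ} (hN : α < 2 * N)
    (hc : 1 / 2 ≤ ‖c‖) (hc1 : ‖c‖ < 1) (hw : ‖w‖ < 1) :
    ‖((1 - starRingEnd ℂ c * w) ^ N)⁻¹‖ ^ 2 * (1 - ‖w‖ ^ 2) ^ α ≤
      2 ^ α * 3 ^ (2 * N - α) * (1 - ‖c‖) ^ (α - 2 * N) *
        (1 + ‖(1 - ‖c‖)⁻¹ • (w - (starRingEnd ℂ c)⁻¹)‖) ^ (-(2 * N - α)) := by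
  obtain ⟨h1, h2⟩ := one_sub_norm_le_norm_one_sub_mul hc1 hw
  have hδ : 0 < 1 - ‖c‖ := by linarith
  have hc0 : starRingEnd ℂ c ≠ 0 := by
    rw [← norm_ne_zero_iff, RCLike.norm_conj]; linarith
  have h3 : ‖w - (starRingEnd ℂ c)⁻¹‖ ≤ 2 * ‖1 - starRingEnd ℂ c * w‖ := by
    have e : 1 - starRingEnd ℂ c * w = - (starRingEnd ℂ c * (w - (starRingEnd ℂ c)⁻¹)) := by
      field_simp; ring
    rw [e, norm_neg, norm_mul, RCLike.norm_conj]
    nlinarith [norm_nonneg (w - (starRingEnd ℂ c)⁻¹)]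
  set X := ‖1 - starRingEnd ℂ c * w‖ with hX
  set Y := ‖w - (starRingEnd ℂ c)⁻¹‖ with hY
  have hY0 : 0 ≤ Y := norm_nonneg _
  have hX0 : 0 < X := by linarith
  have h4 : (1 - ‖w‖ ^ 2) ^ α ≤ (2 * X) ^ α := by
    refine Real.rpow_le_rpow ?_ ?_ hα.le <;> nlinarith [norm_nonneg w]
  have h5 : ‖((1 - starRingEnd ℂ c * w) ^ N)⁻¹‖ ^ 2 = X ^ (-(2 * N : ℝ)) := by
    rw [norm_inv, norm_pow, inv_pow, ← pow_mul, Real.rpow_neg hX0.le, mul_comm N 2]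
    congr 1
    rw [← Real.rpow_natCast]
    push_cast; rfl
  have h6 : (1 - ‖c‖) ^ (α - 2 * N) * (1 + ‖(1 - ‖c‖)⁻¹ • (w - (starRingEnd ℂ c)⁻¹)‖) ^
      (-(2 * N - α)) = (1 - ‖c‖ + Y) ^ (-(2 * N - α)) := by
    rw [norm_smul, Real.norm_of_nonneg (by positivity), ← hY,
      show α - 2 * N = -(2 * N - α) by ring, ← Real.mul_rpow hδ.le (by positivity)]
    congr 1
    field_simp
  rw [mul_assoc, h6, h5]
  calc X ^ (-(2 * N : ℝ)) * (1 - ‖w‖ ^ 2) ^ α ≤ X ^ (-(2 * N : ℝ)) * (2 * X) ^ α := by gcongr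
    _ = 2 ^ α * 3 ^ (2 * N - α) * (3 * X) ^ (-(2 * N - α)) := by
        rw [Real.mul_rpow (by norm_num) hX0.le, Real.mul_rpow (by norm_num) hX0.le,
          show -(2 * N - α) = -(2 * N) + α by ring, Real.rpow_add hX0,
          show -(2 * N : ℝ) + α = -(2 * N - α) by ring, Real.rpow_neg (by norm_num) (2 * N - α)]
        have : (3 : ℝ) ^ (2 * N - α) ≠ 0 := by positivity
        field_simp
    _ ≤ _ := by
        refine mul_le_mul_of_nonneg_left ?_ (by positivity)
        exact Real.rpow_le_rpow_of_nonpos (by positivity) (by linarith) (by linarith)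

lemma exists_lintegral_testFunction_le (hα : 0 < α) {N : ℕ} (hN : α + 2 < 2 * N) :
    ∃ C > 0, ∀ c : ℂ, 1 / 2 ≤ ‖c‖ → ‖c‖ < 1 →
      ∫⁻ w in ball (0 : ℂ) 1, ‖((1 - starRingEnd ℂ c * w) ^ N)⁻¹‖ₑ ^ 2 *
        ENNReal.ofReal ((1 - ‖w‖ ^ 2) ^ α) ≤ ENNReal.ofReal (C * (1 - ‖c‖) ^ (2 + α - 2 * N)) := by
  set K := ∫ w : ℂ, (1 + ‖w‖) ^ (-(2 * N - α)) with hK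
  have hK0 : 0 ≤ K := integral_nonneg fun w => by positivity
  refine ⟨2 ^ α * 3 ^ (2 * N - α) * (K + 1), by positivity, fun c hc hc1 => ?_⟩
  have hδ : 0 < 1 - ‖c‖ := by linarith
  have hint := integrable_one_add_norm_rpow_comp (r := 2 * N - α) hδ (by linarith)
    (starRingEnd ℂ c)⁻¹
  calc ∫⁻ w in ball (0 : ℂ) 1, ‖((1 - starRingEnd ℂ c * w) ^ N)⁻¹‖ₑ ^ 2 *
        ENNReal.ofReal ((1 - ‖w‖ ^ 2) ^ α)
      ≤ ∫⁻ w in ball (0 : ℂ) 1, ENNReal.ofReal (2 ^ α * 3 ^ (2 * N - α) *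
          (1 - ‖c‖) ^ (α - 2 * N) *
          (1 + ‖(1 - ‖c‖)⁻¹ • (w - (starRingEnd ℂ c)⁻¹)‖) ^ (-(2 * N - α))) := by
        refine setLIntegral_mono' measurableSet_ball fun w hw => ?_
        rw [← ofReal_norm_sq_mul]
        exact ENNReal.ofReal_le_ofReal
          (norm_inv_pow_sq_mul_le hα (by linarith) hc hc1 (by simpa using hw))
    _ ≤ ∫⁻ w, ENNReal.ofReal (2 ^ α * 3 ^ (2 * N - α) * (1 - ‖c‖) ^ (α - 2 * N) *
          (1 + ‖(1 - ‖c‖)⁻¹ • (w - (starRingEnd ℂ c)⁻¹)‖) ^ (-(2 * N - α))) :=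
        setLIntegral_le_lintegral _ _
    _ = ENNReal.ofReal (∫ w, 2 ^ α * 3 ^ (2 * N - α) * (1 - ‖c‖) ^ (α - 2 * N) *
          (1 + ‖(1 - ‖c‖)⁻¹ • (w - (starRingEnd ℂ c)⁻¹)‖) ^ (-(2 * N - α))) :=
        (ofReal_integral_eq_lintegral_ofReal (hint.const_mul _)
          (Eventually.of_forall fun w => by positivity)).symm
    _ ≤ _ := by
        rw [integral_const_mul, integral_one_add_norm_rpow_comp hδ, ← hK]
        refine ENNReal.ofReal_le_ofReal ?_
        rw [show 2 + α - 2 * N = (α - 2 * N) + (2 : ℕ) by push_cast; ring, Real.rpow_add hδ,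
          Real.rpow_natCast]
        have : 0 < (1 - ‖c‖) ^ (α - 2 * N) * (1 - ‖c‖) ^ 2 := by positivity
        have h2 : (0 : ℝ) < 2 ^ α * 3 ^ (2 * N - α) := by positivity
        nlinarith [mul_pos h2 this]

lemma hasDerivAt_testFunction {c : ℂ} (hc : c ≠ 0) (m : ℕ) {w : ℂ} (hw : 1 - c * w ≠ 0) :
    HasDerivAt (fun w => (((1 - c * w) ^ (m + 1))⁻¹ - 1) / (c * (m + 1)))
      ((1 - c * w) ^ (m + 2))⁻¹ w := by
  have h1 : HasDerivAt (fun w => 1 - c * w) (-c) w := by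
    simpa using ((hasDerivAt_id w).const_mul c).const_sub 1
  have h2 := (((h1.pow (m + 1)).fun_inv (pow_ne_zero _ hw)).sub_const 1).div_const (c * (m + 1))
  refine h2.congr_deriv ?_
  have h3 : (m + 1 : ℂ) ≠ 0 := Nat.cast_add_one_ne_zero m
  simp only [Nat.add_sub_cancel, Pi.pow_apply]
  push_cast
  field_simp
  ring

/-- The functions `w ↦ (1 - \bar c w)^{-(N-1)}`, suitably normalised, have norm comparable to
that of the reproducing kernels. -/
lemma IsHSpace.exists_testFunction (hα : 0 < α)
    (h : IsHSpace (fun w => Real.sqrt (((α + 1) / Real.pi) * (1 - ‖w‖ ^ 2) ^ α)) e1) :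
    ∃ C > 0, ∃ N : ℕ, ∀ c : ℂ, 1 / 2 ≤ ‖c‖ → ‖c‖ < 1 → ∃ f : H1,
      (∀ w ∈ ball (0 : ℂ) 1, deriv (e1 f) w = ((1 - starRingEnd ℂ c * w) ^ N)⁻¹) ∧
      ‖f‖ ^ 2 ≤ C * (1 - ‖c‖) ^ (2 + α - 2 * N) := by
  have hpi := Real.pi_pos
  set m := ⌈α⌉₊ with hm
  have hm1 : α ≤ m := Nat.le_ceil α
  obtain ⟨C, hC, hCb⟩ := exists_lintegral_testFunction_le hα (N := m + 2) (by push_cast; linarith)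
  refine ⟨(α + 1) / Real.pi * C, by positivity, m + 2, fun c hc hc1 => ?_⟩
  have hδ : 0 < 1 - ‖c‖ := by linarith
  have hc0 : starRingEnd ℂ c ≠ 0 := by
    rw [← norm_ne_zero_iff, RCLike.norm_conj]; linarith
  set g : ℂ → ℂ := fun w =>
    (((1 - starRingEnd ℂ c * w) ^ (m + 1))⁻¹ - 1) / (starRingEnd ℂ c * (m + 1)) with hg
  have hgd : ∀ w ∈ ball (0 : ℂ) 1,
      HasDerivAt g ((1 - starRingEnd ℂ c * w) ^ (m + 2))⁻¹ w := fun w hw => by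
    refine hasDerivAt_testFunction hc0 m ?_
    have := (one_sub_norm_le_norm_one_sub_mul hc1 (w := w) (by simpa using hw)).1
    rw [← norm_pos_iff]; linarith
  have hint : ∫⁻ w in ball (0 : ℂ) 1, ‖deriv g w‖ₑ ^ 2 * ENNReal.ofReal ((1 - ‖w‖ ^ 2) ^ α) ≤
      ENNReal.ofReal (C * (1 - ‖c‖) ^ (2 + α - 2 * (m + 2 : ℕ))) := by
    refine le_trans (le_of_eq ?_) (hCb c hc hc1)
    refine setLIntegral_congr_fun measurableSet_ball fun w hw => ?_
    simp only [(hgd w hw).deriv]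
  obtain ⟨f, hf⟩ := h.surj g (fun w hw => (hgd w hw).differentiableAt.differentiableWithinAt) (by
    have e : ∫⁻ z in ball (0 : ℂ) 1, ENNReal.ofReal (‖deriv g z‖ ^ 2 *
        Real.sqrt (((α + 1) / Real.pi) * (1 - ‖z‖ ^ 2) ^ α) ^ 2) =
        ∫⁻ z in ball (0 : ℂ) 1, ENNReal.ofReal ((α + 1) / Real.pi) *
        (‖deriv g z‖ₑ ^ 2 * ENNReal.ofReal ((1 - ‖z‖ ^ 2) ^ α)) := by
      refine setLIntegral_congr_fun measurableSet_ball fun z hz => ?_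
      rw [weight_sq hα hz, ofReal_norm_sq_mul, ENNReal.ofReal_mul (by positivity)]
      ring
    rw [e, lintegral_const_mul' _ _ ENNReal.ofReal_ne_top]
    exact ENNReal.mul_lt_top ENNReal.ofReal_lt_top (hint.trans_lt ENNReal.ofReal_lt_top))
  have hfd : ∀ w ∈ ball (0 : ℂ) 1, deriv (e1 f) w = deriv g w := fun w hw => by
    refine EventuallyEq.deriv_eq ?_
    filter_upwards [isOpen_ball.mem_nhds hw] with z hz using hf z hz
  refine ⟨f, fun w hw => by rw [hfd w hw, (hgd w hw).deriv], ?_⟩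
  have h0 : e1 f 0 = 0 := by rw [hf 0 (by simp)]; simp [hg]
  rw [← ENNReal.ofReal_le_ofReal_iff (by positivity), h.ofReal_norm_sq hα f, h0, mul_assoc,
    ENNReal.ofReal_mul (p := (α + 1) / Real.pi) (by positivity)]
  simp only [norm_zero, ne_eq, OfNat.ofNat_ne_zero, not_false_eq_true, zero_pow,
    ENNReal.ofReal_zero, zero_add]
  gcongr
  refine le_trans (le_of_eq ?_) hint
  refine setLIntegral_congr_fun measurableSet_ball fun w hw => ?_
  simp only [hfd w hw]

end TestFunctions

section LowerBound

variable {α : ℝ} {H1 : Type} [NormedAddCommGroup H1] [InnerProductSpace ℂ H1] [CompleteSpace H1]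
  {e1 : H1 →ₗ[ℂ] (ℂ → ℂ)} {Ω : Set ℂ} {φ ψ : ℂ → ℂ} {T : H1 →L[ℂ] H1}

lemma ofReal_le_setLIntegral_ball {h : ℂ → ℂ} {c : ℂ} {R m : ℝ} {W : ℂ → ℝ}
    (hh : DifferentiableOn ℂ h (ball c R)) (hR : 0 ≤ R) (hm : 0 ≤ m)
    (hW : ∀ z ∈ ball c R, m ≤ W z) :
    ENNReal.ofReal (Real.pi * R ^ 2 * m * ‖h c‖ ^ 2) ≤
      ∫⁻ z in ball c R, ‖h z‖ₑ ^ 2 * ENNReal.ofReal (W z) := by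
  have hpi := Real.pi_pos
  calc ENNReal.ofReal (Real.pi * R ^ 2 * m * ‖h c‖ ^ 2)
      = ‖h c‖ₑ ^ 2 * volume (ball c R) * ENNReal.ofReal m := by
        rw [Complex.volume_ball, show Real.pi * R ^ 2 * m * ‖h c‖ ^ 2 =
          ‖h c‖ ^ 2 * (R ^ 2 * Real.pi * m) by ring, ofReal_norm_sq_mul,
          ENNReal.ofReal_mul (by positivity), ENNReal.ofReal_mul (by positivity),
          ENNReal.ofReal_pow hR, ← mul_assoc]
        congr 3
        rw [← NNReal.coe_real_pi, ENNReal.ofReal_coe_nnreal]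
    _ ≤ (∫⁻ z in ball c R, ‖h z‖ₑ ^ 2) * ENNReal.ofReal m := by
        gcongr; exact enorm_sq_mul_volume_ball_le hh
    _ = ∫⁻ z in ball c R, ‖h z‖ₑ ^ 2 * ENNReal.ofReal m :=
        (lintegral_mul_const' _ _ ENNReal.ofReal_ne_top).symm
    _ ≤ _ := setLIntegral_mono' measurableSet_ball fun z hz =>
        mul_le_mul' le_rfl (ENNReal.ofReal_le_ofReal (hW z hz))

/-- Lower bound for the norm of the evaluation of the derivative. -/
lemma IsHSpace.exists_le_norm_functional (hα : 0 < α)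
    (h : IsHSpace (fun w => Real.sqrt (((α + 1) / Real.pi) * (1 - ‖w‖ ^ 2) ^ α)) e1) :
    ∃ c > 0, ∀ z : ℂ, 0 < z.re → z.re ≤ 1 / 2 → ∀ l : H1 →L[ℂ] ℂ,
      (∀ f, l f = deriv (e1 f) (Complex.exp (-z))) → c ≤ z.re ^ (2 + α) * ‖l‖ ^ 2 := by
  obtain ⟨C, hC, N, hf⟩ := h.exists_testFunction hα
  refine ⟨(4 ^ N * C)⁻¹, by positivity, fun z hz hz1 l hl => ?_⟩
  set c := Complex.exp (-z) with hc
  have hcn : ‖c‖ = Real.exp (-z.re) := by rw [hc, Complex.norm_exp, Complex.neg_re]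
  have hc1 : ‖c‖ < 1 := by rw [hcn, ← Real.exp_zero]; exact Real.exp_lt_exp.2 (by linarith)
  have hcs : 1 - z.re ≤ ‖c‖ := by
    rw [hcn]; linarith [Real.add_one_le_exp (-z.re)]
  obtain ⟨f, hfd, hfn⟩ := hf c (by linarith) hc1
  set δ := 1 - ‖c‖ with hδ
  have hδ0 : 0 < δ := by linarith
  have h1 : ‖l f‖ ^ 2 = ((1 - ‖c‖ ^ 2) ^ (2 * N))⁻¹ := by
    rw [hl, hfd c (by simpa using hc1), mul_comm (starRingEnd ℂ c), Complex.mul_conj,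
      norm_inv, norm_pow, inv_pow, ← pow_mul, mul_comm N 2, pow_mul, pow_mul, Complex.normSq_eq_norm_sq]
    congr 2
    rw [← Complex.ofReal_one, ← Complex.ofReal_sub, Complex.norm_real, Real.norm_eq_abs, sq_abs]
  have h2 : 1 - ‖c‖ ^ 2 ≤ 2 * δ := by nlinarith [norm_nonneg c]
  have h20 : 0 < 1 - ‖c‖ ^ 2 := by nlinarith [norm_nonneg c]
  have h3 : (4 ^ N * δ ^ (2 * N))⁻¹ ≤ ‖l f‖ ^ 2 := by
    rw [h1, show (4 : ℝ) ^ N * δ ^ (2 * N) = (2 * δ) ^ (2 * N) by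
      rw [mul_pow, pow_mul 2 2 N]; norm_num]
    gcongr
  have h4 : ‖l f‖ ^ 2 ≤ ‖l‖ ^ 2 * (C * δ ^ (2 + α - 2 * N)) := by
    calc ‖l f‖ ^ 2 ≤ (‖l‖ * ‖f‖) ^ 2 := by gcongr; exact l.le_opNorm f
      _ = ‖l‖ ^ 2 * ‖f‖ ^ 2 := by ring
      _ ≤ _ := by gcongr
  have h5 : δ ^ (2 + α - 2 * N) = δ ^ (2 + α) * (δ ^ (2 * N))⁻¹ := by
    rw [sub_eq_add_neg, Real.rpow_add hδ0, Real.rpow_neg hδ0.le, ← Real.rpow_natCast]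
    push_cast; rfl
  have h6 : δ ^ (2 + α) ≤ z.re ^ (2 + α) := by gcongr; linarith
  have h7 := h3.trans h4
  rw [h5, mul_inv] at h7
  have h8 : 0 < (δ ^ (2 * N))⁻¹ := by positivity
  have h9 : ((4 : ℝ) ^ N)⁻¹ ≤ ‖l‖ ^ 2 * (C * δ ^ (2 + α)) := by
    refine le_of_mul_le_mul_right ?_ h8
    linarith
  rw [mul_inv, ← div_eq_mul_inv, div_le_iff₀ hC]
  calc ((4 : ℝ) ^ N)⁻¹ ≤ ‖l‖ ^ 2 * (C * δ ^ (2 + α)) := h9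
    _ ≤ ‖l‖ ^ 2 * (C * z.re ^ (2 + α)) := by gcongr
    _ = _ := by ring

/-- Approximation numbers are bounded below as soon as there are many disjoint discs near the
boundary on which `1 - ‖ψ‖²` is comparable to the distance to the boundary of `𝔻`. -/
lemma IsCompData.exists_le_approxNum (h : IsCompData α Ω φ ψ e1 T) :
    ∃ c > 0, ∃ B > (0 : ℝ), ∀ {ι : Type} [Fintype ι] [Nonempty ι] (z : ι → ℂ) (r : ι → ℝ) (a : ℝ),
      0 < a → (∀ j, 0 < r j) → (∀ j, (z j).re = 6 * r j) → (∀ j, 6 * r j ≤ 1 / 2) →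
      (∀ j, ball (z j) (r j) ⊆ ball 0 1) →
      Pairwise (fun i j => Disjoint (ball (z i) (r i)) (ball (z j) (r j))) →
      (∀ j, ∀ v ∈ ball (z j) (r j), Complex.exp (-v) ∈ Ω ∧
        a * r j ≤ 1 - ‖ψ (Complex.exp (-v))‖ ^ 2) →
      ∀ n : ℕ, B * n ≤ Fintype.card ι → c * a ^ (α / 2) ≤ approxNum T n := by
  have hα := h.pos
  have hpi := Real.pi_pos
  obtain ⟨c, hc, hcl⟩ := h.space.exists_le_norm_functional hα
  obtain ⟨C₁, hC₁, hB⟩ := h.space.exists_lintegral_halfPlane_le hα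
  obtain ⟨C₂, hC₂, hT⟩ := h.exists_le_norm_sq
  set D := (6 : ℝ) ^ (2 + α) / Real.pi with hD
  have hD0 : 0 < D := by positivity
  refine ⟨√(c / 2) / √(D * C₂), by positivity, 2 * (D * C₁) / c, by positivity,
    fun {ι} _ _ z r a ha hr hz hr6 hzb hdisj hW n hn => ?_⟩
  have hre : ∀ j, ∀ v ∈ ball (z j) (r j), r j ≤ v.re := fun j v hv => by
    have h1 : ‖v - z j‖ < r j := by simpa [dist_eq_norm] using hv
    have h2 := abs_le.1 (Complex.abs_re_le_norm (v - z j))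
    rw [Complex.sub_re, hz] at h2
    linarith [h2.1, hr j]
  have hzre : ∀ j, 0 < (z j).re := fun j => by rw [hz]; linarith [hr j]
  choose l hl using fun j => h.space.exists_functional hα 0 (exp_neg_mem_ball (hzre j))
  simp only [iteratedDeriv_zero] at hl
  have hdiff : ∀ f j, DifferentiableOn ℂ (fun v => deriv (e1 f) (Complex.exp (-v)))
      (ball (z j) (r j)) := fun f j =>
    (differentiableOn_comp_exp h.space f).mono fun v hv => (hr j).trans_le (hre j v hv)
  have hs : ∀ j, (z j).re ^ (2 + α) = D * (Real.pi * r j ^ 2 * r j ^ α) := fun j => by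
    rw [hz, Real.mul_rpow (by norm_num) (hr j).le, Real.rpow_add (hr j), hD, Real.rpow_ofNat]
    field_simp
  set t : ι → ℝ := fun j => (z j).re ^ ((2 + α) / 2) with ht
  have ht2 : ∀ j, t j ^ 2 = (z j).re ^ (2 + α) := fun j => by
    rw [ht, ← Real.rpow_natCast, ← Real.rpow_mul (hzre j).le]; norm_num
  have hln : ∀ j f, ‖((t j : ℂ) • l j) f‖ ^ 2 =
      D * (Real.pi * r j ^ 2 * r j ^ α * ‖deriv (e1 f) (Complex.exp (-(z j)))‖ ^ 2) := fun j f => by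
    rw [ContinuousLinearMap.smul_apply, norm_smul, mul_pow, Complex.norm_real, Real.norm_eq_abs,
      sq_abs, ht2, hs, hl]; ring
  have key := le_approxNum_of_functionals T (fun j => (t j : ℂ) • l j) (n := n)
    (A := √(D * C₂) * a ^ (-(α / 2))) (B := D * C₁) (c := c) (by positivity) hc ?_ ?_ ?_ ?_
  · refine le_trans (le_of_eq ?_) key
    rw [Real.rpow_neg ha.le]
    field_simp
  · intro j
    refine (hcl (z j) (hzre j) (by rw [hz]; exact hr6 j) (l j) (hl j)).trans (le_of_eq ?_)
    rw [norm_smul, mul_pow, Complex.norm_real, Real.norm_eq_abs, sq_abs, ht2]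
  · intro f
    simp only [hln]
    rw [← Finset.mul_sum, mul_assoc]
    refine mul_le_mul_of_nonneg_left ?_ hD0.le
    rw [← ENNReal.ofReal_le_ofReal_iff (by positivity),
      ENNReal.ofReal_sum_of_nonneg fun j _ => by have := hr j; positivity]
    calc ∑ j, ENNReal.ofReal (Real.pi * r j ^ 2 * r j ^ α *
          ‖deriv (e1 f) (Complex.exp (-(z j)))‖ ^ 2)
        ≤ ∑ j, ∫⁻ v in ball (z j) (r j), ‖deriv (e1 f) (Complex.exp (-v))‖ₑ ^ 2 *
            ENNReal.ofReal (v.re ^ α) := by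
          refine Finset.sum_le_sum fun j _ => ?_
          exact ofReal_le_setLIntegral_ball (hdiff f j) (hr j).le (by have := hr j; positivity)
            fun v hv => Real.rpow_le_rpow (hr j).le (hre j v hv) hα.le
      _ = ∫⁻ v in ⋃ j, ball (z j) (r j), ‖deriv (e1 f) (Complex.exp (-v))‖ₑ ^ 2 *
            ENNReal.ofReal (v.re ^ α) := by
          rw [lintegral_iUnion (fun j => measurableSet_ball) hdisj, tsum_fintype]
      _ ≤ ∫⁻ v in {v : ℂ | 0 < v.re} ∩ ball 0 1, ‖deriv (e1 f) (Complex.exp (-v))‖ₑ ^ 2 *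
            ENNReal.ofReal (v.re ^ α) :=
          lintegral_mono_set (iUnion_subset fun j v hv =>
            ⟨(hr j).trans_le (hre j v hv), hzb j hv⟩)
      _ ≤ _ := hB f
  · intro j f
    refine le_of_sq_le_sq ?_ (by positivity)
    rw [hln, mul_pow, mul_pow, Real.sq_sqrt (by positivity)]
    have h1 := (ofReal_le_setLIntegral_ball (m := (a * r j) ^ α)
      (W := fun v => (1 - ‖ψ (Complex.exp (-v))‖ ^ 2) ^ α) (hdiff f j) (hr j).le
      (by have := hr j; positivity)
      fun v hv => Real.rpow_le_rpow (by have := hr j; positivity) (hW j v hv).2 hα.le).trans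
      (hT _ measurableSet_ball (hzb j) (fun v hv => (hW j v hv).1) f)
    rw [ENNReal.ofReal_le_ofReal_iff (by positivity), Real.mul_rpow ha.le (hr j).le] at h1
    have h2 : (a ^ (-(α / 2))) ^ 2 = (a ^ α)⁻¹ := by
      rw [← Real.rpow_natCast, ← Real.rpow_mul ha.le, ← Real.rpow_neg ha.le]; congr 1; push_cast; ring
    rw [h2]
    have h3 : 0 < a ^ α := by positivity
    have h4 : Real.pi * r j ^ 2 * r j ^ α * ‖deriv (e1 f) (Complex.exp (-(z j)))‖ ^ 2 ≤
        (a ^ α)⁻¹ * (C₂ * ‖T f‖ ^ 2) := by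
      rw [← div_eq_inv_mul, le_div_iff₀ h3]
      linarith
    calc _ ≤ D * ((a ^ α)⁻¹ * (C₂ * ‖T f‖ ^ 2)) := by gcongr
      _ = _ := by ring
  · rw [div_mul_eq_mul_div, div_le_iff₀ hc] at hn
    linarith

end LowerBound

section CuspDiscs

variable {γf : ℝ → ℝ} {α : ℝ} {H1 : Type} [NormedAddCommGroup H1] [InnerProductSpace ℂ H1]
  [CompleteSpace H1] {e1 : H1 →ₗ[ℂ] (ℂ → ℂ)} {Ω : Set ℂ} {φ ψ : ℂ → ℂ} {T : H1 →L[ℂ] H1}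
  {ρ₁ δ : ℝ}

/-- The number of disjoint discs of radius `γ(2^{-k})` used at scale `2^{-k}`. -/
def discCount (γf : ℝ → ℝ) (k : ℕ) : ℕ := ⌊(8 * (γf ((1 / 2) ^ k) / (1 / 2) ^ k))⁻¹⌋₊

/-- The centres of the discs used at scale `2^{-k}`. -/
def discCenter (γf : ℝ → ℝ) (k j : ℕ) : ℂ :=
  ⟨6 * γf ((1 / 2) ^ k), (1 / 2) ^ (k + 2) + (2 * j + 1) * γf ((1 / 2) ^ k)⟩

lemma abs_re_im_sub_lt_of_mem_ball {v z : ℂ} {r : ℝ} (hv : v ∈ ball z r) :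
    |v.re - z.re| < r ∧ |v.im - z.im| < r := by
  have h1 : ‖v - z‖ < r := by simpa [dist_eq_norm] using hv
  exact ⟨(Complex.abs_re_le_norm (v - z)).trans_lt h1, (Complex.abs_im_le_norm (v - z)).trans_lt h1⟩

lemma IsGauge.mem_disc (hγ : IsGauge γf) {k j : ℕ} (hj : j < discCount γf k) {v : ℂ}
    (hv : v ∈ ball (discCenter γf k j) (γf ((1 / 2) ^ k))) :
    (1 / 2) ^ (k + 2) < v.im ∧ v.im < (1 / 2) ^ (k + 1) ∧ 5 * γf ((1 / 2) ^ k) < v.re ∧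
      v.re < 7 * γf ((1 / 2) ^ k) := by
  have hr := hγ.pos _ (half_pow_mem k)
  have hp := half_pow_pos k
  obtain ⟨h1, h2⟩ := abs_re_im_sub_lt_of_mem_ball hv
  rw [abs_lt] at h1 h2
  have hj1 : (j : ℝ) + 1 ≤ (8 * (γf ((1 / 2) ^ k) / (1 / 2) ^ k))⁻¹ := by
    refine le_trans ?_ (Nat.floor_le (by positivity))
    exact_mod_cast hj
  have hj2 : 8 * ((j : ℝ) + 1) * γf ((1 / 2) ^ k) ≤ (1 / 2) ^ k := by
    have := mul_le_mul_of_nonneg_left hj1 hr.le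
    have e : γf ((1 / 2) ^ k) * (8 * (γf ((1 / 2) ^ k) / (1 / 2) ^ k))⁻¹ = (1 / 2) ^ k / 8 := by
      have := hr.ne'
      have := hp.ne'
      field_simp
    rw [e] at this
    linarith
  have hj0 : (0 : ℝ) ≤ j * γf ((1 / 2) ^ k) := by positivity
  have e1 : (1 / 2 : ℝ) ^ (k + 1) = (1 / 2) ^ k / 2 := by rw [pow_succ]; ring
  have e2 : (1 / 2 : ℝ) ^ (k + 2) = (1 / 2) ^ k / 4 := by rw [pow_add]; norm_num; ring
  simp only [discCenter, e2] at h1 h2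
  rw [e1, e2]
  refine ⟨?_, ?_, ?_, ?_⟩ <;> nlinarith

lemma IsGauge.disjoint_discs (hγ : IsGauge γf) {k j l i : ℕ} (hj : j < discCount γf k)
    (hi : i < discCount γf l) (hne : (k, j) ≠ (l, i)) :
    Disjoint (ball (discCenter γf k j) (γf ((1 / 2) ^ k)))
      (ball (discCenter γf l i) (γf ((1 / 2) ^ l))) := by
  rw [Set.disjoint_left]
  intro v hv hv'
  have h1 := hγ.mem_disc hj hv
  have h2 := hγ.mem_disc hi hv'
  rcases lt_trichotomy k l with hkl | rfl | hkl
  · have := half_pow_anti (k := k + 2) (l := l + 1) (by omega)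
    linarith [h1.1, h2.2.1]
  · have hr := hγ.pos _ (half_pow_mem k)
    have h3 := (abs_re_im_sub_lt_of_mem_ball hv).2
    have h4 := (abs_re_im_sub_lt_of_mem_ball hv').2
    rw [abs_lt] at h3 h4
    simp only [discCenter] at h3 h4
    rcases lt_trichotomy j i with hji | rfl | hji
    · have : (j : ℝ) + 1 ≤ i := by exact_mod_cast hji
      nlinarith
    · exact hne rfl
    · have : (i : ℝ) + 1 ≤ j := by exact_mod_cast hji
      nlinarith
  · have := half_pow_anti (k := l + 2) (l := k + 1) (by omega)
    linarith [h2.1, h1.2.1]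

lemma IsGauge.le_discCount (hγ : IsGauge γf) {k : ℕ}
    (hk : γf ((1 / 2) ^ k) / (1 / 2) ^ k ≤ 1 / 224) :
    (γf ((1 / 2) ^ k) / (1 / 2) ^ k)⁻¹ ≤ 16 * discCount γf k ∧ 0 < discCount γf k := by
  have hκ := hγ.quot_pos (half_pow_mem k)
  have h1 : (224 : ℝ) ≤ (γf ((1 / 2) ^ k) / (1 / 2) ^ k)⁻¹ := by
    rw [le_inv_comm₀ (by norm_num) hκ]; simpa using hk
  have h2 := Nat.lt_floor_add_one ((8 * (γf ((1 / 2) ^ k) / (1 / 2) ^ k))⁻¹)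
  rw [mul_inv] at h2
  have h3 : (γf ((1 / 2) ^ k) / (1 / 2) ^ k)⁻¹ ≤ 16 * discCount γf k := by
    rw [discCount, mul_inv]; linarith
  refine ⟨h3, ?_⟩
  have : (0 : ℝ) < discCount γf k := by linarith
  exact_mod_cast this

lemma IsGauge.exists_scale (hγ : IsGauge γf) {ρ : ℝ} (hρ : 0 < ρ) :
    ∃ k₀ : ℕ, ∀ k ≥ k₀, (1 / 2) ^ k ≤ ρ ∧ γf ((1 / 2) ^ k) / (1 / 2) ^ k ≤ 1 / 224 := by
  have h1 : Tendsto (fun k : ℕ => (1 / 2 : ℝ) ^ k) atTop (𝓝[>] 0) :=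
    tendsto_nhdsWithin_iff.2 ⟨tendsto_pow_atTop_nhds_zero_of_lt_one (by norm_num) (by norm_num),
      Eventually.of_forall half_pow_pos⟩
  have h2 := (hγ.tendsto_quot.comp h1).eventually_le_const (show (0 : ℝ) < 1 / 224 by norm_num)
  have h3 := (h1.mono_right nhdsWithin_le_nhds).eventually_le_const hρ
  obtain ⟨k₀, hk₀⟩ := eventually_atTop.1 (h3.and h2)
  exact ⟨k₀, fun k hk => ⟨(hk₀ k hk).1, (hk₀ k hk).2⟩⟩

lemma IsCompData.exists_scale_le_approxNum (h : IsCompData α Ω φ ψ e1 T) (hγ : IsGauge γf)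
    (hc : IsCuspDomain γf Ω ρ₁) (hψ : IsInverseMap Ω ψ δ) :
    ∃ c > 0, ∃ C > (0 : ℝ), ∃ k₀ : ℕ, ∀ k₁ ≥ k₀, ∀ n : ℕ,
      C * n ≤ ∑ k ∈ Finset.Ico k₀ (k₁ + 1), (γf ((1 / 2) ^ k) / (1 / 2) ^ k)⁻¹ →
      c * Real.exp (-(α / 2) * Gam γf ((1 / 2) ^ (k₁ + 2))) ≤ approxNum T n := by
  obtain ⟨c₁, hc₁, B, hB, hmain⟩ := h.exists_le_approxNum
  obtain ⟨c₂, hc₂, ρ, hρ, -, -, hψb⟩ := exists_re_mul_le_one_sub_sq hγ hc hψ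
  obtain ⟨k₀, hk₀⟩ := hγ.exists_scale hρ
  refine ⟨c₁ * c₂ ^ (α / 2), by positivity, 16 * B, by positivity, k₀, fun k₁ hk₁ n hn => ?_⟩
  set S : Finset (Σ _ : ℕ, ℕ) :=
    (Finset.Ico k₀ (k₁ + 1)).sigma fun k => Finset.range (discCount γf k) with hS
  have hmem : ∀ x : S, (k₀ ≤ x.1.1 ∧ x.1.1 < k₁ + 1) ∧ x.1.2 < discCount γf x.1.1 := fun x => by
    have := x.2
    simpa only [hS, Finset.mem_sigma, Finset.mem_Ico, Finset.mem_range] using this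
  have hne : Nonempty S := by
    refine ⟨⟨⟨k₀, 0⟩, ?_⟩⟩
    simp only [hS, Finset.mem_sigma, Finset.mem_Ico, Finset.mem_range]
    exact ⟨⟨le_rfl, by omega⟩, (hγ.le_discCount (hk₀ k₀ le_rfl).2).2⟩
  have hcard : B * n ≤ Fintype.card S := by
    rw [Fintype.card_coe, hS, Finset.card_sigma]
    simp only [Finset.card_range]
    push_cast
    have h1 : ∑ k ∈ Finset.Ico k₀ (k₁ + 1), (γf ((1 / 2) ^ k) / (1 / 2) ^ k)⁻¹ ≤
        ∑ k ∈ Finset.Ico k₀ (k₁ + 1), 16 * (discCount γf k : ℝ) :=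
      Finset.sum_le_sum fun k hk =>
        (hγ.le_discCount (hk₀ k (Finset.mem_Ico.1 hk).1).2).1
    rw [← Finset.mul_sum] at h1
    linarith
  have hdisc : ∀ x : S, ∀ v ∈ ball (discCenter γf x.1.1 x.1.2) (γf ((1 / 2) ^ x.1.1)),
      ‖v‖ < 1 ∧ Complex.exp (-v) ∈ Ω ∧ c₂ * Real.exp (-Gam γf ((1 / 2) ^ (k₁ + 2))) *
        γf ((1 / 2) ^ x.1.1) ≤ 1 - ‖ψ (Complex.exp (-v))‖ ^ 2 := fun x v hv => by
    obtain ⟨⟨hx1, hx2⟩, hx3⟩ := hmem x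
    obtain ⟨hv1, hv2, hv3, hv4⟩ := hγ.mem_disc hx3 hv
    obtain ⟨hk1, hk2⟩ := hk₀ _ hx1
    set k := x.1.1 with hk
    set p : ℝ := (1 / 2) ^ k with hp
    have hp0 : 0 < p := half_pow_pos k
    have hp1 : p ≤ 1 := half_pow_le_one k
    have hr := hγ.pos _ (half_pow_mem k)
    rw [div_le_iff₀ hp0] at hk2
    have hpi := Real.pi_gt_three
    have e1 : (1 / 2 : ℝ) ^ (k + 1) = p / 2 := by rw [pow_succ]; ring
    have e2 : (1 / 2 : ℝ) ^ (k + 2) = p / 4 := by rw [pow_add]; norm_num; ring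
    have hle := half_pow_anti (k := k + 2) (l := k₁ + 2) (by omega)
    rw [e2] at hv1 hle
    rw [e1] at hv2
    have hq := half_pow_pos (k₁ + 2)
    have him : 0 < v.im := by linarith
    obtain ⟨h1, h2⟩ := hψb v him (by linarith)
      (by linarith [hγ.mono (a := 2 * v.im) (b := p) ⟨by linarith, by linarith⟩
            ⟨hp0.le, by linarith⟩ (by linarith)]) (by linarith)
    refine ⟨?_, h1, le_trans ?_ h2⟩
    · have := Complex.norm_le_abs_re_add_abs_im v
      rw [abs_of_pos him, abs_of_pos (by linarith)] at this
      linarith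
    · have h3 := hγ.Gam_anti hq (y := v.im) (by linarith) (by linarith)
      rw [mul_assoc, mul_comm (Real.exp _)]
      refine mul_le_mul_of_nonneg_left ?_ hc₂.le
      exact mul_le_mul (by linarith) (Real.exp_le_exp.2 (by linarith)) (by positivity)
        (by linarith)
  have key := hmain (fun x : S => discCenter γf x.1.1 x.1.2) (fun x => γf ((1 / 2) ^ x.1.1))
    (c₂ * Real.exp (-Gam γf ((1 / 2) ^ (k₁ + 2)))) (by positivity)
    (fun x => hγ.pos _ (half_pow_mem _)) (fun x => rfl) (fun x => ?_)
    (fun x v hv => by simpa using (hdisc x v hv).1) (fun x y hxy => ?_)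
    (fun x v hv => (hdisc x v hv).2) n hcard
  · refine le_trans (le_of_eq ?_) key
    rw [Real.mul_rpow hc₂.le (Real.exp_pos _).le, ← Real.exp_mul, mul_assoc]
    congr 3; ring
  · have h2 := (hk₀ _ (hmem x).1.1).2
    rw [div_le_iff₀ (half_pow_pos _)] at h2
    linarith [half_pow_le_one x.1.1]
  · refine hγ.disjoint_discs (hmem x).2 (hmem y).2 fun he => hxy ?_
    simp only [Prod.mk.injEq] at he
    exact Subtype.ext (Sigma.ext he.1 (heq_of_eq he.2))

end CuspDiscs

section GaugeSums

variable {γf : ℝ → ℝ}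

/-- The reciprocal of `γ(t)/t` at `t = 2^{-k}`. -/
def invQuot (γf : ℝ → ℝ) (k : ℕ) : ℝ := (γf ((1 / 2) ^ k) / (1 / 2) ^ k)⁻¹

lemma IsGauge.one_le_invQuot (h : IsGauge γf) (k : ℕ) : 1 ≤ invQuot γf k := by
  have hk := half_pow_mem k
  exact (one_le_inv₀ (h.quot_pos hk)).2 (h.quot_le_one hk.1.le hk.2)

lemma log_half_pow_div (k : ℕ) : Real.log ((1 / 2) ^ k / (1 / 2) ^ (k + 1)) = Real.log 2 := by
  congr 1
  have := (half_pow_pos k).ne'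
  rw [pow_succ]
  field_simp

lemma IsGauge.gaugeCount_half_pow_sub (h : IsGauge γf) (k : ℕ) :
    Real.log 2 * invQuot γf k ≤
        gaugeCount γf ((1 / 2) ^ (k + 1)) - gaugeCount γf ((1 / 2) ^ k) ∧
      gaugeCount γf ((1 / 2) ^ (k + 1)) - gaugeCount γf ((1 / 2) ^ k) ≤
        Real.log 2 * invQuot γf (k + 1) := by
  have h1 := h.le_gaugeCount_sub (half_pow_pos (k + 1)) (half_pow_anti (Nat.le_succ k))
    (half_pow_mem k).2
  have h2 := h.gaugeCount_sub_le (half_pow_pos (k + 1)) (half_pow_anti (Nat.le_succ k))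
    (half_pow_mem k).2
  rw [log_half_pow_div, mul_comm] at h1 h2
  exact ⟨h1, h2⟩

lemma IsGauge.sum_invQuot_le (h : IsGauge γf) {a b : ℕ} (hab : a ≤ b) :
    Real.log 2 * ∑ k ∈ Finset.Ico a b, invQuot γf k ≤
      gaugeCount γf ((1 / 2) ^ b) - gaugeCount γf ((1 / 2) ^ a) := by
  rw [← Finset.sum_Ico_sub (fun k => gaugeCount γf ((1 / 2) ^ k)) hab, Finset.mul_sum]
  exact Finset.sum_le_sum fun k _ => (h.gaugeCount_half_pow_sub k).1

lemma IsGauge.gaugeCount_sub_le_sum (h : IsGauge γf) {a b : ℕ} (hab : a ≤ b) :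
    gaugeCount γf ((1 / 2) ^ b) - gaugeCount γf ((1 / 2) ^ a) ≤
      Real.log 2 * ∑ k ∈ Finset.Ico a b, invQuot γf (k + 1) := by
  rw [← Finset.sum_Ico_sub (fun k => gaugeCount γf ((1 / 2) ^ k)) hab, Finset.mul_sum]
  exact Finset.sum_le_sum fun k _ => (h.gaugeCount_half_pow_sub k).2

lemma IsGauge.mul_log_two_le_gaugeCount (h : IsGauge γf) (k : ℕ) :
    k * Real.log 2 ≤ gaugeCount γf ((1 / 2) ^ k) := by
  have h1 := h.sum_invQuot_le (Nat.zero_le k)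
  have h2 : (k : ℝ) ≤ ∑ k ∈ Finset.Ico 0 k, invQuot γf k := by
    have := Finset.sum_le_sum (s := Finset.Ico 0 k) fun k _ => h.one_le_invQuot k
    simpa using this
  have h3 := h.gaugeCount_nonneg (half_pow_pos 0) (half_pow_mem 0).2
  have h4 := Real.log_pos one_lt_two
  nlinarith

lemma IsGauge.Gam_half_pow_add_le (h : IsGauge γf) (k l : ℕ) :
    Gam γf ((1 / 2) ^ (k + l)) ≤ Gam γf ((1 / 2) ^ k) + l * Real.log 2 := by
  have h1 := h.Gam_le_add_log (half_pow_pos (k + l)) (half_pow_anti (Nat.le_add_right k l))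
    (half_pow_mem k).2
  refine h1.trans (le_of_eq ?_)
  have := (half_pow_pos k).ne'
  rw [← Real.log_pow]
  congr 2
  rw [pow_add]
  field_simp
  rw [← mul_pow]
  norm_num

lemma log_pi_div_half_pow_ge (k : ℕ) :
    k * Real.log 2 ≤ Real.log (Real.pi / (1 / 2) ^ k) := by
  rw [← Real.log_pow]
  refine Real.log_le_log (by positivity) ?_
  rw [le_div_iff₀ (by positivity), ← mul_pow]
  norm_num
  linarith [Real.pi_gt_three]

lemma IsGauge.exists_mul_log_le (h : IsGauge γf)
    (hb : ∃ C : ℝ, ∀ᶠ t in 𝓝[>] (0 : ℝ), γf t * Real.log (1 / t) / t ≤ C) :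
    ∃ C, 0 ≤ C ∧ ∀ t ∈ Ioc 0 Real.pi, γf t / t * Real.log (Real.pi / t) ≤ C := by
  obtain ⟨C, hC⟩ := hb
  obtain ⟨ε, hε, hCε⟩ := mem_nhdsGT_iff_exists_Ioo_subset.1 hC
  have hε0 : (0 : ℝ) < ε := hε
  have hpi := Real.pi_gt_three
  have hlpi : 0 ≤ Real.log Real.pi := Real.log_nonneg (by linarith)
  refine ⟨Real.log Real.pi + |C| + |Real.log (Real.pi / ε)|, by positivity, fun t ht => ?_⟩
  have hκ := h.quot_pos ht
  have hκ1 := h.quot_le_one ht.1.le ht.2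
  have hC1 := abs_nonneg C
  have hl := abs_nonneg (Real.log (Real.pi / ε))
  by_cases hte : t < ε
  · have h1 : γf t * Real.log (1 / t) / t ≤ C := hCε ⟨ht.1, hte⟩
    have h2 : Real.log (Real.pi / t) = Real.log Real.pi + Real.log (1 / t) := by
      rw [← Real.log_mul (by positivity) (by have := ht.1; positivity)]; congr 1; ring
    rw [h2, mul_add]
    have h3 : γf t / t * Real.log (1 / t) = γf t * Real.log (1 / t) / t := by ring
    rw [h3]
    nlinarith [le_abs_self C]
  · have h1 : Real.log (Real.pi / t) ≤ Real.log (Real.pi / ε) :=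
      Real.log_le_log (div_pos (by linarith) ht.1)
        (div_le_div_of_nonneg_left (by linarith) hε0 (not_lt.1 hte))
    have h2 : 0 ≤ Real.log (Real.pi / t) :=
      Real.log_nonneg (by rw [le_div_iff₀ ht.1]; linarith [ht.2])
    nlinarith [le_abs_self (Real.log (Real.pi / ε))]

lemma IsGauge.exists_sq_le_gaugeCount (h : IsGauge γf) {C : ℝ}
    (hlog : ∀ t ∈ Ioc 0 Real.pi, γf t / t * Real.log (Real.pi / t) ≤ C) :
    ∃ C' > 0, ∀ k : ℕ, (k : ℝ) ^ 2 ≤ C' * gaugeCount γf ((1 / 2) ^ (k + 2)) := by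
  have hl2 := Real.log_pos one_lt_two
  have hC : 0 ≤ C := by
    have hpi := Real.pi_pos
    simpa [hpi.ne'] using hlog Real.pi ⟨hpi, le_rfl⟩
  have h1 : ∀ k : ℕ, k * Real.log 2 ≤ (C + 1) * invQuot γf k := fun k => by
    have h2 := hlog _ (half_pow_mem k)
    have h3 := h.quot_pos (half_pow_mem k)
    have h4 := mul_le_mul_of_nonneg_left (log_pi_div_half_pow_ge k) h3.le
    rw [invQuot, ← div_eq_mul_inv, le_div_iff₀ h3]
    linarith
  have h2 : ∀ k : ℕ, (k : ℝ) * (k - 1) / 2 * Real.log 2 ≤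
      (C + 1) * ∑ j ∈ Finset.Ico 0 k, invQuot γf j := fun k => by
    induction k with
    | zero => simp
    | succ k ih =>
      rw [Finset.sum_Ico_succ_top (Nat.zero_le k), mul_add]
      have := h1 k
      push_cast
      nlinarith
  refine ⟨2 * (C + 1) / Real.log 2 ^ 2, by positivity, fun k => ?_⟩
  have h3 := h2 (k + 2)
  have h4 := h.sum_invQuot_le (Nat.zero_le (k + 2))
  have h5 := h.gaugeCount_nonneg (half_pow_pos 0) (half_pow_mem 0).2
  push_cast at h3
  have hk : (0 : ℝ) ≤ k := Nat.cast_nonneg k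
  rw [div_mul_eq_mul_div, le_div_iff₀ (by positivity)]
  have h6 : (k : ℝ) ^ 2 / 2 * Real.log 2 ≤ ((k : ℝ) + 2) * (k + 2 - 1) / 2 * Real.log 2 := by
    gcongr; nlinarith
  have h7 := mul_le_mul_of_nonneg_right (h6.trans h3) hl2.le
  have h8 : Real.log 2 * ∑ j ∈ Finset.Ico 0 (k + 2), invQuot γf j ≤
    gaugeCount γf ((1 / 2) ^ (k + 2)) := by linarith
  have h9 := mul_le_mul_of_nonneg_left h8 (show 0 ≤ 2 * (C + 1) by linarith)
  nlinarith

lemma tendsto_half_pow_nhdsGT : Tendsto (fun k : ℕ => (1 / 2 : ℝ) ^ k) atTop (𝓝[>] 0) :=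
  tendsto_nhdsWithin_iff.2 ⟨tendsto_pow_atTop_nhds_zero_of_lt_one (by norm_num) (by norm_num),
    Eventually.of_forall half_pow_pos⟩

lemma eventually_le_quot_half_pow_mul
    (hl : Tendsto (fun t => γf t * Real.log (1 / t) / t) (𝓝[>] (0 : ℝ)) atTop) (M : ℝ) :
    ∃ k₀ : ℕ, ∀ k ≥ k₀, M ≤ Real.log 2 * (γf ((1 / 2) ^ k) / (1 / 2) ^ k) * k := by
  obtain ⟨k₀, hk₀⟩ := eventually_atTop.1
    ((hl.comp tendsto_half_pow_nhdsGT).eventually_ge_atTop M)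
  refine ⟨k₀, fun k hk => (hk₀ k hk).trans (le_of_eq ?_)⟩
  simp only [Function.comp_apply]
  rw [show (1 : ℝ) / (1 / 2) ^ k = 2 ^ k by rw [div_pow, one_pow, one_div_one_div], Real.log_pow]
  ring

lemma IsGauge.exists_invQuot_le (h : IsGauge γf)
    (hl : Tendsto (fun t => γf t * Real.log (1 / t) / t) (𝓝[>] (0 : ℝ)) atTop) :
    ∃ C > 0, ∀ k : ℕ, invQuot γf k ≤ C * (k + 1) := by
  obtain ⟨k₀, hk₀⟩ := eventually_le_quot_half_pow_mul hl 1
  have hnn : ∀ k, 0 ≤ invQuot γf k := fun k => zero_le_one.trans (h.one_le_invQuot k)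
  have hsum : 0 ≤ ∑ j ∈ Finset.range k₀, invQuot γf j := Finset.sum_nonneg fun j _ => hnn j
  refine ⟨1 + ∑ j ∈ Finset.range k₀, invQuot γf j, by positivity, fun k => ?_⟩
  have hk0 : (0 : ℝ) ≤ k := Nat.cast_nonneg k
  by_cases hk : k < k₀
  · have := Finset.single_le_sum (fun j _ => hnn j) (Finset.mem_range.2 hk)
    nlinarith
  · have h1 := hk₀ k (not_lt.1 hk)
    have hκ := h.quot_pos (half_pow_mem k)
    have h2 : invQuot γf k ≤ k := by
      rw [invQuot, inv_le_iff_one_le_mul₀ hκ, mul_comm]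
      have := Real.log_two_lt_d9
      refine h1.trans ?_
      refine mul_le_mul_of_nonneg_right ?_ hk0
      nlinarith
    nlinarith

lemma IsGauge.exists_log_le_Gam (h : IsGauge γf)
    (hl : Tendsto (fun t => γf t * Real.log (1 / t) / t) (𝓝[>] (0 : ℝ)) atTop) {M : ℝ}
    (hM : 0 < M) : ∃ D, ∀ k : ℕ, M * Real.log (k + 1) ≤ Gam γf ((1 / 2) ^ k) + D := by
  obtain ⟨k₀, hk₀⟩ := eventually_le_quot_half_pow_mul hl (Real.pi / 2 * M)
  have hpi := Real.pi_pos
  have hstep : ∀ k ≥ k₀, M * Real.log (k + 1) ≤ Gam γf ((1 / 2) ^ k) + M * Real.log (k₀ + 1) := by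
    refine fun k hk => Nat.le_induction ?_ (fun k hk ih => ?_) k hk
    · have := h.Gam_nonneg (half_pow_pos k₀) (half_pow_le_one k₀)
      linarith
    · have h1 := hk₀ (k + 1) (by omega)
      have h2 := h.le_Gam_sub (half_pow_pos (k + 1)) (half_pow_anti (Nat.le_succ k))
        (half_pow_mem k).2
      rw [log_half_pow_div] at h2
      have hk1 : (0 : ℝ) < (k : ℝ) + 1 := by positivity
      have h3 : Real.log (k + 1 + 1) ≤ Real.log (k + 1) + 1 / (k + 1) := by
        have h4 := Real.log_le_sub_one_of_pos (show (0 : ℝ) < (k + 1 + 1) / (k + 1) by positivity)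
        rw [Real.log_div (by positivity) (by positivity)] at h4
        have h5 : ((k : ℝ) + 1 + 1) / (k + 1) - 1 = 1 / (k + 1) := by field_simp; ring
        linarith
      have h4 : M / (k + 1) ≤ 2 / Real.pi *
          (γf ((1 / 2) ^ (k + 1)) / (1 / 2) ^ (k + 1) * Real.log 2) := by
        rw [div_le_iff₀ hk1, div_mul_eq_mul_div, div_mul_eq_mul_div, le_div_iff₀ hpi]
        push_cast at h1
        linarith
      have h5 := mul_le_mul_of_nonneg_left h3 hM.le
      rw [mul_add, mul_one_div] at h5
      push_cast
      linarith
  refine ⟨M * Real.log (k₀ + 1), fun k => ?_⟩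
  rcases le_or_gt k₀ k with hk | hk
  · exact hstep k hk
  · have h1 := h.Gam_nonneg (half_pow_pos k) (half_pow_le_one k)
    have h2 : Real.log (k + 1) ≤ Real.log (k₀ + 1) := by gcongr
    nlinarith

end GaugeSums

section DecayRates

variable {γf : ℝ → ℝ} {α : ℝ} {H1 : Type} [NormedAddCommGroup H1] [InnerProductSpace ℂ H1]
  [CompleteSpace H1] {e1 : H1 →ₗ[ℂ] (ℂ → ℂ)} {Ω : Set ℂ} {φ ψ : ℂ → ℂ} {T : H1 →L[ℂ] H1}
  {ρ₁ δ : ℝ}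

lemma IsCompData.exists_approxNum_le_rpow (h : IsCompData α Ω φ ψ e1 T) (hγ : IsGauge γf)
    (hc : IsCuspDomain γf Ω ρ₁) (hψ : IsInverseMap Ω ψ δ)
    (hl : Tendsto (fun t => γf t * Real.log (1 / t) / t) (𝓝[>] (0 : ℝ)) atTop) {A : ℝ}
    (hA : 0 < A) : ∃ C > 0, ∀ n : ℕ, approxNum T n ≤ C / (n + 1 : ℝ) ^ A := by
  have hα := h.pos
  obtain ⟨C₁, hC₁, hmain⟩ := h.exists_approxNum_le hγ hc hψ
  obtain ⟨C₂, hC₂, hq⟩ := hγ.exists_invQuot_le hl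
  obtain ⟨D, hD⟩ := hγ.exists_log_le_Gam hl (M := 4 * A / α) (by positivity)
  set B := C₁ * (1 + 4 * C₂) + 1 with hB
  have hB1 : 1 ≤ B := by have : 0 < C₁ * (1 + 4 * C₂) := by positivity
                         linarith
  have hcount : ∀ k₁ : ℕ, 1 ≤ k₁ → C₁ * ((k₁ : ℝ) ^ 2 + ∑ k ∈ Finset.range k₁,
      (γf ((1 / 2) ^ (k + 2)) / (1 / 2) ^ (k + 2))⁻¹) ≤ B * (k₁ : ℝ) ^ 2 := fun k₁ hk₁ => by
    have hk1 : (1 : ℝ) ≤ k₁ := by exact_mod_cast hk₁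
    have h1 : ∑ k ∈ Finset.range k₁, (γf ((1 / 2) ^ (k + 2)) / (1 / 2) ^ (k + 2))⁻¹ ≤
        ∑ k ∈ Finset.range k₁, C₂ * (4 * k₁) := by
      refine Finset.sum_le_sum fun k hk => (hq (k + 2)).trans ?_
      have : (k : ℝ) + 1 ≤ k₁ := by exact_mod_cast Finset.mem_range.1 hk
      push_cast
      gcongr
      linarith
    rw [Finset.sum_const, Finset.card_range, nsmul_eq_mul] at h1
    have h2 := mul_le_mul_of_nonneg_left h1 hC₁.le
    rw [mul_add, hB]
    nlinarith [sq_nonneg (k₁ : ℝ)]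
  have hexp : ∀ k : ℕ, Real.exp (-(α / 2) * Gam γf ((1 / 2) ^ k)) ≤
      Real.exp (α / 2 * D) / ((k : ℝ) + 1) ^ (2 * A) := fun k => by
    have hk1 : (0 : ℝ) < (k : ℝ) + 1 := by positivity
    rw [Real.rpow_def_of_pos hk1, ← Real.exp_sub]
    refine Real.exp_le_exp.2 ?_
    have h1 := mul_le_mul_of_nonneg_left (hD k) (show 0 ≤ α / 2 by linarith)
    have h2 : α / 2 * (4 * A / α * Real.log (k + 1)) = Real.log (k + 1) * (2 * A) := by
      field_simp; ring
    rw [h2] at h1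
    linarith
  refine ⟨(C₁ * Real.exp (α / 2 * D) + ‖T‖) * (2 * B) ^ A, by positivity, fun n => ?_⟩
  have hn1 : (0 : ℝ) < (n : ℝ) + 1 := by positivity
  set k₁ := ⌊√(n / B)⌋₊ with hk₁
  have hle : B * (k₁ : ℝ) ^ 2 ≤ n := by
    have h1 : (k₁ : ℝ) ≤ √(n / B) := Nat.floor_le (Real.sqrt_nonneg _)
    have h2 : (k₁ : ℝ) ^ 2 ≤ n / B := by
      rw [← Real.sq_sqrt (show 0 ≤ (n : ℝ) / B by positivity)]; gcongr
    rw [le_div_iff₀ (by linarith)] at h2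
    linarith
  have hgt : (n : ℝ) + 1 ≤ 2 * B * ((k₁ : ℝ) + 1) ^ 2 := by
    have h1 : √(n / B) < k₁ + 1 := Nat.lt_floor_add_one _
    have h2 : (n : ℝ) / B < ((k₁ : ℝ) + 1) ^ 2 := (Real.sqrt_lt' (by positivity)).1 h1
    rw [div_lt_iff₀ (by linarith)] at h2
    have h3 : (1 : ℝ) ≤ ((k₁ : ℝ) + 1) ^ 2 := one_le_pow₀ (by simp)
    nlinarith
  have hpow : ((n : ℝ) + 1) ^ A ≤ (2 * B) ^ A * ((k₁ : ℝ) + 1) ^ (2 * A) := by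
    rw [Real.rpow_mul (by positivity), ← Real.mul_rpow (by positivity) (by positivity)]
    norm_cast at hgt ⊢
    exact Real.rpow_le_rpow (by positivity) (by exact_mod_cast hgt) hA.le
  rw [le_div_iff₀ (by positivity)]
  refine (mul_le_mul_of_nonneg_left hpow (approxNum_nonneg T n)).trans ?_
  have hkA : 0 < ((k₁ : ℝ) + 1) ^ (2 * A) := by positivity
  have key : approxNum T n * ((k₁ : ℝ) + 1) ^ (2 * A) ≤ C₁ * Real.exp (α / 2 * D) + ‖T‖ := by
    rcases Nat.eq_zero_or_pos k₁ with h0 | h0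
    · rw [h0]
      simp only [Nat.cast_zero, zero_add, Real.one_rpow, mul_one]
      have : 0 < C₁ * Real.exp (α / 2 * D) := by positivity
      linarith [approxNum_le_norm T n]
    · have h1 := (hmain k₁ h0 n ((hcount k₁ h0).trans hle)).trans
        (mul_le_mul_of_nonneg_left (hexp k₁) hC₁.le)
      rw [← mul_div_assoc, le_div_iff₀ hkA] at h1
      linarith [norm_nonneg T]
  calc _ = approxNum T n * ((k₁ : ℝ) + 1) ^ (2 * A) * (2 * B) ^ A := by ring
    _ ≤ _ := by gcongr

lemma IsCompData.exists_approxNum_le_exp (h : IsCompData α Ω φ ψ e1 T) (hγ : IsGauge γf)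
    (hc : IsCuspDomain γf Ω ρ₁) (hψ : IsInverseMap Ω ψ δ) {C₀ : ℝ} (hC₀ : 0 ≤ C₀)
    (hlog : ∀ t ∈ Ioc 0 Real.pi, γf t / t * Real.log (Real.pi / t) ≤ C₀) :
    ∃ C > 0, ∀ (n : ℕ) (y : ℝ), y ∈ Ioc 0 Real.pi → gaugeCount γf y = n + 1 →
      approxNum T n ≤ C * Real.exp (-(α / 2) * Gam γf y) := by
  have hα := h.pos
  have hl2 := Real.log_pos one_lt_two
  obtain ⟨C₁, hC₁, hmain⟩ := h.exists_approxNum_le hγ hc hψ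
  obtain ⟨C₂, hC₂, hsq⟩ := hγ.exists_sq_le_gaugeCount hlog
  set B := C₁ * (C₂ + (Real.log 2)⁻¹) with hB
  have hB0 : 0 < B := by positivity
  have hcount : ∀ k₁ : ℕ, C₁ * ((k₁ : ℝ) ^ 2 + ∑ k ∈ Finset.range k₁,
      (γf ((1 / 2) ^ (k + 2)) / (1 / 2) ^ (k + 2))⁻¹) ≤
        B * gaugeCount γf ((1 / 2) ^ (k₁ + 2)) := fun k₁ => by
    have h1 := hγ.sum_invQuot_le (show 2 ≤ k₁ + 2 by omega)
    have h2 := hγ.gaugeCount_nonneg (half_pow_pos 2) (half_pow_mem 2).2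
    have h3 : ∑ k ∈ Finset.Ico 2 (k₁ + 2), invQuot γf k =
        ∑ k ∈ Finset.range k₁, (γf ((1 / 2) ^ (k + 2)) / (1 / 2) ^ (k + 2))⁻¹ := by
      rw [Finset.sum_Ico_eq_sum_range]
      refine Finset.sum_congr (by simp) fun k _ => ?_
      rw [add_comm 2 k]; rfl
    rw [h3] at h1
    have h4 : ∑ k ∈ Finset.range k₁, (γf ((1 / 2) ^ (k + 2)) / (1 / 2) ^ (k + 2))⁻¹ ≤
        (Real.log 2)⁻¹ * gaugeCount γf ((1 / 2) ^ (k₁ + 2)) := by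
      rw [← div_eq_inv_mul, le_div_iff₀ hl2]
      linarith
    calc _ ≤ C₁ * (C₂ * gaugeCount γf ((1 / 2) ^ (k₁ + 2)) +
          (Real.log 2)⁻¹ * gaugeCount γf ((1 / 2) ^ (k₁ + 2))) := by
          gcongr
          exact hsq k₁
      _ = _ := by rw [hB]; ring
  have hone : ∀ k, 1 ≤ 2 * gaugeCount γf ((1 / 2) ^ (k + 2)) := fun k => by
    have h1 := hγ.mul_log_two_le_gaugeCount (k + 2)
    have h2 := Real.log_two_gt_d9
    push_cast at h1
    have h3 : (0 : ℝ) ≤ k := Nat.cast_nonneg k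
    nlinarith
  have hcmp : ∀ (n k : ℕ) (y : ℝ), y ∈ Ioc 0 Real.pi → gaugeCount γf y = n + 1 →
      n < B * gaugeCount γf ((1 / 2) ^ (k + 2)) →
      Gam γf y ≤ Gam γf ((1 / 2) ^ (k + 2)) + (B + 2) * C₀ := fun n k y hy hyn hn => by
    refine hγ.Gam_le_add_of_gaugeCount_le hC₀ hlog (half_pow_mem _) hy (by linarith) ?_
    rw [hyn]
    linarith [hone k]
  have hex : ∀ n : ℕ, ∃ k : ℕ, (n : ℝ) < B * gaugeCount γf ((1 / 2) ^ (k + 2)) := fun n => by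
    obtain ⟨k, hk⟩ := exists_nat_gt (n / (B * Real.log 2))
    rw [div_lt_iff₀ (by positivity)] at hk
    refine ⟨k, hk.trans_le ?_⟩
    have h1 := hγ.mul_log_two_le_gaugeCount (k + 2)
    push_cast at h1
    have := mul_le_mul_of_nonneg_left h1 hB0.le
    nlinarith [mul_pos hB0 hl2]
  set E := (B + 2) * C₀ + 3 * Real.log 2 with hE
  set G := Gam γf ((1 / 2) ^ (1 + 2)) with hG
  refine ⟨C₁ * Real.exp (α / 2 * E) + ‖T‖ * Real.exp (α / 2 * (G + (B + 2) * C₀)), by positivity,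
    fun n y hy hyn => ?_⟩
  classical
  set K := Nat.find (hex n) with hK
  have hKs := Nat.find_spec (hex n)
  rw [← hK] at hKs
  have hty := Real.exp_pos (-(α / 2) * Gam γf y)
  rw [add_mul]
  rcases Nat.lt_or_ge K 2 with hK2 | hK2
  · have h1 : (n : ℝ) < B * gaugeCount γf ((1 / 2) ^ (1 + 2)) := by
      refine hKs.trans_le ?_
      refine mul_le_mul_of_nonneg_left ?_ hB0.le
      exact hγ.gaugeCount_anti (half_pow_pos _) (half_pow_anti (by omega)) (half_pow_mem _).2
    have h2 := hcmp n 1 y hy hyn h1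
    have h3 : approxNum T n ≤ ‖T‖ * Real.exp (α / 2 * (G + (B + 2) * C₀)) *
        Real.exp (-(α / 2) * Gam γf y) := by
      refine (approxNum_le_norm T n).trans ?_
      rw [mul_assoc, ← Real.exp_add]
      refine le_mul_of_one_le_right (norm_nonneg _) (Real.one_le_exp ?_)
      nlinarith
    have h4 : 0 ≤ C₁ * Real.exp (α / 2 * E) * Real.exp (-(α / 2) * Gam γf y) := by positivity
    linarith
  · have h1 : B * gaugeCount γf ((1 / 2) ^ (K - 1 + 2)) ≤ n :=
      not_lt.1 (Nat.find_min (hex n) (show K - 1 < K by omega))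
    have h2 := hmain (K - 1) (by omega) n ((hcount (K - 1)).trans h1)
    have h3 := hcmp n K y hy hyn hKs
    have h4 := hγ.Gam_half_pow_add_le (K - 1) 3
    rw [show K - 1 + 3 = K + 2 by omega] at h4
    have h5 : C₁ * Real.exp (-(α / 2) * Gam γf ((1 / 2) ^ (K - 1))) ≤
        C₁ * Real.exp (α / 2 * E) * Real.exp (-(α / 2) * Gam γf y) := by
      rw [mul_assoc, ← Real.exp_add]
      refine mul_le_mul_of_nonneg_left (Real.exp_le_exp.2 ?_) hC₁.le
      push_cast at h4
      nlinarith
    have h6 : 0 ≤ ‖T‖ * Real.exp (α / 2 * (G + (B + 2) * C₀)) *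
        Real.exp (-(α / 2) * Gam γf y) := by positivity
    linarith

lemma IsCompData.exists_exp_le_approxNum (h : IsCompData α Ω φ ψ e1 T) (hγ : IsGauge γf)
    (hc : IsCuspDomain γf Ω ρ₁) (hψ : IsInverseMap Ω ψ δ) {C₀ : ℝ} (hC₀ : 0 ≤ C₀)
    (hlog : ∀ t ∈ Ioc 0 Real.pi, γf t / t * Real.log (Real.pi / t) ≤ C₀) :
    ∃ c > 0, ∀ (n : ℕ) (y : ℝ), y ∈ Ioc 0 Real.pi → gaugeCount γf y = n + 1 →
      c * Real.exp (-(α / 2) * Gam γf y) ≤ approxNum T n := by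
  have hα := h.pos
  have hl2 := Real.log_pos one_lt_two
  obtain ⟨c, hc0, C, hC, k₀, hmain⟩ := h.exists_scale_le_approxNum hγ hc hψ
  have hnn : ∀ k, 0 ≤ invQuot γf k := fun k => zero_le_one.trans (hγ.one_le_invQuot k)
  have hex : ∀ n : ℕ, ∃ k : ℕ, C * n ≤ ∑ j ∈ Finset.Ico k₀ (k₀ + k + 1), invQuot γf j :=
    fun n => by
      obtain ⟨k, hk⟩ := exists_nat_ge (C * n)
      refine ⟨k, hk.trans ?_⟩
      have := Finset.sum_le_sum (s := Finset.Ico k₀ (k₀ + k + 1)) fun j _ => hγ.one_le_invQuot j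
      rw [Finset.sum_const, Nat.card_Ico, nsmul_eq_mul, show k₀ + k + 1 - k₀ = k + 1 by omega] at this
      push_cast at this
      linarith
  set N₀ := gaugeCount γf ((1 / 2) ^ k₀) with hN₀
  have hN₀0 : 0 ≤ N₀ := hγ.gaugeCount_nonneg (half_pow_pos _) (half_pow_mem _).2
  set B := N₀ + C + 1 with hB
  set G := Gam γf ((1 / 2) ^ (k₀ + 2)) with hG
  set E₁ := α / 2 * (B * C₀ + 3 * Real.log 2) with hE₁
  set E₂ := α / 2 * (G - Gam γf Real.pi) with hE₂
  refine ⟨c * (Real.exp (-E₁) * Real.exp (-E₂)), by positivity, fun n y hy hyn => ?_⟩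
  have hpi := Real.pi_gt_three
  have hE₁0 : 0 ≤ E₁ := by positivity
  have hE₂0 : 0 ≤ E₂ := by
    have := hγ.Gam_anti (half_pow_pos (k₀ + 2)) (half_pow_mem _).2 le_rfl
    have : 0 ≤ G - Gam γf Real.pi := by linarith
    positivity
  classical
  set K := Nat.find (hex n) with hK
  have hKs := Nat.find_spec (hex n)
  rw [← hK] at hKs
  refine le_trans ?_ (hmain (k₀ + K) (by omega) n hKs)
  rw [mul_assoc, ← Real.exp_add, ← Real.exp_add]
  refine mul_le_mul_of_nonneg_left (Real.exp_le_exp.2 ?_) hc0.le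
  rcases Nat.eq_zero_or_pos K with h0 | h0
  · rw [h0, add_zero, ← hG]
    have := hγ.Gam_anti hy.1 hy.2 le_rfl
    nlinarith
  · have h1 : ∑ j ∈ Finset.Ico k₀ (k₀ + (K - 1) + 1), invQuot γf j < C * n :=
      not_le.1 (Nat.find_min (hex n) (show K - 1 < K by omega))
    have h2 := hγ.gaugeCount_sub_le_sum (show k₀ ≤ k₀ + (K - 1) by omega)
    have h3 : ∑ k ∈ Finset.Ico k₀ (k₀ + (K - 1)), invQuot γf (k + 1) ≤
        ∑ j ∈ Finset.Ico k₀ (k₀ + (K - 1) + 1), invQuot γf j := by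
      rw [Finset.sum_Ico_add' (fun k => invQuot γf k)]
      exact Finset.sum_le_sum_of_subset_of_nonneg
        (Finset.Ico_subset_Ico (by omega) le_rfl) fun j _ _ => hnn j
    have h4 : gaugeCount γf ((1 / 2) ^ (k₀ + (K - 1))) ≤ B * gaugeCount γf y := by
      rw [hyn, hB]
      have h5 : Real.log 2 * ∑ k ∈ Finset.Ico k₀ (k₀ + (K - 1)), invQuot γf (k + 1) ≤ C * n := by
        have := Finset.sum_nonneg (s := Finset.Ico k₀ (k₀ + (K - 1)))
          fun k _ => hnn (k + 1)
        have := Real.log_two_lt_d9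
        nlinarith
      have h6 : (0 : ℝ) ≤ n := Nat.cast_nonneg n
      nlinarith
    have h5 := hγ.Gam_le_add_of_gaugeCount_le hC₀ hlog hy (half_pow_mem _) (by linarith) h4
    have h6 := hγ.Gam_half_pow_add_le (k₀ + (K - 1)) 3
    rw [show k₀ + (K - 1) + 3 = k₀ + K + 2 by omega] at h6
    push_cast at h6
    nlinarith

end DecayRates

lemma exists_isInverseMap {φ : ℂ → ℂ} {Ω : Set ℂ} (hΩ : IsOpen Ω)
    (hφd : DifferentiableOn ℂ φ (ball (0 : ℂ) 1)) (hφi : InjOn φ (ball (0 : ℂ) 1))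
    (hφim : φ '' ball (0 : ℂ) 1 = Ω) (hφ0 : φ 0 = 0) :
    ∃ ψ δ, IsInverseMap Ω ψ δ ∧ ∀ z ∈ ball (0 : ℂ) 1, ψ (φ z) = z := by
  obtain ⟨ψ, hψd, hψΩ, hψl, hψt⟩ := exists_conformal_inverse hφd hφi hφim
  have h0 : ContinuousAt φ 0 :=
    (hφd.differentiableAt (isOpen_ball.mem_nhds (by simp))).continuousAt
  obtain ⟨δ, hδ, hδb⟩ := Metric.continuousAt_iff.1 h0 (1 / 2) (by norm_num)
  refine ⟨ψ, δ, ⟨hΩ, hψd, fun w hw => by simpa using (hψΩ w hw).1, fun w hw hw0 he => ?_, hψt, hδ,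
    fun w hw hw1 => ?_⟩, hψl⟩
  · have := (hψΩ w hw).2
    rw [he, hφ0] at this
    exact hw0 this.symm
  · by_contra! hlt
    have := hδb (x := ψ w) (by simpa using hlt)
    rw [(hψΩ w hw).2, hφ0, dist_zero_right] at this
    linarith

/-- **Theorem D.** Let `α > 0`, `γ : (0,π] → (0,1]` differentiable increasing with
`γ(0⁺) = 0`, `γ(t)/t` increasing, `γ′(t) = O(γ(t)/t)` and `γ(t) = O(t/log^β(1/t))` for
some `β > 1/2`.  Let `Ω ⊆ 𝔻` be a simply connected domain containing `0` with
`∂Ω ∩ ∂𝔻 = {1}` and boundary polar equation `1 − r = γ(|θ|)` near `1`, and let `φ` be a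
conformal map of `𝔻` onto `Ω` with `φ(0) = 0`.  Suppose `∫_0 γ(t)/t² dt = ∞`.  Then:
(1) if `γ(t)log(1/t)/t → ∞`, then `s_n(C_φ,ℋ_α) = O(n^{−A})` for every `A > 0`;
(2) if `γ(t)log(1/t)/t = O(1)`, then `s_n(C_φ,ℋ_α) ≍ exp(−(α/2)Γ(x_n))` where
`∫_{x_n}^π dt/γ(t) = n` (here `approxNum Cφ n = s_{n+1}(C_φ,ℋ_α)`). -/
theorem theoremD (α : ℝ) (hα : 0 < α)
    (γf : ℝ → ℝ)
    (hγ_mem : ∀ t ∈ Ioc (0 : ℝ) Real.pi, γf t ∈ Ioc (0 : ℝ) 1)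
    (hγ_diff : ∀ t ∈ Ioc (0 : ℝ) Real.pi, DifferentiableAt ℝ γf t)
    (hγ_mono : MonotoneOn γf (Ioc 0 Real.pi))
    (hγ_zero : Tendsto γf (𝓝[>] (0 : ℝ)) (𝓝 0))
    (hγ_quot : MonotoneOn (fun t => γf t / t) (Ioc 0 Real.pi))
    (hγ_deriv : ∃ C : ℝ, ∀ᶠ t in 𝓝[>] (0 : ℝ), |deriv γf t| ≤ C * (γf t / t))
    (hγ_log : ∃ β > (1 / 2 : ℝ), ∃ C : ℝ, ∀ᶠ t in 𝓝[>] (0 : ℝ),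
      γf t ≤ C * (t / Real.log (1 / t) ^ β))
    (Ω : Set ℂ) (hΩ_open : IsOpen Ω) (hΩ_sub : Ω ⊆ ball (0 : ℂ) 1)
    (hΩ_zero : (0 : ℂ) ∈ Ω) (hΩ_conn : IsConnected Ω) (hΩ_sc : SimplyConnectedSpace ↥Ω)
    (hΩ_bd : frontier Ω ∩ frontier (ball (0 : ℂ) 1) = {1})
    (hΩ_polar : ∃ ε > 0, ∀ r θ : ℝ, |1 - r| < ε → |θ| < ε →
      (((r : ℂ) * Complex.exp (θ * Complex.I) ∈ frontier Ω) ↔ 1 - r = γf |θ|))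
    (φ : ℂ → ℂ) (hφd : DifferentiableOn ℂ φ (ball (0 : ℂ) 1))
    (hφi : InjOn φ (ball (0 : ℂ) 1)) (hφim : φ '' ball (0 : ℂ) 1 = Ω) (hφ0 : φ 0 = 0)
    (hdiv : Tendsto (fun t => ∫ s in t..(1 : ℝ), γf s / s ^ 2) (𝓝[>] (0 : ℝ)) atTop)
    {H1 : Type} [NormedAddCommGroup H1] [InnerProductSpace ℂ H1] [CompleteSpace H1]
    (e1 : H1 →ₗ[ℂ] (ℂ → ℂ))
    (hH1 : IsHSpace (fun w => Real.sqrt (((α + 1) / Real.pi) * (1 - ‖w‖ ^ 2) ^ α)) e1)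
    (Cφ : H1 →L[ℂ] H1) (hCφ : ∀ f : H1, ∀ z ∈ ball (0 : ℂ) 1, e1 (Cφ f) z = e1 f (φ z)) :
    (Tendsto (fun t => γf t * Real.log (1 / t) / t) (𝓝[>] (0 : ℝ)) atTop →
      ∀ A > 0, ∃ C > 0, ∀ n : ℕ, approxNum Cφ n ≤ C / (n + 1 : ℝ) ^ A) ∧
    ((∃ C : ℝ, ∀ᶠ t in 𝓝[>] (0 : ℝ), γf t * Real.log (1 / t) / t ≤ C) →
      ∀ x : ℕ → ℝ, ∀ N₀ : ℕ,
        (∀ n : ℕ, N₀ ≤ n → x n ∈ Ioo (0 : ℝ) Real.pi ∧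
          (∫ t in (x n)..Real.pi, 1 / γf t) = n) →
        ∃ c > 0, ∃ C > 0, ∀ n : ℕ, N₀ ≤ n + 1 →
          c * Real.exp (-(α / 2) * Gam γf (x (n + 1))) ≤ approxNum Cφ n ∧
          approxNum Cφ n ≤ C * Real.exp (-(α / 2) * Gam γf (x (n + 1)))) := by
  have hγ0 : γf 0 = 0 := by
    obtain ⟨ε, hε, hpol⟩ := hΩ_polar
    have h1 : (1 : ℂ) ∈ frontier Ω := by
      have : (1 : ℂ) ∈ frontier Ω ∩ frontier (ball (0 : ℂ) 1) := by rw [hΩ_bd]; rfl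
      exact this.1
    have h2 := (hpol 1 0 (by simpa using hε) (by simpa using hε)).1 (by simpa using h1)
    simpa using h2.symm
  have hγ := isGauge_of_hypotheses hγ_mem hγ_diff hγ_zero hγ_quot hγ_log hγ0
  obtain ⟨ρ₁, hc⟩ := exists_isCuspDomain hγ hΩ_open hΩ_sub hΩ_bd hΩ_polar
  obtain ⟨ψ, δ, hψ, hψl⟩ := exists_isInverseMap hΩ_open hφd hφi hφim hφ0
  have hdata : IsCompData α Ω φ ψ e1 Cφ :=
    ⟨hα, hH1, hCφ, hφd, hφi, hφim, hφ0, hΩ_sub, hΩ_open, hψl⟩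
  refine ⟨fun hl A hA => ?_, fun hb x N₀ hx => ?_⟩
  · exact_mod_cast hdata.exists_approxNum_le_rpow hγ hc hψ hl (A := A) (by exact_mod_cast hA)
  · obtain ⟨C₀, hC₀, hlog⟩ := hγ.exists_mul_log_le hb
    obtain ⟨C, hC, hupper⟩ := hdata.exists_approxNum_le_exp hγ hc hψ hC₀ hlog
    obtain ⟨c, hc0, hlower⟩ := hdata.exists_exp_le_approxNum hγ hc hψ hC₀ hlog
    refine ⟨c, hc0, C, hC, fun n hn => ?_⟩
    obtain ⟨hxm, hxn⟩ := hx (n + 1) hn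
    have hN : gaugeCount γf (x (n + 1)) = n + 1 := by
      rw [gaugeCount, hxn]; push_cast; rfl
    exact ⟨hlower n _ ⟨hxm.1, hxm.2.le⟩ hN, hupper n _ ⟨hxm.1, hxm.2.le⟩ hN⟩

end
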